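/- Let f be a 2π-periodic complex-valued continuous function on ℝ. For every ε > 0 there exist a Borel set E ⊆ [0,2π] with Lebesgue measure |E| ≤ ε and a positive integer N₀ such that for all x ∈ [0,2π] \ E and all integers N > N₀ one has |f(x) − S_N f(x)| ≤ ε. -/

import Mathlib

open MeasureTheory
open scoped Real ENNReal

/-- The `N`-th partial Fourier sum of a `2π`-periodic function `f`,
`S_N f(x) = ∑_{n=-N}^{N} f̂_n e^{inx}` with `f̂_n = (1/2π) ∫₀^{2π} f(y) e^{-iny} dy`. -/
noncomputable def partialFourierSum (N : ℕ) (f : ℝ → ℂ) (x : ℝ) : ℂ :=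
  ∑ n ∈ Finset.Icc (-(N : ℤ)) (N : ℤ),
    ((((2 * π)⁻¹ : ℝ) : ℂ) *
        ∫ y in (0 : ℝ)..(2 * π), f y * Complex.exp (-(Complex.I * (n : ℂ) * (y : ℂ)))) *
      Complex.exp (Complex.I * (n : ℂ) * (x : ℂ))


section
open MeasureTheory
open scoped Real ENNReal

namespace CarlesonProof

/-- The basic weight `W t = 1/(1+t^2)`. -/
noncomputable def W (t : ℝ) : ℝ := (1 + t ^ 2)⁻¹

lemma W_pos (t : ℝ) : 0 < W t := by unfold W; positivity
lemma W_nonneg (t : ℝ) : 0 ≤ W t := (W_pos t).le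
lemma W_le_one (t : ℝ) : W t ≤ 1 := by
  unfold W; exact inv_le_one_of_one_le₀ (by nlinarith [sq_nonneg t])
@[simp] lemma W_neg (t : ℝ) : W (-t) = W t := by simp [W]
lemma W_sub_comm (a b : ℝ) : W (a - b) = W (b - a) := by rw [← W_neg]; congr 1; ring
lemma W_continuous : Continuous W := by
  unfold W
  exact Continuous.inv₀ (by fun_prop) (fun x => by positivity)
lemma W_integrable : Integrable W := by
  unfold W; exact integrable_inv_one_add_sq
lemma W_integral : ∫ t, W t = π := by
  unfold W; exact integral_univ_inv_one_add_sq
lemma W_anti {a b : ℝ} (h : |a| ≤ |b|) : W b ≤ W a := by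
  unfold W
  have := sq_le_sq.mpr h
  gcongr
lemma W_inv (t : ℝ) : (W t)⁻¹ = 1 + t ^ 2 := by simp [W]
lemma W_mul_le (a b : ℝ) : W a * W b ≤ 2 * W (a + b) := by
  unfold W
  rw [← mul_inv, ← div_eq_mul_inv, inv_eq_one_div, div_le_div_iff₀ (by positivity) (by positivity)]
  nlinarith [sq_nonneg (a - b), sq_nonneg (a * b)]
lemma W_add_sq_le {p q : ℝ} (hp : 0 ≤ p) (hq : 0 ≤ q) : W (p + q) ^ 2 ≤ W p * W q := by
  have h1 : W (p + q) ≤ W p := W_anti (by rw [abs_of_nonneg hp, abs_of_nonneg (by positivity)]; linarith)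
  have h2 : W (p + q) ≤ W q := W_anti (by rw [abs_of_nonneg hq, abs_of_nonneg (by positivity)]; linarith)
  rw [sq]
  exact mul_le_mul h1 h2 (W_nonneg _) (W_nonneg _)
lemma W_shift {t h : ℝ} (hh : |h| ≤ 1) : W (t + h) ≤ 3 * W t := by
  unfold W
  rw [← div_eq_mul_inv, inv_eq_one_div, div_le_div_iff₀ (by positivity) (by positivity)]
  have := (sq_le_one_iff_abs_le_one h).mpr hh
  nlinarith [sq_nonneg (t + 2 * h)]
lemma W_pow_le {t : ℝ} {a b : ℕ} (h : a ≤ b) : W t ^ b ≤ W t ^ a :=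
  pow_le_pow_of_le_one (W_nonneg t) (W_le_one t) h
lemma W_pow_le_self {t : ℝ} {b : ℕ} (h : 1 ≤ b) : W t ^ b ≤ W t := by
  simpa using W_pow_le (t := t) h
lemma W_le_inv_sq {t : ℝ} (ht : 0 < t) : W t ≤ 1 / t ^ 2 := by
  unfold W; rw [inv_eq_one_div]; gcongr; linarith

lemma W_scale_integrable {R : ℝ} (hR : 0 < R) (c : ℝ) : Integrable (fun u => W (R * (c - u))) := by
  have h1 : Integrable (fun u => W (R * u)) := W_integrable.comp_mul_left' hR.ne'
  exact h1.comp_sub_left c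
lemma W_scale_integral {R : ℝ} (hR : 0 < R) (c : ℝ) : ∫ u, W (R * (c - u)) = π / R := by
  rw [integral_sub_left_eq_self (fun u => W (R * u)) volume c, Measure.integral_comp_mul_left,
    W_integral, abs_of_pos (inv_pos.mpr hR), smul_eq_mul]
  ring

lemma W_scale_pow_integrable {R : ℝ} (hR : 0 < R) (c : ℝ) {k : ℕ} (hk : 1 ≤ k) :
    Integrable (fun u => W (R * (c - u)) ^ k) := by
  refine (W_scale_integrable hR c).mono' ?_ ?_
  · exact (Continuous.pow (W_continuous.comp (by fun_prop)) k).aestronglyMeasurable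
  · refine Filter.Eventually.of_forall fun u => ?_
    rw [Real.norm_of_nonneg (pow_nonneg (W_nonneg _) _)]
    exact W_pow_le_self hk

lemma W_scale_pow_integral_le {R : ℝ} (hR : 0 < R) (c : ℝ) {k : ℕ} (hk : 1 ≤ k) :
    ∫ u, W (R * (c - u)) ^ k ≤ π / R := by
  rw [← W_scale_integral hR c]
  exact integral_mono (W_scale_pow_integrable hR c hk) (W_scale_integrable hR c)
    (fun u => W_pow_le_self hk)

/-- pointwise version of the two-bump estimate -/
lemma P2_point {R R' : ℝ} (hR : 0 < R) (h : R ≤ R') (x x' u : ℝ) :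
    (R * W (R * (x - u)) ^ 3) * (R' * W (R' * (x' - u)) ^ 3) ≤
      (4 * R * W (R * (x - x')) ^ 2) * (R' * W (R' * (x' - u))) := by
  have hR' : 0 < R' := lt_of_lt_of_le hR h
  set a := W (R * (x - u)) with ha
  set b := W (R' * (x' - u)) with hb
  have h1 : b ≤ W (R * (u - x')) := by
    rw [hb, ← W_neg (R * (u - x'))]
    apply W_anti
    have : -(R * (u - x')) = R * (x' - u) := by ring
    rw [this, abs_mul, abs_mul, abs_of_pos hR, abs_of_pos hR']
    gcongr
  have h2 : a * b ≤ 2 * W (R * (x - x')) := by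
    calc a * b ≤ a * W (R * (u - x')) := by gcongr; exact W_nonneg _
      _ ≤ 2 * W (R * (x - u) + R * (u - x')) := W_mul_le _ _
      _ = _ := by congr 2; ring
  have a0 : 0 ≤ a := W_nonneg _
  have b0 : 0 ≤ b := W_nonneg _
  have a1 : a ≤ 1 := W_le_one _
  calc (R * a ^ 3) * (R' * b ^ 3) = R * R' * ((a * b) ^ 2 * (a * b)) := by ring
    _ ≤ R * R' * ((2 * W (R * (x - x'))) ^ 2 * (1 * b)) := by gcongr
    _ = _ := by ring

lemma P2_integral {R R' : ℝ} (hR : 0 < R) (h : R ≤ R') (x x' : ℝ) :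
    ∫ u, (R * W (R * (x - u)) ^ 3) * (R' * W (R' * (x' - u)) ^ 3) ≤
      4 * π * R * W (R * (x - x')) ^ 2 := by
  have hR' : 0 < R' := lt_of_lt_of_le hR h
  calc ∫ u, (R * W (R * (x - u)) ^ 3) * (R' * W (R' * (x' - u)) ^ 3)
      ≤ ∫ u, (4 * R * W (R * (x - x')) ^ 2) * (R' * W (R' * (x' - u))) := by
        refine integral_mono_of_nonneg ?_ ?_ ?_
        · refine Filter.Eventually.of_forall fun u => ?_
          have := W_nonneg (R * (x - u)); have := W_nonneg (R' * (x' - u))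
          positivity
        · exact ((W_scale_integrable hR' x').const_mul _).const_mul _
        · exact Filter.Eventually.of_forall fun u => P2_point hR h x x' u
    _ = _ := by
        rw [integral_const_mul, integral_const_mul, W_scale_integral hR']
        field_simp

/-- Sum over disjoint short intervals against the weight. -/
lemma SUMW {ι : Type*} (s : Finset ι) (p q x : ι → ℝ) {R : ℝ} (hR : 0 < R) (c : ℝ)
    (hpx : ∀ k ∈ s, p k ≤ x k) (hxq : ∀ k ∈ s, x k ≤ q k) (hlen : ∀ k ∈ s, q k - p k ≤ 1 / R)
    (hdis : (s : Set ι).PairwiseDisjoint (fun k => Set.Ico (p k) (q k))) :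
    ∑ k ∈ s, (q k - p k) * W (R * (c - x k)) ≤ 3 * π / R := by
  have hint := (W_scale_integrable hR c).const_mul 3
  calc ∑ k ∈ s, (q k - p k) * W (R * (c - x k))
      ≤ ∑ k ∈ s, ∫ u in Set.Ico (p k) (q k), 3 * W (R * (c - u)) := by
        refine Finset.sum_le_sum fun k hk => ?_
        have h1 : ∫ u in Set.Ico (p k) (q k), W (R * (c - x k)) = (q k - p k) * W (R * (c - x k)) := by
          rw [setIntegral_const, Measure.real, Real.volume_Ico, ENNReal.toReal_ofReal, smul_eq_mul]
          linarith [hpx k hk, hxq k hk]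
        rw [← h1]
        refine setIntegral_mono_on ?_ hint.integrableOn measurableSet_Ico ?_
        · exact (integrableOn_const (by simp) (by simp))
        · intro u hu
          have : R * (c - x k) = R * (c - u) + R * (u - x k) := by ring
          rw [this]
          apply W_shift
          rw [abs_mul, abs_of_pos hR]
          have h2 := hlen k hk
          have h3 := hpx k hk
          have h4 := hxq k hk
          have : |u - x k| ≤ 1 / R := by
            rw [abs_le]; constructor <;> linarith [hu.1, hu.2]
          calc R * |u - x k| ≤ R * (1 / R) := by gcongr
            _ = 1 := by field_simp
    _ = ∫ u in ⋃ k ∈ s, Set.Ico (p k) (q k), 3 * W (R * (c - u)) := by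
        rw [integral_biUnion_finset s (fun _ _ => measurableSet_Ico) hdis (fun k _ => hint.integrableOn)]
    _ ≤ ∫ u, 3 * W (R * (c - u)) := by
        refine setIntegral_le_integral hint (Filter.Eventually.of_forall fun u => ?_)
        have := W_nonneg (R * (c - u)); simp only [Pi.zero_apply]; positivity
    _ = 3 * π / R := by
        rw [integral_const_mul, W_scale_integral hR]; ring

end CarlesonProof

end


section
open MeasureTheory
open scoped Real ENNReal FourierTransform ContDiff

set_option linter.unusedSimpArgs false
namespace CarlesonProof

/-- `e t = exp (2 π i t)`. -/
noncomputable def e (t : ℝ) : ℂ := Complex.exp (((2 * π * t : ℝ) : ℂ) * Complex.I)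

@[simp] lemma norm_e (t : ℝ) : ‖e t‖ = 1 := by unfold e; exact Complex.norm_exp_ofReal_mul_I _
lemma e_add (a b : ℝ) : e (a + b) = e a * e b := by
  unfold e; rw [← Complex.exp_add]; congr 1; push_cast; ring
@[simp] lemma e_zero : e 0 = 1 := by simp [e]
lemma e_int (n : ℤ) : e n = 1 := by
  unfold e; rw [Complex.exp_eq_one_iff]; exact ⟨n, by push_cast; ring⟩
lemma e_neg_mul (a : ℝ) : e (-a) * e a = 1 := by rw [← e_add]; simp
lemma e_conj (a : ℝ) : (starRingEnd ℂ) (e a) = e (-a) := by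
  unfold e; rw [← Complex.exp_conj]; congr 1
  rw [map_mul, Complex.conj_ofReal, Complex.conj_I]; push_cast; ring
@[fun_prop] lemma e_continuous : Continuous e := by unfold e; fun_prop
lemma e_ne_zero (a : ℝ) : e a ≠ 0 := Complex.exp_ne_zero _
lemma e_sub_le (a b : ℝ) : ‖e a - e b‖ ≤ 2 * π * |a - b| := by
  have : e a - e b = e b * (e (a - b) - 1) := by
    rw [mul_sub, ← e_add]; simp
  rw [this, norm_mul, norm_e, one_mul]
  unfold e
  have := Real.norm_exp_I_mul_ofReal_sub_one_le (x := 2 * π * (a - b))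
  rw [mul_comm Complex.I] at this
  refine this.trans (le_of_eq ?_)
  rw [Real.norm_eq_abs, abs_mul, abs_of_pos (by positivity)]

/-- Inverse Fourier integral. -/
noncomputable def FI (φ : ℝ → ℂ) (η : ℝ) : ℂ := ∫ y, e (y * η) * φ y

lemma FI_eq (φ : ℝ → ℂ) : FI φ = 𝓕⁻ φ := by
  ext η; rw [FI, Real.fourierInv_eq']
  congr 1; ext v
  simp only [e, smul_eq_mul, Real.inner_apply, conj_trivial]

lemma parseval {φ φ' : ℝ → ℂ} (hφ : Integrable φ) (hc' : Continuous φ')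
    (hφ' : Integrable φ') (hF' : Integrable (FI φ')) :
    ∫ x, φ x * (starRingEnd ℂ) (φ' x) = ∫ η, FI φ η * (starRingEnd ℂ) (FI φ' η) := by
  rw [FI_eq] at hF'
  have key := VectorFourier.integral_sesq_fourierIntegral_eq_neg_flip (innerSL ℂ (E := ℂ))
    (L := innerₗ ℝ) Real.continuous_fourierChar continuous_inner hF' hφ
  have inv : 𝓕 (𝓕⁻ φ') = φ' := by
    refine hc'.fourier_fourierInv_eq hφ' ?_
    have h1 := hF'.comp_neg
    refine h1.congr (Filter.Eventually.of_forall fun x => ?_)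
    simp [Real.fourierInv_eq_fourier_neg]
  have h2 : ∀ ξ, VectorFourier.fourierIntegral Real.fourierChar volume (innerₗ ℝ) (𝓕⁻ φ') ξ = φ' ξ := by
    intro ξ; exact congrFun inv ξ
  have h3 : ∀ ξ, VectorFourier.fourierIntegral Real.fourierChar volume (-(innerₗ ℝ).flip) φ ξ
      = FI φ ξ := by
    intro ξ
    rw [FI_eq, Real.fourierInv_eq]
    simp [VectorFourier.fourierIntegral, Real.inner_apply, mul_comm]
  simp only [h2, h3, innerSL_apply_apply, RCLike.inner_apply] at key
  rw [key, ← FI_eq φ']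

/-- Existence of mother functions. -/
lemma exists_mother (g : ℝ → ℝ) (hg : ContDiff ℝ ∞ g) (hs : HasCompactSupport g) :
    ∃ (ψ : ℝ → ℂ) (C : ℝ), 0 < C ∧ Continuous ψ ∧ (∀ t, ‖ψ t‖ ≤ C * W t ^ 6) ∧
      (∀ t, ψ t = ∫ η, (g η : ℂ) * e (t * η)) ∧ (∀ η, ∫ v, ψ v * e (-(v * η)) = g η) := by
  have hg' : ContDiff ℝ ∞ (fun x => (g x : ℂ)) := Complex.ofRealCLM.contDiff.comp hg
  have hs' : HasCompactSupport (fun x => (g x : ℂ)) := hs.comp_left (g := fun x : ℝ => (x : ℂ)) (by simp)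
  let G : SchwartzMap ℝ ℂ := hs'.toSchwartzMap hg'
  have hG : ∀ x, G x = (g x : ℂ) := fun x => rfl
  let Ψ : SchwartzMap ℝ ℂ := 𝓕⁻ G
  have hΨ : 𝓕 Ψ = G := by simp [Ψ]
  obtain ⟨C0, hC0, h0⟩ := Ψ.decay 0 0
  obtain ⟨C1, hC1, h1⟩ := Ψ.decay 12 0
  refine ⟨Ψ, 64 * (C0 + C1), by positivity, Ψ.continuous, ?_, ?_, ?_⟩
  · intro t
    have h0 := h0 t
    have h1 := h1 t
    simp only [pow_zero, norm_iteratedFDeriv_zero, one_mul, Real.norm_eq_abs] at h0 h1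
    have h3 : (1 + t ^ 2) ^ 6 ≤ 64 * (1 + |t| ^ 12) := by
      have : |t| ^ 12 = (t ^ 2) ^ 6 := by rw [← sq_abs, ← pow_mul]
      rw [this]
      have h := add_pow_le (a := (1:ℝ)) (b := t ^ 2) (by norm_num) (by positivity) 6
      norm_num at h
      nlinarith [pow_nonneg (sq_nonneg t) 6]
    unfold W
    rw [inv_pow, ← div_eq_mul_inv, le_div_iff₀ (by positivity)]
    calc ‖Ψ t‖ * (1 + t ^ 2) ^ 6 ≤ ‖Ψ t‖ * (64 * (1 + |t| ^ 12)) := by gcongr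
      _ = 64 * (‖Ψ t‖ + |t| ^ 12 * ‖Ψ t‖) := by ring
      _ ≤ _ := by gcongr
  · intro t
    have : Ψ t = 𝓕⁻ (G : ℝ → ℂ) t := by
      simp only [Ψ]; rw [SchwartzMap.fourierInv_coe]
    rw [this, ← FI_eq, FI]
    congr 1; ext v; rw [hG, mul_comm, mul_comm v]
  · intro η
    rw [← hG, ← hΨ, SchwartzMap.fourier_coe, Real.fourier_eq']
    congr 1; ext v
    simp only [e, smul_eq_mul, Real.inner_apply, conj_trivial]
    rw [mul_comm]; congr 3; push_cast; ring

/-- smooth cutoff: `1` for `η ≤ 1/4`, `0` for `η ≥ 1/2`. -/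
noncomputable def Phi (η : ℝ) : ℝ := Real.smoothTransition (2 - 4 * η)
noncomputable def mm (η : ℝ) : ℝ := Phi η - Phi (16 * η)
noncomputable def mt (η : ℝ) : ℝ :=
  Real.smoothTransition (128 * η - 1) * Real.smoothTransition (3 - 4 * η)
noncomputable def mz (η : ℝ) : ℝ :=
  Real.smoothTransition (η + 1) * Real.smoothTransition (4 - η)

lemma Phi_one {η : ℝ} (h : η ≤ 1 / 4) : Phi η = 1 :=
  Real.smoothTransition.one_of_one_le (by linarith)
lemma Phi_zero {η : ℝ} (h : 1 / 2 ≤ η) : Phi η = 0 :=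
  Real.smoothTransition.zero_of_nonpos (by linarith)
lemma Phi_nonneg (η : ℝ) : 0 ≤ Phi η := Real.smoothTransition.nonneg _
lemma Phi_le_one (η : ℝ) : Phi η ≤ 1 := Real.smoothTransition.le_one _
lemma Phi_smooth : ContDiff ℝ ∞ Phi :=
  Real.smoothTransition.contDiff.comp (by fun_prop)
lemma mm_smooth : ContDiff ℝ ∞ mm :=
  Phi_smooth.sub (Phi_smooth.comp (by fun_prop))
lemma mt_smooth : ContDiff ℝ ∞ mt :=
  (Real.smoothTransition.contDiff.comp (by fun_prop)).mul
    (Real.smoothTransition.contDiff.comp (by fun_prop))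
lemma mz_smooth : ContDiff ℝ ∞ mz :=
  (Real.smoothTransition.contDiff.comp (by fun_prop)).mul
    (Real.smoothTransition.contDiff.comp (by fun_prop))
lemma mm_zero_left {η : ℝ} (h : η ≤ 1 / 64) : mm η = 0 := by
  rw [mm, Phi_one (by linarith), Phi_one (by linarith), sub_self]
lemma mm_zero_right {η : ℝ} (h : 1 / 2 ≤ η) : mm η = 0 := by
  rw [mm, Phi_zero (by linarith), Phi_zero (by linarith), sub_self]
lemma mm_abs_le (η : ℝ) : |mm η| ≤ 1 := by
  rw [mm, abs_le]
  constructor <;> linarith [Phi_nonneg η, Phi_le_one η, Phi_nonneg (16 * η), Phi_le_one (16 * η)]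
lemma mt_zero_left {η : ℝ} (h : η ≤ 1 / 128) : mt η = 0 := by
  rw [mt, Real.smoothTransition.zero_of_nonpos (by linarith), zero_mul]
lemma mt_zero_right {η : ℝ} (h : 3 / 4 ≤ η) : mt η = 0 := by
  rw [mt, Real.smoothTransition.zero_of_nonpos (x := 3 - 4 * η) (by linarith), mul_zero]
lemma mt_one {η : ℝ} (h : 1 / 64 ≤ η) (h' : η ≤ 1 / 2) : mt η = 1 := by
  rw [mt, Real.smoothTransition.one_of_one_le (by linarith),
    Real.smoothTransition.one_of_one_le (by linarith), mul_one]
lemma mm_mul_mt (η : ℝ) : mm η * mt η = mm η := by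
  rcases le_total η (1 / 64) with h | h
  · simp [mm_zero_left h]
  rcases le_total (1 / 2) η with h' | h'
  · simp [mm_zero_right h']
  rw [mt_one h h', mul_one]
lemma mz_one {η : ℝ} (h : 0 ≤ η) (h' : η ≤ 3) : mz η = 1 := by
  rw [mz, Real.smoothTransition.one_of_one_le (by linarith),
    Real.smoothTransition.one_of_one_le (by linarith), mul_one]
lemma mz_zero_right {η : ℝ} (h : 4 ≤ η) : mz η = 0 := by
  rw [mz, Real.smoothTransition.zero_of_nonpos (x := 4 - η) (by linarith), mul_zero]
lemma mz_zero_left {η : ℝ} (h : η ≤ -1) : mz η = 0 := by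
  rw [mz, Real.smoothTransition.zero_of_nonpos (by linarith), zero_mul]
lemma hasCompactSupport_of {g : ℝ → ℝ} (a b : ℝ) (h : ∀ x ≤ a, g x = 0) (h' : ∀ x, b ≤ x → g x = 0) :
    HasCompactSupport g := by
  refine HasCompactSupport.intro (isCompact_Icc (a := a) (b := b)) fun x hx => ?_
  by_contra h0
  exact hx ⟨not_lt.mp fun hh => h0 (h x hh.le), not_lt.mp fun hh => h0 (h' x hh.le)⟩
lemma mm_supp : HasCompactSupport mm :=
  hasCompactSupport_of (1 / 64) (1 / 2) (fun _ => mm_zero_left) (fun _ => mm_zero_right)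
lemma mt_supp : HasCompactSupport mt :=
  hasCompactSupport_of (1 / 128) (3 / 4) (fun _ => mt_zero_left) (fun _ => mt_zero_right)
lemma mz_supp : HasCompactSupport mz :=
  hasCompactSupport_of (-1) 4 (fun _ => mz_zero_left) (fun _ => mz_zero_right)

/-- `ψ` is the mother function with Fourier transform `g`. -/
structure Mother (ψ : ℝ → ℂ) (g : ℝ → ℝ) (C : ℝ) : Prop where
  Cpos : 1 ≤ C
  cont : Continuous ψ
  decay : ∀ t, ‖ψ t‖ ≤ C * W t ^ 6
  inv : ∀ t, ψ t = ∫ η, (g η : ℂ) * e (t * η)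
  ft : ∀ η, ∫ v, ψ v * e (-(v * η)) = g η

lemma exists_mothers : ∃ (ψ ψt ζ : ℝ → ℂ) (C : ℝ), Mother ψ mm C ∧ Mother ψt mt C ∧ Mother ζ mz C := by
  obtain ⟨ψ, C1, p1, c1, d1, i1, f1⟩ := exists_mother mm mm_smooth mm_supp
  obtain ⟨ψt, C2, p2, c2, d2, i2, f2⟩ := exists_mother mt mt_smooth mt_supp
  obtain ⟨ζ, C3, p3, c3, d3, i3, f3⟩ := exists_mother mz mz_smooth mz_supp
  refine ⟨ψ, ψt, ζ, C1 + C2 + C3 + 1, ⟨by linarith, c1, fun t => (d1 t).trans ?_, i1, f1⟩,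
    ⟨by linarith, c2, fun t => (d2 t).trans ?_, i2, f2⟩, ⟨by linarith, c3, fun t => (d3 t).trans ?_, i3, f3⟩⟩
  all_goals exact mul_le_mul_of_nonneg_right (by linarith) (pow_nonneg (W_nonneg t) 6)

noncomputable def psi : ℝ → ℂ := exists_mothers.choose
noncomputable def psit : ℝ → ℂ := exists_mothers.choose_spec.choose
noncomputable def zeta : ℝ → ℂ := exists_mothers.choose_spec.choose_spec.choose
/-- common decay constant of the mother functions -/
noncomputable def CM : ℝ := exists_mothers.choose_spec.choose_spec.choose_spec.choose
lemma psi_mother : Mother psi mm CM := exists_mothers.choose_spec.choose_spec.choose_spec.choose_spec.1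
lemma psit_mother : Mother psit mt CM := exists_mothers.choose_spec.choose_spec.choose_spec.choose_spec.2.1
lemma zeta_mother : Mother zeta mz CM := exists_mothers.choose_spec.choose_spec.choose_spec.choose_spec.2.2
lemma CM_one : 1 ≤ CM := psi_mother.Cpos
lemma CM_pos : 0 < CM := lt_of_lt_of_le one_pos CM_one

/-- wave packet -/
noncomputable def pk (ψ : ℝ → ℂ) (R θ x y : ℝ) : ℂ := R * ψ (R * (x - y)) * e (θ * (x - y))

section
variable {ψ : ℝ → ℂ} {g : ℝ → ℝ} {C : ℝ} (M : Mother ψ g C)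
include M

lemma Mother.C0 : 0 < C := lt_of_lt_of_le one_pos M.Cpos
lemma Mother.integrable : Integrable ψ := by
  have h1 : Integrable (fun t => C * W t ^ 6) := by
    have := (W_scale_pow_integrable (R := 1) one_pos 0 (k := 6) (by norm_num)).const_mul C
    simpa using this
  exact h1.mono' M.cont.aestronglyMeasurable (Filter.Eventually.of_forall M.decay)
lemma Mother.pk_cont (R θ x : ℝ) : Continuous (pk ψ R θ x) := by
  have := M.cont
  unfold pk; fun_prop
lemma Mother.pk_cont' (R θ y : ℝ) : Continuous (fun x => pk ψ R θ x y) := by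
  have := M.cont
  unfold pk; fun_prop
lemma Mother.pk_bound {R : ℝ} (hR : 0 < R) (θ x y : ℝ) :
    ‖pk ψ R θ x y‖ ≤ C * (R * W (R * (x - y)) ^ 6) := by
  unfold pk
  rw [norm_mul, norm_e, mul_one, norm_mul, Complex.norm_real, Real.norm_of_nonneg hR.le]
  calc R * ‖ψ (R * (x - y))‖ ≤ R * (C * W (R * (x - y)) ^ 6) := by gcongr; exact M.decay _
    _ = _ := by ring
lemma Mother.pk_bound_le {R : ℝ} (hR : 0 < R) (θ x y : ℝ) {k : ℕ} (hk : k ≤ 6) :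
    ‖pk ψ R θ x y‖ ≤ C * (R * W (R * (x - y)) ^ k) := by
  refine (M.pk_bound hR θ x y).trans ?_
  exact mul_le_mul_of_nonneg_left (mul_le_mul_of_nonneg_left (W_pow_le hk) hR.le) M.C0.le
lemma Mother.pk_integrable {R : ℝ} (hR : 0 < R) (θ x : ℝ) : Integrable (pk ψ R θ x) :=
  (((W_scale_pow_integrable hR x (k := 6) (by norm_num)).const_mul R).const_mul C).mono'
    (M.pk_cont R θ x).aestronglyMeasurable (Filter.Eventually.of_forall (M.pk_bound hR θ x))
lemma Mother.FI_pk {R : ℝ} (hR : 0 < R) (θ x η : ℝ) :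
    FI (pk ψ R θ x) η = e (x * η) * g ((η - θ) / R) := by
  rw [← M.ft, FI, ← integral_const_mul]
  have h1 := integral_sub_left_eq_self (fun y => e ((x - y) * η) * (R * ψ (R * y) * e (θ * y))) volume x
  have h2 : ∀ y, e (y * η) * pk ψ R θ x y = (fun y => e ((x - y) * η) * (R * ψ (R * y) * e (θ * y))) (x - y) := by
    intro y; simp [pk]
  simp_rw [h2]
  rw [h1]
  have h3 := Measure.integral_comp_mul_left (fun v => e (x * η) * (ψ v * e (-(v * ((η - θ) / R))))) R
  have h4 : ∀ y, e ((x - y) * η) * (R * ψ (R * y) * e (θ * y)) =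
      R * (fun v => e (x * η) * (ψ v * e (-(v * ((η - θ) / R))))) (R * y) := by
    intro y
    have : e ((x - y) * η) * e (θ * y) = e (x * η) * e (-(R * y * ((η - θ) / R))) := by
      rw [← e_add, ← e_add]; congr 1; field_simp; ring
    simp only
    calc _ = R * ψ (R * y) * (e ((x - y) * η) * e (θ * y)) := by ring
      _ = _ := by rw [this]; ring
  simp_rw [h4]
  rw [integral_const_mul, h3, abs_of_pos (inv_pos.mpr hR)]
  rw [Complex.real_smul]
  push_cast
  rw [← mul_assoc, mul_inv_cancel₀ (by exact_mod_cast hR.ne'), one_mul]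
end

lemma reproducing_base (t : ℝ) : ∫ v, psi v * psit (t - v) = psi t := by
  have M := psi_mother
  have Mt := psit_mother
  have hh : Integrable (fun η : ℝ => (mt η : ℂ) * e (t * η)) := by
    refine Continuous.integrable_of_hasCompactSupport ?_ ?_
    · have := mt_smooth.continuous
      fun_prop
    · refine HasCompactSupport.mul_right ?_
      exact mt_supp.comp_left (g := fun x : ℝ => (x : ℂ)) (by simp)
  have key := VectorFourier.integral_fourierIntegral_smul_eq_flip (L := innerₗ ℝ) (e := Real.fourierChar)
    (μ := volume) (ν := volume)
    Real.continuous_fourierChar continuous_inner M.integrable hh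
  have h1 : ∀ η, VectorFourier.fourierIntegral Real.fourierChar volume (innerₗ ℝ) psi η = mm η := by
    intro η
    rw [← M.ft]
    change 𝓕 psi η = _
    rw [Real.fourier_eq']
    congr 1; ext v
    simp only [e, smul_eq_mul, Real.inner_apply, conj_trivial]
    rw [mul_comm]; congr 3; push_cast; ring
  have h2 : ∀ v, VectorFourier.fourierIntegral Real.fourierChar volume (innerₗ ℝ).flip
      (fun η : ℝ => (mt η : ℂ) * e (t * η)) v = psit (t - v) := by
    intro v
    rw [Mt.inv, flip_innerₗ]
    change 𝓕 (fun η : ℝ => (mt η : ℂ) * e (t * η)) v = _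
    rw [Real.fourier_eq']
    congr 1; ext η
    have : e ((t - v) * η) = e (-(η * v)) * e (t * η) := by rw [← e_add]; congr 1; ring
    rw [this]
    simp only [e, smul_eq_mul, Real.inner_apply, conj_trivial]
    push_cast
    ring_nf
  simp only [h1, h2, smul_eq_mul] at key
  rw [← key, M.inv]
  congr 1; ext η
  rw [← mul_assoc]; congr 1
  exact_mod_cast mm_mul_mt η

/-- reproducing formula for packets -/
lemma reproducing {R : ℝ} (hR : 0 < R) (ξ x y : ℝ) :
    ∫ u, pk psi R ξ x u * pk psit R ξ u y = pk psi R ξ x y := by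
  have h2 : ∀ u, pk psi R ξ x u * pk psit R ξ u y =
      (R * e (ξ * (x - y))) * ((fun v => (R:ℂ) * (psi (R * v) * psit (R * (x - y) - R * v))) (x - u)) := by
    intro u
    have : e (ξ * (x - y)) = e (ξ * (x - u)) * e (ξ * (u - y)) := by rw [← e_add]; congr 1; ring
    rw [this]
    simp only [pk]
    have : R * (x - y) - R * (x - u) = R * (u - y) := by ring
    rw [this]; ring
  simp_rw [h2]
  rw [integral_const_mul, integral_sub_left_eq_self (fun v => (R:ℂ) * (psi (R * v) * psit (R * (x - y) - R * v))) volume x,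
    integral_const_mul, Measure.integral_comp_mul_left (fun v => psi v * psit (R * (x - y) - v)), reproducing_base,
    abs_of_pos (inv_pos.mpr hR), Complex.real_smul]
  rw [pk]
  push_cast
  have : (R : ℂ) ≠ 0 := by exact_mod_cast hR.ne'
  field_simp

end CarlesonProof

end


section
open MeasureTheory
open scoped Real ENNReal

set_option linter.unusedSectionVars false
namespace CarlesonProof

/-- `dv a k = ⌊a / 256^k⌋`. -/
def dv (a : ℤ) (k : ℕ) : ℤ := a / 256 ^ k

@[simp] lemma dv_zero (a : ℤ) : dv a 0 = a := by simp [dv]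
lemma dv_dv (a : ℤ) (j k : ℕ) : dv (dv a j) k = dv a (j + k) := by
  unfold dv; rw [Int.ediv_ediv_of_nonneg (by positivity), pow_add]
lemma dv_iff (a b : ℤ) (k : ℕ) : dv a k = b ↔ b * 256 ^ k ≤ a ∧ a < (b + 1) * 256 ^ k := by
  unfold dv
  rw [Int.ediv_eq_iff_of_pos (by positivity), add_mul, one_mul]
lemma dv_le (a : ℤ) (k : ℕ) : dv a k * 256 ^ k ≤ a := ((dv_iff a _ k).1 rfl).1
lemma dv_lt (a : ℤ) (k : ℕ) : a < (dv a k + 1) * 256 ^ k := ((dv_iff a _ k).1 rfl).2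
lemma dv_of (a b : ℤ) (k : ℕ) (h : a = 256 ^ k * b) : dv a k = b := by
  unfold dv; rw [h]; exact Int.mul_ediv_cancel_left _ (by positivity)

/-- scale -/
noncomputable def R (r : ℕ) (n : ℕ) : ℝ := r * 256 ^ n

variable (r : ℕ) [NeZero r]

lemma R_pos (n : ℕ) : 0 < R r n := by
  have : (0:ℝ) < r := by exact_mod_cast Nat.pos_of_ne_zero (NeZero.ne r)
  unfold R; positivity
lemma R_add (n k : ℕ) : R r (n + k) = R r n * 256 ^ k := by unfold R; rw [pow_add]; ring
lemma R_succ (n : ℕ) : R r (n + 1) = R r n * 256 := by simpa using R_add r n 1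
lemma R_mono {a b : ℕ} (h : a ≤ b) : R r a ≤ R r b := by
  have := R_pos r 0
  unfold R at *; simp at this; gcongr; norm_num
lemma R_sub {a b : ℕ} (h : a ≤ b) : R r b = R r a * 256 ^ (b - a) := by
  rw [← R_add]; congr 1; omega

/-- time coordinate -/
noncomputable def X (n : ℕ) (x : ℝ) : ℤ := ⌊R r n * x⌋
/-- frequency coordinate -/
noncomputable def F (n : ℕ) (η : ℝ) : ℤ := ⌊η / R r n⌋

lemma X_iff (n : ℕ) (x : ℝ) (i : ℤ) : X r n x = i ↔ i ≤ R r n * x ∧ R r n * x < i + 1 := by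
  unfold X; exact Int.floor_eq_iff
lemma F_iff (n : ℕ) (x : ℝ) (i : ℤ) : F r n x = i ↔ i ≤ x / R r n ∧ x / R r n < i + 1 := by
  unfold F; exact Int.floor_eq_iff
lemma F_iff' (n : ℕ) (x : ℝ) (i : ℤ) : F r n x = i ↔ i * R r n ≤ x ∧ x < (i + 1) * R r n := by
  rw [F_iff, le_div_iff₀ (R_pos r n), div_lt_iff₀ (R_pos r n)]
lemma X_dv {a b : ℕ} (h : a ≤ b) (x : ℝ) : dv (X r b x) (b - a) = X r a x := by
  rw [dv_iff]
  obtain ⟨k, rfl⟩ := Nat.exists_eq_add_of_le h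
  rw [Nat.add_sub_cancel_left]
  obtain ⟨h1, h2⟩ := (X_iff r a x _).1 rfl
  have hp : (0:ℝ) < 256 ^ k := by positivity
  have e1 : R r (a + k) * x = R r a * x * 256 ^ k := by rw [R_add]; ring
  constructor
  · unfold X at *
    rw [Int.le_floor, e1]; push_cast; gcongr
  · unfold X at *
    rw [Int.floor_lt, e1]; push_cast; gcongr
lemma F_dv {a b : ℕ} (h : a ≤ b) (x : ℝ) : dv (F r a x) (b - a) = F r b x := by
  rw [dv_iff]
  obtain ⟨k, rfl⟩ := Nat.exists_eq_add_of_le h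
  rw [Nat.add_sub_cancel_left]
  obtain ⟨h1, h2⟩ := (F_iff r (a + k) x _).1 rfl
  have hp : (0:ℝ) < 256 ^ k := by positivity
  have hR := R_pos r a
  have e1 : x / R r a = x / R r (a + k) * 256 ^ k := by rw [R_add]; field_simp
  constructor
  · unfold F at *
    rw [Int.le_floor, e1]; push_cast; gcongr
  · unfold F at *
    rw [Int.floor_lt, e1]; push_cast; gcongr

/-- tiles -/
@[ext] structure Tile where
  n : ℕ
  i : ℤ
  m : ℤ

noncomputable instance : DecidableEq Tile := Classical.decEq _

namespace Tile

noncomputable def lo (s : Tile) : ℝ := s.i / R r s.n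
noncomputable def hi (s : Tile) : ℝ := (s.i + 1) / R r s.n
noncomputable def w1 (s : Tile) : Set ℝ := {η | s.m * R r s.n + R r s.n / 256 ≤ η ∧ η < (s.m + 1) * R r s.n}

def le (s t : Tile) : Prop := t.n ≤ s.n ∧ dv s.i (s.n - t.n) = t.i ∧ dv t.m (s.n - t.n) = s.m
def two (s t : Tile) : Prop :=
  s = t ∨ (t.n < s.n ∧ dv s.i (s.n - t.n) = t.i ∧ dv t.m (s.n - 1 - t.n) = 256 * s.m)
def Rel (s s' : Tile) : Prop :=
  s.n < s'.n ∧ dv s.m (s'.n - s.n) = s'.m ∧ dv s.m (s'.n - 1 - s.n) ≠ 256 * s'.m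
def left (t : Tile) : ℤ := t.m * 256 ^ t.n

lemma le_refl (s : Tile) : le s s := ⟨_root_.le_refl _, by simp, by simp⟩
lemma le_trans {s t u : Tile} (h : le s t) (h' : le t u) : le s u := by
  obtain ⟨a, b, c⟩ := h
  obtain ⟨a', b', c'⟩ := h'
  refine ⟨by omega, ?_, ?_⟩
  · rw [← b', ← b, dv_dv]; congr 1; omega
  · rw [← c, ← c', dv_dv]; congr 1; omega
lemma le_antisymm {s t : Tile} (h : le s t) (h' : le t s) : s = t := by
  obtain ⟨a, b, c⟩ := h
  obtain ⟨a', b', c'⟩ := h'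
  have hn : s.n = t.n := by omega
  ext
  · exact hn
  · rw [hn] at b; simpa using b
  · rw [hn] at c; simpa using c.symm
lemma two_le {s t : Tile} (h : two s t) : le s t := by
  rcases h with rfl | ⟨a, b, c⟩
  · exact le_refl _
  · refine ⟨a.le, b, ?_⟩
    have : s.n - t.n = (s.n - 1 - t.n) + 1 := by omega
    rw [this, ← dv_dv, c]
    exact dv_of _ _ _ (by ring)

lemma left_of_le {s t : Tile} (h : le s t) : left s ≤ left t := by
  obtain ⟨a, b, c⟩ := h
  have h1 := dv_le t.m (s.n - t.n)
  rw [c] at h1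
  unfold left
  calc s.m * 256 ^ s.n = s.m * 256 ^ (s.n - t.n) * 256 ^ t.n := by
        rw [mul_assoc, ← pow_add]; congr 2; omega
    _ ≤ _ := by gcongr

lemma LEFT {s s' t t' : Tile} (h : Rel s s') (h1 : two s t) (h2 : two s' t') : left t' < left t := by
  have hl := left_of_le (two_le h1)
  refine lt_of_lt_of_le ?_ hl
  obtain ⟨a, b, c⟩ := h
  -- left s ≥ (256 m' + 1) 256^(n'-1)
  set k := s'.n - 1 - s.n with hk
  have hk1 : s'.n - s.n = k + 1 := by omega
  set u := dv s.m k with hu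
  have hu1 : dv u 1 = s'.m := by rw [hu, dv_dv, ← hk1, b]
  have hu2 : 256 * s'.m + 1 ≤ u := by
    have := dv_le u 1
    rw [hu1] at this
    rcases lt_or_eq_of_le this with h | h
    · omega
    · exfalso; apply c; rw [← h]; ring
  have hs : u * 256 ^ (s'.n - 1) ≤ left s := by
    have := dv_le s.m k
    unfold left
    calc u * 256 ^ (s'.n - 1) = u * 256 ^ k * 256 ^ s.n := by
          rw [mul_assoc, ← pow_add]; congr 2; omega
      _ ≤ _ := by gcongr
  refine lt_of_lt_of_le ?_ hs
  refine lt_of_lt_of_le ?_ (mul_le_mul_of_nonneg_right hu2 (by positivity))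
  rcases h2 with rfl | ⟨a2, b2, c2⟩
  · unfold left
    have : (256:ℤ) ^ s'.n = 256 * 256 ^ (s'.n - 1) := by rw [← pow_succ']; congr 1; omega
    rw [this]
    have : (0:ℤ) < 256 ^ (s'.n - 1) := by positivity
    nlinarith
  · have := dv_lt t'.m (s'.n - 1 - t'.n)
    rw [c2] at this
    unfold left
    calc t'.m * 256 ^ t'.n < (256 * s'.m + 1) * 256 ^ (s'.n - 1 - t'.n) * 256 ^ t'.n := by gcongr
      _ = _ := by rw [mul_assoc, ← pow_add]; congr 2; omega

lemma Rel_chain {s s' s'' : Tile} (h : Rel s s') (h' : Rel s s'') (hn : s'.n < s''.n) : Rel s' s'' := by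
  obtain ⟨a, b, c⟩ := h
  obtain ⟨a', b', c'⟩ := h'
  refine ⟨hn, ?_, ?_⟩
  · rw [← b, dv_dv, ← b']; congr 1; omega
  · rw [← b, dv_dv]
    convert c' using 2; omega

lemma le_of_Rel {s s' t : Tile} (h : Rel s s') (h1 : le s t) (hi : dv s'.i (s'.n - t.n) = t.i) : le s' t := by
  obtain ⟨a, b, c⟩ := h
  obtain ⟨a1, b1, c1⟩ := h1
  refine ⟨by omega, hi, ?_⟩
  rw [← b, ← c1, dv_dv]; congr 1; omega

lemma Rel_same {s s' s'' : Tile} (h : Rel s s') (h' : Rel s s'') (hn : s'.n = s''.n) : s'.m = s''.m := by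
  rw [← h.2.1, ← h'.2.1, hn]

lemma len (s : Tile) : hi r s - lo r s = 1 / R r s.n := by unfold hi lo; ring
lemma lo_lt_hi (s : Tile) : lo r s < hi r s := by
  have := len r s; have := R_pos r s.n; have : 0 < 1 / R r s.n := by positivity
  linarith
lemma lo_le_of {s t : Tile} (hn : t.n ≤ s.n) (h : dv s.i (s.n - t.n) = t.i) :
    lo r t ≤ lo r s ∧ hi r s ≤ hi r t := by
  rw [dv_iff] at h
  have h1 : (t.i : ℝ) * 256 ^ (s.n - t.n) ≤ s.i := by exact_mod_cast h.1
  have h2 : (s.i : ℝ) + 1 ≤ (t.i + 1) * 256 ^ (s.n - t.n) := by exact_mod_cast h.2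
  have hR := R_pos r t.n
  unfold lo hi
  rw [R_sub r hn]
  constructor
  · rw [div_le_div_iff₀ hR (by positivity)]; nlinarith
  · rw [div_le_div_iff₀ (by positivity) hR]; nlinarith
lemma disj_of {s t : Tile} (hn : t.n ≤ s.n) (h : dv s.i (s.n - t.n) ≠ t.i) :
    hi r s ≤ lo r t ∨ hi r t ≤ lo r s := by
  rw [Ne, dv_iff, not_and_or, not_le, not_lt] at h
  have hR := R_pos r t.n
  unfold lo hi
  rw [R_sub r hn]
  rcases h with h | h
  · left
    have h1 : (s.i : ℝ) + 1 ≤ t.i * 256 ^ (s.n - t.n) := by exact_mod_cast h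
    rw [div_le_div_iff₀ (by positivity) hR]; nlinarith
  · right
    have h1 : (t.i + 1 : ℝ) * 256 ^ (s.n - t.n) ≤ s.i := by exact_mod_cast h
    rw [div_le_div_iff₀ hR (by positivity)]; nlinarith

lemma mem_I_iff (s : Tile) (x : ℝ) : x ∈ Set.Ico (lo r s) (hi r s) ↔ X r s.n x = s.i := by
  have hR := R_pos r s.n
  rw [X_iff, Set.mem_Ico, lo, hi, div_le_iff₀ hR, lt_div_iff₀ hR, mul_comm x]

lemma w1_F {s : Tile} {η : ℝ} (h : η ∈ w1 r s) : F r s.n η = s.m := by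
  rw [F_iff']
  have := R_pos r s.n
  exact ⟨by linarith [h.1], h.2⟩

lemma w1_disj {s s' : Tile} (hn : s.n < s'.n) (h : ¬ Rel s s') {η : ℝ} (h1 : η ∈ w1 r s) : η ∉ w1 r s' := by
  intro h2
  apply h
  refine ⟨hn, ?_, ?_⟩
  · rw [← w1_F r h1, F_dv r hn.le, w1_F r h2]
  · rw [← w1_F r h1, F_dv r (by omega)]
    intro hh
    rw [F_iff'] at hh
    have h3 := h2.1
    have : R r s'.n = R r (s'.n - 1) * 256 := by rw [← R_succ]; congr 1; omega
    rw [this] at h3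
    push_cast at hh
    linarith [hh.2]
lemma w1_disj' {s s' : Tile} (hn : s.n = s'.n) (h : s.m ≠ s'.m) {η : ℝ} (h1 : η ∈ w1 r s) : η ∉ w1 r s' := by
  intro h2
  apply h
  rw [← w1_F r h1, ← w1_F r h2, hn]

end Tile
end CarlesonProof

end


section
open MeasureTheory
open scoped Real ENNReal

set_option linter.unusedSectionVars false
namespace CarlesonProof

lemma sum_int_W (A : Finset ℤ) (c : ℝ) : ∑ i ∈ A, W (c - i) ≤ 3 * π := by
  have := SUMW A (fun i => (i:ℝ)) (fun i => (i:ℝ) + 1) (fun i => (i:ℝ)) one_pos c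
    (fun _ _ => le_refl _) (fun _ _ => by simp) (fun _ _ => by simp) ?_
  · simpa using this
  · intro i _ j _ hij
    simp only [Function.onFun]
    rw [Set.disjoint_left]
    intro x hx hx'
    apply hij
    have h1 := Int.floor_eq_iff.2 ⟨hx.1, hx.2⟩
    have h2 := Int.floor_eq_iff.2 ⟨hx'.1, hx'.2⟩
    rw [← h1, ← h2]

/-- norm squared of a finite sum. -/
lemma norm_sq_sum_le {ι : Type*} (A : Finset ι) (g : ι → ℝ → ℂ)
    (hint : ∀ s ∈ A, ∀ s' ∈ A, Integrable (fun y => g s y * (starRingEnd ℂ) (g s' y))) :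
    ∫ y, ‖∑ s ∈ A, g s y‖ ^ 2 ≤ ∑ s ∈ A, ∑ s' ∈ A, ‖∫ y, g s y * (starRingEnd ℂ) (g s' y)‖ := by
  have h1 : ((∫ y, ‖∑ s ∈ A, g s y‖ ^ 2 : ℝ) : ℂ) = ∑ s ∈ A, ∑ s' ∈ A, ∫ y, g s y * (starRingEnd ℂ) (g s' y) := by
    rw [← integral_complex_ofReal]
    rw [Finset.sum_congr rfl (fun s hs => (integral_finset_sum A (fun s' hs' => hint s hs s' hs')).symm)]
    rw [← integral_finset_sum A]
    · congr 1; ext y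
      rw [Complex.ofReal_pow, ← Complex.mul_conj', map_sum, Finset.sum_mul_sum]
    · intro s hs
      exact integrable_finset_sum A (fun s' hs' => hint s hs s' hs')
  have h2 : 0 ≤ ∫ y, ‖∑ s ∈ A, g s y‖ ^ 2 := integral_nonneg fun y => by positivity
  rw [← Real.norm_of_nonneg h2, ← Complex.norm_real, h1]
  refine (norm_sum_le _ _).trans (Finset.sum_le_sum fun s _ => norm_sum_le _ _)

variable (r : ℕ) [NeZero r]

/-- admissible wave packets adapted to a tile -/
structure Adm (s : Tile) (φ : ℝ → ℂ) : Prop where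
  cont : Continuous φ
  bound : ∀ y, ‖φ y‖ ≤ R r s.n * W (R r s.n * (s.lo r - y)) ^ 3
  supp : ∀ η, η ∉ s.w1 r → FI φ η = 0

variable {r}
lemma Adm.integrable {s : Tile} {φ : ℝ → ℂ} (h : Adm r s φ) : Integrable φ :=
  ((W_scale_pow_integrable (R_pos r s.n) _ (k := 3) (by norm_num)).const_mul _).mono'
    h.cont.aestronglyMeasurable (Filter.Eventually.of_forall h.bound)
lemma Adm.bdd {s : Tile} {φ : ℝ → ℂ} (h : Adm r s φ) (y : ℝ) : ‖φ y‖ ≤ R r s.n := by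
  refine (h.bound y).trans ?_
  have := R_pos r s.n
  calc R r s.n * W (R r s.n * (s.lo r - y)) ^ 3 ≤ R r s.n * 1 := by
        gcongr; exact pow_le_one₀ (W_nonneg _) (W_le_one _)
    _ = _ := mul_one _
lemma Adm.L1 {s : Tile} {φ : ℝ → ℂ} (h : Adm r s φ) : ∫ y, ‖φ y‖ ≤ π := by
  have hR := R_pos r s.n
  calc ∫ y, ‖φ y‖ ≤ ∫ y, R r s.n * W (R r s.n * (s.lo r - y)) ^ 3 :=
        integral_mono h.integrable.norm ((W_scale_pow_integrable hR _ (by norm_num)).const_mul _) h.bound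
    _ ≤ R r s.n * (π / R r s.n) := by
        rw [integral_const_mul]
        exact mul_le_mul_of_nonneg_left (W_scale_pow_integral_le hR _ (by norm_num)) hR.le
    _ = π := by field_simp
lemma Adm.mul_integrable {s s' : Tile} {φ φ' : ℝ → ℂ} (h : Adm r s φ) (h' : Adm r s' φ') :
    Integrable (fun y => φ y * (starRingEnd ℂ) (φ' y)) := by
  refine h.integrable.mul_bdd (c := R r s'.n) ?_ ?_
  · exact (Complex.continuous_conj.comp h'.cont).aestronglyMeasurable
  · exact Filter.Eventually.of_forall fun y => by rw [RCLike.norm_conj]; exact h'.bdd y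

lemma FI_continuous {φ : ℝ → ℂ} (h : Integrable φ) : Continuous (FI φ) := by
  unfold FI
  refine continuous_of_dominated (bound := fun y => ‖φ y‖) ?_ ?_ h.norm ?_
  · intro x
    exact (Continuous.aestronglyMeasurable (by fun_prop)).mul h.aestronglyMeasurable
  · intro x; exact Filter.Eventually.of_forall fun y => by simp
  · exact Filter.Eventually.of_forall fun y => by fun_prop

lemma Adm.FI_integrable {s : Tile} {φ : ℝ → ℂ} (h : Adm r s φ) : Integrable (FI φ) := by
  refine (FI_continuous h.integrable).integrable_of_hasCompactSupport ?_
  refine HasCompactSupport.intro (isCompact_Icc (a := s.m * R r s.n + R r s.n / 256) (b := (s.m + 1) * R r s.n)) fun x hx => ?_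
  exact h.supp x fun hx' => hx ⟨hx'.1, hx'.2.le⟩

lemma Adm.orth {s s' : Tile} {φ φ' : ℝ → ℂ} (h : Adm r s φ) (h' : Adm r s' φ')
    (hd : ∀ η, η ∈ s.w1 r → η ∉ s'.w1 r) : ∫ y, φ y * (starRingEnd ℂ) (φ' y) = 0 := by
  rw [parseval h.integrable h'.cont h'.integrable h'.FI_integrable]
  rw [← integral_zero ℝ ℂ]
  congr 1; ext η
  by_cases hη : η ∈ s.w1 r
  · rw [h'.supp η (hd η hη)]; simp
  · rw [h.supp η hη]; simp

lemma Adm.inner_le {s s' : Tile} {φ φ' : ℝ → ℂ} (h : Adm r s φ) (h' : Adm r s' φ') (hn : s.n ≤ s'.n) :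
    ‖∫ y, φ y * (starRingEnd ℂ) (φ' y)‖ ≤ 4 * π * R r s.n * W (R r s.n * (s.lo r - s'.lo r)) ^ 2 := by
  refine le_trans ?_ (P2_integral (R_pos r s.n) (R_mono r hn) (s.lo r) (s'.lo r))
  refine (norm_integral_le_integral_norm _).trans ?_
  refine integral_mono_of_nonneg (Filter.Eventually.of_forall fun y => norm_nonneg _) ?_ ?_
  · have h1 := (W_scale_integrable (R_pos r s'.n) (s'.lo r)).const_mul (R r s'.n)
    refine (h1.const_mul (4 * R r s.n * W (R r s.n * (s.lo r - s'.lo r)) ^ 2)).mono' ?_ ?_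
    · have := W_continuous
      exact Continuous.aestronglyMeasurable (by fun_prop)
    · refine Filter.Eventually.of_forall fun u => ?_
      have := R_pos r s.n; have := R_pos r s'.n
      have := W_nonneg (R r s.n * (s.lo r - u)); have := W_nonneg (R r s'.n * (s'.lo r - u))
      rw [Real.norm_of_nonneg (by positivity)]
      exact P2_point (R_pos r s.n) (R_mono r hn) _ _ u
  · refine Filter.Eventually.of_forall fun y => ?_
    simp only [norm_mul, RCLike.norm_conj]
    have := R_pos r s.n; have := W_nonneg (R r s.n * (s.lo r - y))
    exact mul_le_mul (h.bound y) (h'.bound y) (norm_nonneg _) (by positivity)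

lemma conj_integral_swap (φ φ' : ℝ → ℂ) :
    ‖∫ y, φ y * (starRingEnd ℂ) (φ' y)‖ = ‖∫ y, φ' y * (starRingEnd ℂ) (φ y)‖ := by
  rw [← RCLike.norm_conj, ← integral_conj]
  congr 2; ext y; simp [mul_comm]

open Classical in
lemma Adm.inner_le_all {s s' : Tile} {φ φ' : ℝ → ℂ} (h : Adm r s φ) (h' : Adm r s' φ') :
    ‖∫ y, φ y * (starRingEnd ℂ) (φ' y)‖ ≤
      (if Tile.Rel s s' then 4 * π * R r s.n * W (R r s.n * (s.lo r - s'.lo r)) ^ 2 else 0) +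
      (if Tile.Rel s' s then 4 * π * R r s'.n * W (R r s'.n * (s'.lo r - s.lo r)) ^ 2 else 0) +
      (if s.n = s'.n ∧ s.m = s'.m then 4 * π * R r s.n * W (s.i - s'.i) else 0) := by
  have nn : ∀ (t t' : Tile), 0 ≤ 4 * π * R r t.n * W (R r t.n * (t.lo r - t'.lo r)) ^ 2 := fun t t' => by
    have := R_pos r t.n; positivity
  have nn' : 0 ≤ 4 * π * R r s.n * W (s.i - s'.i) := by
    have := R_pos r s.n; have := W_nonneg (s.i - s'.i); positivity
  have key : ∀ c : Prop, ∀ [Decidable c], ∀ v : ℝ, 0 ≤ v → 0 ≤ if c then v else 0 := by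
    intro c _ v hv; split_ifs <;> simp [hv]
  have k1 := key (Tile.Rel s s') _ (nn s s')
  have k2 := key (Tile.Rel s' s) _ (nn s' s)
  have k3 := key (s.n = s'.n ∧ s.m = s'.m) _ nn'
  rcases lt_trichotomy s.n s'.n with hn | hn | hn
  · by_cases hr : Tile.Rel s s'
    · rw [if_pos hr]; linarith [h.inner_le h' hn.le]
    · rw [h.orth h' (fun η hη => Tile.w1_disj r hn hr hη), norm_zero]; linarith
  · by_cases hm : s.m = s'.m
    · rw [if_pos (⟨hn, hm⟩ : s.n = s'.n ∧ s.m = s'.m)]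
      have h3 := h.inner_le h' hn.le
      have : R r s.n * (s.lo r - s'.lo r) = s.i - s'.i := by
        have := R_pos r s'.n
        unfold Tile.lo; rw [hn]; field_simp
      rw [this] at h3
      have h4 : W ((s.i:ℝ) - s'.i) ^ 2 ≤ W (s.i - s'.i) := W_pow_le_self (by norm_num)
      have := R_pos r s.n
      have h5 : 4 * π * R r s.n * W (s.i - s'.i) ^ 2 ≤ 4 * π * R r s.n * W (s.i - s'.i) := by gcongr
      linarith
    · rw [h.orth h' (fun η hη => Tile.w1_disj' r hn hm hη), norm_zero]; linarith
  · rw [conj_integral_swap]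
    by_cases hr : Tile.Rel s' s
    · rw [if_pos hr]; linarith [h'.inner_le h hn.le]
    · rw [h'.orth h (fun η hη => Tile.w1_disj r hn hr hη), norm_zero]; linarith

open Classical in
/-- Bessel-type inequality. -/
lemma ORTH (A : Finset Tile) (φ : Tile → ℝ → ℂ) (c : Tile → ℂ) (hφ : ∀ s ∈ A, Adm r s (φ s)) :
    ∫ y, ‖∑ s ∈ A, (c s / R r s.n) * φ s y‖ ^ 2 ≤
      12 * π ^ 2 * ∑ s ∈ A, ‖c s‖ ^ 2 / R r s.n +
      8 * π * ∑ s ∈ A, ∑ s' ∈ A with Tile.Rel s s',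
        ‖c s‖ * ‖c s'‖ / R r s'.n * W (R r s.n * (s.lo r - s'.lo r)) ^ 2 := by
  have hconv : ∀ s s' y, (c s / R r s.n) * φ s y * (starRingEnd ℂ) ((c s' / R r s'.n) * φ s' y) =
      (c s / R r s.n) * (starRingEnd ℂ) (c s' / R r s'.n) * (φ s y * (starRingEnd ℂ) (φ s' y)) := by
    intro s s' y; rw [map_mul]; ring
  refine (norm_sq_sum_le A (fun s y => (c s / R r s.n) * φ s y) ?_).trans ?_
  · intro s hs s' hs'
    simp_rw [hconv]
    exact ((hφ s hs).mul_integrable (hφ s' hs')).const_mul _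
  simp_rw [hconv, integral_const_mul, norm_mul, RCLike.norm_conj, norm_div, Complex.norm_real]
  have nR : ∀ s : Tile, ‖R r s.n‖ = R r s.n := fun s => Real.norm_of_nonneg (R_pos r _).le
  simp_rw [nR]
  set U : Tile → Tile → ℝ := fun s s' => if Tile.Rel s s' then
     ‖c s‖ * ‖c s'‖ / R r s'.n * W (R r s.n * (s.lo r - s'.lo r)) ^ 2 else 0 with hU
  set V : Tile → Tile → ℝ := fun s s' => if s.n = s'.n ∧ s.m = s'.m then
     ‖c s‖ ^ 2 / R r s.n * W (s.i - s'.i) else 0 with hV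
  have hb : ∀ s ∈ A, ∀ s' ∈ A, ‖c s‖ / R r s.n * (‖c s'‖ / R r s'.n) * ‖∫ y, φ s y * (starRingEnd ℂ) (φ s' y)‖
      ≤ 4 * π * (U s s' + U s' s) + 2 * π * (V s s' + V s' s) := by
    intro s hs s' hs'
    have h1 := (hφ s hs).inner_le_all (hφ s' hs')
    have hR := R_pos r s.n; have hR' := R_pos r s'.n
    refine (mul_le_mul_of_nonneg_left h1 (by positivity)).trans ?_
    rw [mul_add, mul_add, mul_add (4 * π)]
    refine add_le_add (add_le_add (le_of_eq ?_) (le_of_eq ?_)) ?_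
    · simp only [hU]; split_ifs
      · field_simp
      · simp
    · simp only [hU]; split_ifs
      · field_simp
      · simp
    · simp only [hV]
      by_cases hc : s.n = s'.n ∧ s.m = s'.m
      · rw [if_pos hc, if_pos hc, if_pos ⟨hc.1.symm, hc.2.symm⟩, W_sub_comm (s'.i : ℝ), ← hc.1]
        have e1 : ‖c s‖ / R r s.n * (‖c s'‖ / R r s.n) * (4 * π * R r s.n * W (s.i - s'.i)) =
          2 * π * ((2 * ‖c s‖ * ‖c s'‖) / R r s.n * W (s.i - s'.i)) := by field_simp; ring
        have e2 : (‖c s‖ ^ 2 / R r s.n * W (s.i - s'.i) + ‖c s'‖ ^ 2 / R r s.n * W (s.i - s'.i)) =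
          (‖c s‖ ^ 2 + ‖c s'‖ ^ 2) / R r s.n * W (s.i - s'.i) := by ring
        rw [e1, e2]
        have := W_nonneg (s.i - s'.i)
        gcongr
        exact two_mul_le_add_sq _ _
      · rw [if_neg hc, if_neg hc, if_neg (fun h => hc ⟨h.1.symm, h.2.symm⟩)]; simp
  refine (Finset.sum_le_sum fun s hs => Finset.sum_le_sum fun s' hs' => hb s hs s' hs').trans ?_
  simp_rw [Finset.sum_add_distrib, ← Finset.mul_sum, Finset.sum_add_distrib]
  rw [Finset.sum_comm (f := fun s s' => U s' s), Finset.sum_comm (f := fun s s' => V s' s)]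
  have hUs : ∑ s ∈ A, ∑ s' ∈ A with Tile.Rel s s',
        ‖c s‖ * ‖c s'‖ / R r s'.n * W (R r s.n * (s.lo r - s'.lo r)) ^ 2 = ∑ s ∈ A, ∑ s' ∈ A, U s s' := by
    refine Finset.sum_congr rfl fun s _ => ?_
    rw [Finset.sum_filter]
  have hVs : ∑ s ∈ A, ∑ s' ∈ A, V s s' ≤ 3 * π * ∑ s ∈ A, ‖c s‖ ^ 2 / R r s.n := by
    rw [Finset.mul_sum]
    refine Finset.sum_le_sum fun s _ => ?_
    simp only [hV]
    rw [← Finset.sum_filter, ← Finset.mul_sum, mul_comm (3 * π)]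
    have hR := R_pos r s.n
    refine mul_le_mul_of_nonneg_left ?_ (by positivity)
    rw [← Finset.sum_image (f := fun i : ℤ => W (s.i - i)) (g := fun s' : Tile => s'.i)]
    · exact sum_int_W _ _
    · intro t ht t' ht' hh
      simp only [Finset.coe_filter, Set.mem_setOf_eq] at ht ht'
      ext
      · rw [← ht.2.1, ← ht'.2.1]
      · exact hh
      · rw [← ht.2.2, ← ht'.2.2]
  rw [hUs]
  nlinarith [Real.pi_pos]

end CarlesonProof

end


section
open MeasureTheory
open scoped Real ENNReal

set_option linter.unusedSectionVars false
namespace CarlesonProof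

/-- standing assumptions on the function -/
structure Fok (f : ℝ → ℂ) : Prop where
  meas : Measurable f
  bdd : ∀ x, ‖f x‖ ≤ 1
  supp : ∀ x, x ∉ Set.Icc (-1 : ℝ) 2 → f x = 0

lemma Fok.mul_integrable {f : ℝ → ℂ} (hf : Fok f) {φ : ℝ → ℂ} (h : Integrable φ) :
    Integrable (fun y => φ y * f y) :=
  h.mul_bdd (c := 1) hf.meas.aestronglyMeasurable (Filter.Eventually.of_forall hf.bdd)
lemma Fok.norm_integral_le {f : ℝ → ℂ} (hf : Fok f) {φ : ℝ → ℂ} (h : Integrable φ) :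
    ‖∫ y, φ y * f y‖ ≤ ∫ y, ‖φ y‖ := by
  refine (norm_integral_le_integral_norm _).trans ?_
  refine integral_mono (hf.mul_integrable h).norm h.norm fun y => ?_
  simp only [norm_mul]
  exact mul_le_of_le_one_right (norm_nonneg _) (hf.bdd y)

variable (r : ℕ) [NeZero r] 

lemma Adm_zero (s : Tile) : Adm r s (fun _ => 0) := by
  refine ⟨continuous_const, fun y => ?_, fun η _ => by simp [FI]⟩
  have := R_pos r s.n; have := W_nonneg (R r s.n * (s.lo r - y))
  simp only [norm_zero]; positivity

/-- maximal wave packet coefficient -/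
noncomputable def co (f : ℝ → ℂ) (s : Tile) : ℝ :=
  sSup {v | ∃ φ, Adm r s φ ∧ v = ‖∫ y, φ y * f y‖}

variable {r} {f : ℝ → ℂ} (hf : Fok f)
include hf

lemma co_bdd (s : Tile) : BddAbove {v | ∃ φ, Adm r s φ ∧ v = ‖∫ y, φ y * f y‖} :=
  ⟨π, by rintro v ⟨φ, h, rfl⟩; exact (hf.norm_integral_le h.integrable).trans h.L1⟩
lemma le_co {s : Tile} {φ : ℝ → ℂ} (h : Adm r s φ) : ‖∫ y, φ y * f y‖ ≤ co r f s :=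
  le_csSup (co_bdd hf s) ⟨φ, h, rfl⟩
lemma co_nonneg (s : Tile) : 0 ≤ co r f s := by
  have := le_co hf (Adm_zero r s); simpa using this
lemma co_le (s : Tile) : co r f s ≤ π :=
  csSup_le ⟨_, _, Adm_zero r s, rfl⟩ (by
    rintro v ⟨φ, h, rfl⟩; exact (hf.norm_integral_le h.integrable).trans h.L1)
lemma exists_near (s : Tile) : ∃ φ, Adm r s φ ∧ co r f s ≤ 2 * ‖∫ y, φ y * f y‖ := by
  rcases eq_or_lt_of_le (co_nonneg (r := r) hf s) with h | h
  · exact ⟨_, Adm_zero r s, by rw [← h]; positivity⟩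
  · have h1 : co r f s / 2 < sSup {v | ∃ φ, Adm r s φ ∧ v = ‖∫ y, φ y * f y‖} := by
      change _ < co r f s; linarith
    have hne : {v | ∃ φ, Adm r s φ ∧ v = ‖∫ y, φ y * f y‖}.Nonempty := ⟨_, _, Adm_zero r s, rfl⟩
    obtain ⟨v, ⟨φ, hφ, rfl⟩, h2⟩ := exists_lt_of_lt_csSup hne h1
    exact ⟨φ, hφ, by linarith⟩
lemma le_co_mul {s : Tile} {φ : ℝ → ℂ} {C : ℝ} (hC : 0 < C) (h : Adm r s (fun y => φ y / C)) :
    ‖∫ y, φ y * f y‖ ≤ C * co r f s := by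
  have h1 := le_co hf h
  have h2 : (fun y => φ y / C * f y) = fun y => (C:ℂ)⁻¹ * (φ y * f y) := by ext y; ring
  rw [h2, integral_const_mul, norm_mul, norm_inv, Complex.norm_real, Real.norm_of_nonneg hC.le,
    inv_mul_le_iff₀ hC] at h1
  exact h1

omit hf in
lemma G_integrable (A : Finset Tile) (φ : Tile → ℝ → ℂ) (c : Tile → ℂ) (hφ : ∀ s, Adm r s (φ s)) :
    Integrable (fun y => ∑ s ∈ A, (c s / R r s.n) * φ s y) :=
  integrable_finsetSum _ fun s _ => ((hφ s).integrable.const_mul _)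
omit hf in
lemma G_sq_integrable (A : Finset Tile) (φ : Tile → ℝ → ℂ) (c : Tile → ℂ) (hφ : ∀ s, Adm r s (φ s)) :
    Integrable (fun y => ‖∑ s ∈ A, (c s / R r s.n) * φ s y‖ ^ 2) := by
  have h1 := (G_integrable A φ c hφ).norm
  have h2 := h1.mul_bdd (c := ∑ s ∈ A, ‖c s / R r s.n‖ * R r s.n) h1.aestronglyMeasurable (by
    refine Filter.Eventually.of_forall fun y => ?_
    rw [norm_norm]
    refine (norm_sum_le _ _).trans (Finset.sum_le_sum fun s _ => ?_)
    rw [norm_mul]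
    exact mul_le_mul_of_nonneg_left ((hφ s).bdd y) (norm_nonneg _))
  simpa [sq] using h2

lemma dual_exists (A : Finset Tile) : ∃ (φ : Tile → ℝ → ℂ) (c : Tile → ℂ),
    (∀ s, Adm r s (φ s)) ∧ (∀ s, ‖c s‖ = co r f s) ∧
    ∑ s ∈ A, co r f s ^ 2 / R r s.n ≤ 2 * ‖∫ y, (∑ s ∈ A, (c s / R r s.n) * φ s y) * f y‖ := by
  choose φ hφ hn using fun s => exists_near (r := r) hf s
  choose u hu hu' using fun s => RCLike.exists_norm_eq_mul_self (∫ y, φ s y * f y)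
  refine ⟨φ, fun s => co r f s * u s, hφ, fun s => ?_, ?_⟩
  · rw [norm_mul, hu, mul_one, Complex.norm_real, Real.norm_of_nonneg (co_nonneg hf s)]
  · have h1 : ∫ y, (∑ s ∈ A, (co r f s * u s / R r s.n) * φ s y) * f y =
        ((∑ s ∈ A, co r f s / R r s.n * ‖∫ y, φ s y * f y‖ : ℝ) : ℂ) := by
      simp_rw [Finset.sum_mul]
      rw [integral_finsetSum _ (fun s _ => hf.mul_integrable ((hφ s).integrable.const_mul _))]
      push_cast
      refine Finset.sum_congr rfl fun s _ => ?_
      simp_rw [mul_assoc _ (φ s _) (f _)]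
      rw [integral_const_mul]
      have := hu' s
      simp only [RCLike.ofReal_eq_complex_ofReal] at this
      rw [this]; ring
    rw [h1, Complex.norm_real]
    refine le_trans ?_ (mul_le_mul_of_nonneg_left (le_abs_self _) (by norm_num))
    rw [Finset.mul_sum]
    refine Finset.sum_le_sum fun s _ => ?_
    have hR := R_pos r s.n
    have h0 := co_nonneg (r := r) hf s
    calc co r f s ^ 2 / R r s.n = co r f s / R r s.n * co r f s := by ring
      _ ≤ co r f s / R r s.n * (2 * ‖∫ y, φ s y * f y‖) := by gcongr; exact hn s
      _ = _ := by ring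

omit hf in
lemma amgm_set {G : ℝ → ℂ} (hG : Integrable G) (hG2 : Integrable (fun y => ‖G y‖ ^ 2)) {J : Set ℝ}
    (hJ : MeasurableSet J) {L : ℝ} (hL : volume J ≤ ENNReal.ofReal L) (hL0 : 0 ≤ L) {lam : ℝ} (hl : 0 < lam) :
    ∫ y in J, ‖G y‖ ≤ lam * L / 2 + 1 / (2 * lam) * ∫ y, ‖G y‖ ^ 2 := by
  have hfin : volume J < ⊤ := lt_of_le_of_lt hL ENNReal.ofReal_lt_top
  have hc : IntegrableOn (fun _ : ℝ => lam / 2) J := integrableOn_const hfin.ne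
  calc ∫ y in J, ‖G y‖ ≤ ∫ y in J, (lam / 2 + 1 / (2 * lam) * ‖G y‖ ^ 2) := by
        refine integral_mono hG.norm.integrableOn (hc.add (hG2.integrableOn.const_mul _)) fun y => ?_
        simp only
        have : 0 ≤ (‖G y‖ - lam) ^ 2 / (2 * lam) := by positivity
        have e : (‖G y‖ - lam) ^ 2 / (2 * lam) = lam / 2 + 1 / (2 * lam) * ‖G y‖ ^ 2 - ‖G y‖ := by
          field_simp; ring
        linarith
    _ = lam / 2 * (volume J).toReal + 1 / (2 * lam) * ∫ y in J, ‖G y‖ ^ 2 := by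
        rw [integral_add hc (hG2.integrableOn.const_mul _), setIntegral_const, integral_const_mul, smul_eq_mul,
          Measure.real, mul_comm (lam / 2)]
    _ ≤ lam * L / 2 + 1 / (2 * lam) * ∫ y, ‖G y‖ ^ 2 := by
        have h1 : (volume J).toReal ≤ L := ENNReal.toReal_le_of_le_ofReal hL0 hL
        have h2 : ∫ y in J, ‖G y‖ ^ 2 ≤ ∫ y, ‖G y‖ ^ 2 :=
          setIntegral_le_integral hG2 (Filter.Eventually.of_forall fun y => by simp)
        have : lam * L / 2 = lam / 2 * L := by ring
        rw [this]
        gcongr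

omit hf in
lemma geom_R (B : Finset ℕ) (n₀ : ℕ) (h : ∀ n ∈ B, n₀ ≤ n) : ∑ n ∈ B, 1 / R r n ≤ 2 / R r n₀ := by
  have hR := R_pos r n₀
  have h1 : ∀ n ∈ B, 1 / R r n = 1 / R r n₀ * (1 / 256 : ℝ) ^ (n - n₀) := by
    intro n hn
    rw [R_sub r (h n hn)]; field_simp; rw [← mul_pow]; norm_num
  rw [Finset.sum_congr rfl h1, ← Finset.mul_sum]
  have h2 : ∑ n ∈ B, (1 / 256 : ℝ) ^ (n - n₀) ≤ 2 := by
    rw [← Finset.sum_image (f := fun k => (1 / 256 : ℝ) ^ k) (g := fun n => n - n₀)]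
    · refine (Summable.sum_le_tsum _ (fun _ _ => by positivity) (summable_geometric_of_lt_one (by norm_num) (by norm_num))).trans ?_
      rw [tsum_geometric_of_lt_one (by norm_num) (by norm_num)]; norm_num
    · intro a ha b hb hab
      have := h a ha; have := h b hb
      simp only at hab; omega
  calc 1 / R r n₀ * _ ≤ 1 / R r n₀ * 2 := by gcongr
    _ = _ := by ring

omit hf in
/-- weighted sum over a tree -/
lemma TREEW (A : Finset Tile) (t : Tile) (hA : ∀ s ∈ A, Tile.le s t) (α : ℝ) :
    ∑ s ∈ A, W (R r s.n * (s.lo r - α)) / R r s.n ≤ 6 * π / R r t.n := by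
  rw [← Finset.sum_fiberwise_of_maps_to (g := fun s : Tile => s.n) (t := A.image (fun s => s.n))
    (fun s hs => Finset.mem_image_of_mem _ hs)]
  calc ∑ n ∈ A.image (fun s => s.n), ∑ s ∈ A with s.n = n, W (R r s.n * (s.lo r - α)) / R r s.n
      ≤ ∑ n ∈ A.image (fun s => s.n), 3 * π * (1 / R r n) := by
        refine Finset.sum_le_sum fun n _ => ?_
        have hR := R_pos r n
        have h1 : ∀ s ∈ A.filter (fun s => s.n = n), W (R r s.n * (s.lo r - α)) / R r s.n =
            W (R r n * α - s.i) * (1 / R r n) := by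
          intro s hs
          have hs' := (Finset.mem_filter.1 hs).2
          rw [hs', W_sub_comm (R r n * α)]
          have : R r n * (s.lo r - α) = s.i - R r n * α := by
            unfold Tile.lo; rw [hs']; field_simp
          rw [this]; ring
        rw [Finset.sum_congr rfl h1, ← Finset.sum_mul]
        refine mul_le_mul_of_nonneg_right ?_ (by positivity)
        rw [← Finset.sum_image (f := fun i : ℤ => W (R r n * α - i)) (g := fun s : Tile => s.i)]
        · exact sum_int_W _ _
        · intro s hs s' hs' hh
          have a1 := Finset.mem_filter.1 (Finset.mem_coe.1 hs)
          have a2 := Finset.mem_filter.1 (Finset.mem_coe.1 hs')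
          have b1 := (hA s a1.1).2.2
          have b2 := (hA s' a2.1).2.2
          rw [a1.2] at b1
          rw [a2.2] at b2
          ext
          · rw [a1.2, a2.2]
          · exact hh
          · rw [← b1, ← b2]
    _ ≤ 3 * π * (2 / R r t.n) := by
        rw [← Finset.mul_sum]
        gcongr
        apply geom_R
        intro n hn
        obtain ⟨s, hs, rfl⟩ := Finset.mem_image.1 hn
        exact (hA s hs).1
    _ = _ := by ring

end CarlesonProof

end


section
open MeasureTheory
open scoped Real ENNReal

set_option linter.unusedSectionVars false
set_option linter.unusedVariables false
namespace CarlesonProof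

variable {r : ℕ} [NeZero r] {f : ℝ → ℂ} (hf : Fok f)

/-- boundary weight of a tile relative to the top -/
noncomputable def bw (r : ℕ) (t s : Tile) : ℝ :=
  W (R r s.n * (s.lo r - t.lo r)) + W (R r s.n * (s.lo r - t.hi r))

lemma bw_nonneg (t s : Tile) : 0 ≤ bw r t s := add_nonneg (W_nonneg _) (W_nonneg _)
lemma bw_le_two (t s : Tile) : bw r t s ≤ 2 := by
  unfold bw; linarith [W_le_one (R r s.n * (s.lo r - t.lo r)), W_le_one (R r s.n * (s.lo r - t.hi r))]
lemma bw_sum (A : Finset Tile) (t : Tile) (hA : ∀ s ∈ A, Tile.le s t) :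
    ∑ s ∈ A, bw r t s / R r s.n ≤ 12 * π / R r t.n := by
  unfold bw
  simp_rw [add_div, Finset.sum_add_distrib]
  have h1 := TREEW (r := r) A t hA (t.lo r)
  have h2 := TREEW (r := r) A t hA (t.hi r)
  have : 12 * π / R r t.n = 6 * π / R r t.n + 6 * π / R r t.n := by ring
  linarith

lemma bw_sum_sq (A : Finset Tile) (t : Tile) (hA : ∀ s ∈ A, Tile.le s t) :
    ∑ s ∈ A, bw r t s ^ 2 / R r s.n ≤ 24 * π / R r t.n := by
  have h1 := bw_sum (r := r) A t hA
  calc ∑ s ∈ A, bw r t s ^ 2 / R r s.n ≤ ∑ s ∈ A, 2 * (bw r t s / R r s.n) := by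
        refine Finset.sum_le_sum fun s _ => ?_
        have hR := R_pos r s.n
        rw [← mul_div_assoc]
        gcongr
        nlinarith [bw_nonneg (r := r) t s, bw_le_two (r := r) t s]
    _ = 2 * ∑ s ∈ A, bw r t s / R r s.n := by rw [Finset.mul_sum]
    _ ≤ 2 * (12 * π / R r t.n) := by gcongr
    _ = _ := by ring

/-- constant of the initial size estimate (squared) -/
noncomputable def A0 : ℝ := 96 * π ^ 3 + 48 * π ^ 2

lemma tree_orth (A : Finset Tile) (t : Tile) (hA : ∀ s ∈ A, Tile.two s t) (φ : Tile → ℝ → ℂ) (c : Tile → ℂ)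
    (hφ : ∀ s, Adm r s (φ s)) :
    ∫ y, ‖∑ s ∈ A, (c s / R r s.n) * φ s y‖ ^ 2 ≤ 12 * π ^ 2 * ∑ s ∈ A, ‖c s‖ ^ 2 / R r s.n := by
  classical
  have h := ORTH (r := r) A φ c (fun s _ => hφ s)
  refine h.trans (le_of_eq ?_)
  rw [add_eq_left]
  have : ∀ s ∈ A, A.filter (fun s' => Tile.Rel s s') = ∅ := by
    intro s hs
    rw [Finset.filter_eq_empty_iff]
    intro s' hs' hr
    exact lt_irrefl _ (Tile.LEFT hr (hA s hs) (hA s' hs'))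
  rw [Finset.sum_congr rfl (fun s hs => by rw [this s hs, Finset.sum_empty])]
  simp

include hf in
lemma initial_size (A : Finset Tile) (t : Tile) (hA : ∀ s ∈ A, Tile.two s t) :
    ∑ s ∈ A, co r f s ^ 2 / R r s.n ≤ A0 / R r t.n := by
  obtain ⟨φ, c, hφ, hc, hB⟩ := dual_exists (r := r) hf A
  set B := ∑ s ∈ A, co r f s ^ 2 / R r s.n with hBdef
  set G : ℝ → ℂ := fun y => ∑ s ∈ A, (c s / R r s.n) * φ s y with hG
  have hRt := R_pos r t.n
  have hGi : Integrable G := G_integrable A φ c hφ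
  have hG2 : Integrable (fun y => ‖G y‖ ^ 2) := G_sq_integrable A φ c hφ
  have hL2 : ∫ y, ‖G y‖ ^ 2 ≤ 12 * π ^ 2 * B := by
    have := tree_orth A t hA φ c hφ
    simpa only [hc] using this
  change B ≤ 2 * ‖∫ y, G y * f y‖ at hB
  set J : Set ℝ := Set.Ico (t.lo r) (t.hi r) with hJ
  have h1 : ‖∫ y, G y * f y‖ ≤ (∫ y in J, ‖G y‖) + ∫ y in Jᶜ, ‖G y‖ := by
    refine (hf.norm_integral_le hGi).trans (le_of_eq ?_)
    exact (integral_add_compl measurableSet_Ico hGi.norm).symm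
  have h2 : ∫ y in J, ‖G y‖ ≤ 24 * π ^ 2 * (1 / R r t.n) / 2 + 1 / (2 * (24 * π ^ 2)) * ∫ y, ‖G y‖ ^ 2 := by
    refine amgm_set hGi hG2 measurableSet_Ico ?_ (by positivity) (by positivity)
    rw [Real.volume_Ico, Tile.len]
  have h3 : ∫ y in Jᶜ, ‖G y‖ ≤ 12 * π ^ 3 / R r t.n := by
    calc ∫ y in Jᶜ, ‖G y‖ ≤ ∫ y in Jᶜ, ∑ s ∈ A, co r f s / R r s.n * ‖φ s y‖ := by
          refine integral_mono hGi.norm.integrableOn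
            (integrable_finsetSum _ fun s _ => ((hφ s).integrable.norm.const_mul _).integrableOn) fun y => ?_
          refine (norm_sum_le _ _).trans (le_of_eq (Finset.sum_congr rfl fun s _ => ?_))
          rw [norm_mul, norm_div, hc, Complex.norm_real, Real.norm_of_nonneg (R_pos r _).le]
      _ = ∑ s ∈ A, co r f s / R r s.n * ∫ y in Jᶜ, ‖φ s y‖ := by
          rw [integral_finsetSum _ fun s _ => ((hφ s).integrable.norm.const_mul _).integrableOn]
          simp_rw [integral_const_mul]
      _ ≤ ∑ s ∈ A, π / R r s.n * (π * bw r t s) := by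
          refine Finset.sum_le_sum fun s hs => ?_
          have hR := R_pos r s.n
          have hle := Tile.two_le (hA s hs)
          obtain ⟨l1, l2⟩ := Tile.lo_le_of r hle.1 hle.2.1
          have l3 := Tile.lo_lt_hi r s
          have : ∫ y in Jᶜ, ‖φ s y‖ ≤ π * bw r t s := by
            calc ∫ y in Jᶜ, ‖φ s y‖ ≤ ∫ y in Jᶜ, R r s.n * (bw r t s * W (R r s.n * (s.lo r - y))) := by
                  refine setIntegral_mono_on (hφ s).integrable.norm.integrableOn
                    (((W_scale_integrable hR _).const_mul _).const_mul _).integrableOn measurableSet_Ico.compl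
                    fun y hy => ?_
                  refine ((hφ s).bound y).trans ?_
                  have hw : W (R r s.n * (s.lo r - y)) ≤ bw r t s := by
                    rw [hJ, Set.mem_compl_iff, Set.mem_Ico, not_and_or, not_le, not_lt] at hy
                    unfold bw
                    rcases hy with hy | hy
                    · refine le_trans ?_ (le_add_of_nonneg_right (W_nonneg _))
                      apply W_anti
                      rw [abs_mul, abs_mul]
                      refine mul_le_mul_of_nonneg_left ?_ (abs_nonneg _)
                      rw [abs_of_nonneg (by linarith), abs_of_nonneg (by linarith)]; linarith
                    · refine le_trans ?_ (le_add_of_nonneg_left (W_nonneg _))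
                      apply W_anti
                      rw [abs_mul, abs_mul]
                      refine mul_le_mul_of_nonneg_left ?_ (abs_nonneg _)
                      rw [abs_of_nonpos (by linarith), abs_of_nonpos (by linarith)]; linarith
                  have h0 := W_nonneg (R r s.n * (s.lo r - y))
                  have h1 := W_le_one (R r s.n * (s.lo r - y))
                  have h2 := W_pow_le (t := R r s.n * (s.lo r - y)) (a := 2) (b := 3) (by norm_num)
                  gcongr
                  nlinarith
              _ ≤ ∫ y, R r s.n * (bw r t s * W (R r s.n * (s.lo r - y))) := by
                  refine setIntegral_le_integral (((W_scale_integrable hR _).const_mul _).const_mul _) ?_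
                  refine Filter.Eventually.of_forall fun y => ?_
                  have := bw_nonneg (r := r) t s
                  have := W_nonneg (R r s.n * (s.lo r - y))
                  simp only [Pi.zero_apply]
                  positivity
              _ = _ := by
                  rw [integral_const_mul, integral_const_mul, W_scale_integral hR]
                  field_simp
          have h0 := co_nonneg (r := r) hf s
          have h4 := co_le (r := r) hf s
          have h5 : 0 ≤ ∫ y in Jᶜ, ‖φ s y‖ := integral_nonneg fun y => norm_nonneg _
          gcongr
      _ = π ^ 2 * ∑ s ∈ A, bw r t s / R r s.n := by
          rw [Finset.mul_sum]; refine Finset.sum_congr rfl fun s _ => ?_; ring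
      _ ≤ π ^ 2 * (12 * π / R r t.n) := by
          gcongr
          exact bw_sum A t fun s hs => Tile.two_le (hA s hs)
      _ = _ := by ring
  have h4 : 1 / (2 * (24 * π ^ 2)) * ∫ y, ‖G y‖ ^ 2 ≤ B / 4 := by
    calc 1 / (2 * (24 * π ^ 2)) * ∫ y, ‖G y‖ ^ 2 ≤ 1 / (2 * (24 * π ^ 2)) * (12 * π ^ 2 * B) := by gcongr
      _ = B / 4 := by field_simp; ring
  have h5 : B ≤ 2 * (24 * π ^ 2 * (1 / R r t.n) / 2 + B / 4 + 12 * π ^ 3 / R r t.n) := by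
    linarith
  have e1 : A0 / R r t.n = 96 * π ^ 3 / R r t.n + 48 * π ^ 2 / R r t.n := by unfold A0; ring
  have e2 : 24 * π ^ 2 * (1 / R r t.n) / 2 = 12 * (π ^ 2 / R r t.n) := by ring
  have e3 : 48 * π ^ 2 / R r t.n = 48 * (π ^ 2 / R r t.n) := by ring
  have e4 : 96 * π ^ 3 / R r t.n = 96 * (π ^ 3 / R r t.n) := by ring
  have e5 : 12 * π ^ 3 / R r t.n = 12 * (π ^ 3 / R r t.n) := by ring
  have p1 : 0 ≤ π ^ 3 / R r t.n := by positivity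
  have p2 : 0 ≤ π ^ 2 / R r t.n := by positivity
  rw [e1, e3, e4]; rw [e2, e5] at h5
  linarith

end CarlesonProof

end


section
open MeasureTheory
open scoped Real ENNReal

set_option linter.unusedSectionVars false
set_option linter.unusedVariables false
namespace CarlesonProof

open Classical in
lemma greedy (P : Finset Tile) (v w : Tile → ℝ) (hv : ∀ s, 0 ≤ v s) (hw : ∀ t, 0 ≤ w t) :
    ∀ k : ℕ, ∀ S : Finset Tile, S.card ≤ k → ∃ (D : Finset Tile) (g : Tile → Finset Tile),
      D ⊆ P ∧ (∀ t ∈ D, g t ⊆ S ∧ ∀ s ∈ g t, Tile.two s t) ∧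
      (∀ t ∈ D, w t < ∑ s ∈ g t, v s) ∧
      (∀ t ∈ D, ∀ t' ∈ D, t ≠ t' → Disjoint (g t) (g t')) ∧
      (∀ t ∈ D, ∀ t' ∈ D, ∀ s ∈ g t, ∀ s' ∈ g t', Tile.Rel s s' → ¬ Tile.le s' t) ∧
      (∀ t ∈ P, ∑ s ∈ S.filter (fun s => Tile.two s t ∧ ∀ u ∈ D, ¬ Tile.le s u), v s ≤ w t) := by
  intro k
  induction k with
  | zero =>
    intro S hS
    have : S = ∅ := by simpa using hS
    subst this
    exact ⟨∅, fun _ => ∅, by simp, by simp, by simp, by simp, by simp, fun t _ => by simpa using hw t⟩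
  | succ k ih =>
    intro S hS
    set Cd := P.filter (fun t => w t < ∑ s ∈ S.filter (fun s => Tile.two s t), v s) with hCd
    by_cases hne : Cd.Nonempty
    swap
    · refine ⟨∅, fun _ => ∅, by simp, by simp, by simp, by simp, by simp, fun t ht => ?_⟩
      rw [Finset.not_nonempty_iff_eq_empty, Finset.filter_eq_empty_iff] at hne
      have := hne ht
      rw [not_lt] at this
      simpa using this
    obtain ⟨t0, ht0, hmax⟩ := Cd.exists_max_image Tile.left hne
    rw [hCd, Finset.mem_filter] at ht0
    set T0 := S.filter (fun s => Tile.two s t0) with hT0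
    set S1 := S.filter (fun s => ¬ Tile.le s t0) with hS1
    have hcard : S1.card ≤ k := by
      have : T0.Nonempty := by
        by_contra h
        rw [Finset.not_nonempty_iff_eq_empty] at h
        have := ht0.2
        rw [h, Finset.sum_empty] at this
        linarith [hw t0]
      obtain ⟨s, hs⟩ := this
      rw [hT0, Finset.mem_filter] at hs
      have : S1 ⊂ S := by
        rw [Finset.ssubset_iff_of_subset (Finset.filter_subset _ _)]
        exact ⟨s, hs.1, fun h => (Finset.mem_filter.1 h).2 (Tile.two_le hs.2)⟩
      have := Finset.card_lt_card this
      omega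
    obtain ⟨D1, g1, h1, h2, h3, h4, h5, h6⟩ := ih S1 hcard
    have hnot : t0 ∉ D1 := by
      intro h
      have hh : (g1 t0).Nonempty := by
        by_contra h'
        rw [Finset.not_nonempty_iff_eq_empty] at h'
        have := h3 t0 h
        rw [h', Finset.sum_empty] at this
        linarith [hw t0]
      obtain ⟨s, hs⟩ := hh
      exact (Finset.mem_filter.1 ((h2 t0 h).1 hs)).2 (Tile.two_le ((h2 t0 h).2 s hs))
    have hne0 : ∀ t ∈ D1, t ≠ t0 := fun t ht h => hnot (h ▸ ht)
    have hg1 : ∀ t ∈ D1, (if t = t0 then T0 else g1 t) = g1 t := fun t ht => if_neg (hne0 t ht)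
    have hleft : ∀ t ∈ D1, Tile.left t ≤ Tile.left t0 := by
      intro t ht
      apply hmax
      rw [hCd, Finset.mem_filter]
      refine ⟨h1 ht, (h3 t ht).trans_le ?_⟩
      refine Finset.sum_le_sum_of_subset_of_nonneg ?_ fun s _ _ => hv s
      intro s hs
      exact Finset.mem_filter.2 ⟨Finset.filter_subset _ _ ((h2 t ht).1 hs), (h2 t ht).2 s hs⟩
    have hd0 : ∀ t ∈ D1, Disjoint T0 (g1 t) := by
      intro t ht
      rw [Finset.disjoint_left]
      intro s hs hs'
      exact (Finset.mem_filter.1 ((h2 t ht).1 hs')).2 (Tile.two_le (Finset.mem_filter.1 hs).2)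
    refine ⟨insert t0 D1, fun t => if t = t0 then T0 else g1 t, ?_, ?_, ?_, ?_, ?_, ?_⟩
    · exact Finset.insert_subset ht0.1 h1
    · rw [Finset.forall_mem_insert]
      refine ⟨by simp only [if_true]; exact ⟨Finset.filter_subset _ _, fun s hs => (Finset.mem_filter.1 hs).2⟩, ?_⟩
      intro t ht
      simp only [hg1 t ht]
      exact ⟨(h2 t ht).1.trans (Finset.filter_subset _ _), (h2 t ht).2⟩
    · rw [Finset.forall_mem_insert]
      refine ⟨by simp only [if_true]; exact ht0.2, ?_⟩
      intro t ht
      simp only [hg1 t ht]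
      exact h3 t ht
    · intro t ht t' ht' hn
      rw [Finset.mem_insert] at ht ht'
      rcases ht with rfl | ht <;> rcases ht' with rfl | ht'
      · exact absurd rfl hn
      · simp only [hg1 t' ht', if_true]; exact hd0 t' ht'
      · simp only [hg1 t ht, if_true]; exact (hd0 t ht).symm
      · simp only [hg1 t ht, hg1 t' ht']; exact h4 t ht t' ht' hn
    · intro t ht t' ht' s hs s' hs' hr
      rw [Finset.mem_insert] at ht ht'
      rcases ht with rfl | ht <;> rcases ht' with rfl | ht'
      · simp only [if_true] at hs hs'
        exact absurd (Tile.LEFT hr (Finset.mem_filter.1 hs).2 (Finset.mem_filter.1 hs').2) (lt_irrefl _)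
      · simp only [hg1 t' ht'] at hs'
        exact (Finset.mem_filter.1 ((h2 t' ht').1 hs')).2
      · simp only [hg1 t ht, if_true] at hs hs'
        have := Tile.LEFT hr ((h2 t ht).2 s hs) (Finset.mem_filter.1 hs').2
        exact absurd (hleft t ht) (not_le.2 this)
      · simp only [hg1 t ht, hg1 t' ht'] at hs hs'
        exact h5 t ht t' ht' s hs s' hs' hr
    · intro t ht
      refine le_trans (le_of_eq ?_) (h6 t ht)
      refine Finset.sum_congr ?_ fun _ _ => rfl
      ext s
      simp only [hS1, Finset.mem_filter, Finset.forall_mem_insert]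
      tauto

variable {r : ℕ} [NeZero r] {f : ℝ → ℂ} (hf : Fok f)

open Classical in
/-- the inner sum in the size lemma -/
lemma size_inner (D : Finset Tile) (g : Tile → Finset Tile)
    (h2 : ∀ t ∈ D, ∀ s ∈ g t, Tile.two s t)
    (h5 : ∀ t ∈ D, ∀ t' ∈ D, ∀ s ∈ g t, ∀ s' ∈ g t', Tile.Rel s s' → ¬ Tile.le s' t)
    (t : Tile) (ht : t ∈ D) (s : Tile) (hs : s ∈ g t) :
    ∑ s' ∈ (D.biUnion g).filter (fun s' => Tile.Rel s s'), 1 / R r s'.n * W (R r s.n * (s.lo r - s'.lo r)) ^ 2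
      ≤ bw r t s * (3 * π / R r s.n) := by
  have hR := R_pos r s.n
  set B := (D.biUnion g).filter (fun s' => Tile.Rel s s') with hB
  have hBm : ∀ s' ∈ B, Tile.Rel s s' ∧ ∃ t' ∈ D, s' ∈ g t' := by
    intro s' hs'
    rw [hB, Finset.mem_filter, Finset.mem_biUnion] at hs'
    exact ⟨hs'.2, hs'.1⟩
  have key : ∀ s' ∈ B, ∀ s'' ∈ B, s'.n ≤ s''.n → s' ≠ s'' → Tile.hi r s'' ≤ Tile.lo r s' ∨ Tile.hi r s' ≤ Tile.lo r s'' := by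
    intro s' hs' s'' hs'' hn hne
    apply Tile.disj_of r hn
    intro hdv
    obtain ⟨r', t', ht', hst'⟩ := hBm s' hs'
    obtain ⟨r'', t'', ht'', hst''⟩ := hBm s'' hs''
    rcases hn.lt_or_eq with hn | hn
    · have hrel := Tile.Rel_chain r' r'' hn
      have hle := Tile.two_le (h2 t' ht' s' hst')
      refine h5 t' ht' t'' ht'' s' hst' s'' hst'' hrel (Tile.le_of_Rel hrel hle ?_)
      rw [← hle.2.1, ← hdv, dv_dv]; congr 1
      have := hle.1
      omega
    · apply hne
      ext
      · exact hn
      · rw [hn] at hdv; simpa using hdv.symm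
      · exact Tile.Rel_same r' r'' hn
  have hdis : (B : Set Tile).PairwiseDisjoint (fun s' => Set.Ico (s'.lo r) (s'.hi r)) := by
    intro s' hs' s'' hs'' hne
    have : Tile.hi r s'' ≤ Tile.lo r s' ∨ Tile.hi r s' ≤ Tile.lo r s'' := by
      rcases le_total s'.n s''.n with h | h
      · exact key s' hs' s'' hs'' h hne
      · exact (key s'' hs'' s' hs' h hne.symm).symm
    simp only [Function.onFun]
    rw [Set.disjoint_left]
    rintro x ⟨a, b⟩ ⟨c, d⟩
    rcases this with h | h <;> linarith
  have hS : ∀ c, ∑ s' ∈ B, 1 / R r s'.n * W (R r s.n * (c - s'.lo r)) ≤ 3 * π / R r s.n := by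
    intro c
    have := SUMW B (fun s' => s'.lo r) (fun s' => s'.hi r) (fun s' => s'.lo r) hR c (fun _ _ => le_refl _)
      (fun s' _ => (Tile.lo_lt_hi r s').le) (fun s' hs' => ?_) hdis
    · simp only [Tile.len] at this
      exact this
    · simp only [Tile.len]
      exact one_div_le_one_div_of_le hR (R_mono r (hBm s' hs').1.1.le)
  have hle := Tile.two_le (h2 t ht s hs)
  obtain ⟨l1, l2⟩ := Tile.lo_le_of r hle.1 hle.2.1
  have l3 := Tile.lo_lt_hi r s
  calc _ ≤ ∑ s' ∈ B, (W (R r s.n * (s.lo r - t.lo r)) * (1 / R r s'.n * W (R r s.n * (t.lo r - s'.lo r))) +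
        W (R r s.n * (s.lo r - t.hi r)) * (1 / R r s'.n * W (R r s.n * (t.hi r - s'.lo r)))) := by
        refine Finset.sum_le_sum fun s' hs' => ?_
        obtain ⟨r', t', ht', hst'⟩ := hBm s' hs'
        have hn : ¬ dv s'.i (s'.n - t.n) = t.i := fun h =>
          h5 t ht t' ht' s hs s' hst' r' (Tile.le_of_Rel r' hle h)
        have hR' := R_pos r s'.n
        have hor := Tile.disj_of r (show t.n ≤ s'.n from hle.1.trans r'.1.le) hn
        have l4 := Tile.lo_lt_hi r s'
        have p1 := W_nonneg (R r s.n * (s.lo r - t.lo r))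
        have p2 := W_nonneg (R r s.n * (t.lo r - s'.lo r))
        have p3 := W_nonneg (R r s.n * (s.lo r - t.hi r))
        have p4 := W_nonneg (R r s.n * (t.hi r - s'.lo r))
        rcases hor with h | h
        · have := W_add_sq_le (p := R r s.n * (s.lo r - t.lo r)) (q := R r s.n * (t.lo r - s'.lo r))
            (mul_nonneg hR.le (by linarith)) (mul_nonneg hR.le (by linarith))
          have e : R r s.n * (s.lo r - t.lo r) + R r s.n * (t.lo r - s'.lo r) = R r s.n * (s.lo r - s'.lo r) := by ring
          rw [e] at this
          refine le_trans ?_ (le_add_of_nonneg_right (by positivity))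
          calc 1 / R r s'.n * W (R r s.n * (s.lo r - s'.lo r)) ^ 2 ≤ 1 / R r s'.n * (_ * _) :=
                mul_le_mul_of_nonneg_left this (by positivity)
            _ = _ := by ring
        · have := W_add_sq_le (p := R r s.n * (t.hi r - s.lo r)) (q := R r s.n * (s'.lo r - t.hi r))
            (mul_nonneg hR.le (by linarith)) (mul_nonneg hR.le (by linarith))
          have e : R r s.n * (t.hi r - s.lo r) + R r s.n * (s'.lo r - t.hi r) = -(R r s.n * (s.lo r - s'.lo r)) := by ring
          have e2 : R r s.n * (t.hi r - s.lo r) = -(R r s.n * (s.lo r - t.hi r)) := by ring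
          have e3 : R r s.n * (s'.lo r - t.hi r) = -(R r s.n * (t.hi r - s'.lo r)) := by ring
          rw [e, e2, e3, W_neg, W_neg, W_neg] at this
          refine le_trans ?_ (le_add_of_nonneg_left (by positivity))
          calc 1 / R r s'.n * W (R r s.n * (s.lo r - s'.lo r)) ^ 2 ≤ 1 / R r s'.n * (_ * _) :=
                mul_le_mul_of_nonneg_left this (by positivity)
            _ = _ := by ring
    _ = W (R r s.n * (s.lo r - t.lo r)) * (∑ s' ∈ B, 1 / R r s'.n * W (R r s.n * (t.lo r - s'.lo r))) +
        W (R r s.n * (s.lo r - t.hi r)) * ∑ s' ∈ B, (1 / R r s'.n * W (R r s.n * (t.hi r - s'.lo r))) := by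
        rw [Finset.sum_add_distrib, Finset.mul_sum, Finset.mul_sum]
    _ ≤ W (R r s.n * (s.lo r - t.lo r)) * (3 * π / R r s.n) + W (R r s.n * (s.lo r - t.hi r)) * (3 * π / R r s.n) := by
        have p1 := W_nonneg (R r s.n * (s.lo r - t.lo r))
        have p3 := W_nonneg (R r s.n * (s.lo r - t.hi r))
        gcongr
        · exact hS _
        · exact hS _
    _ = _ := by unfold bw; ring

/-- constant -/
noncomputable def C2 : ℝ := 36 * π ^ 2 + 576 * π ^ 3

open Classical in
include hf in
lemma size_lemma (P S : Finset Tile) (hSP : S ⊆ P) {σ : ℝ} (hσ : 0 < σ)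
    (hsz : ∀ t ∈ P, ∑ s ∈ S.filter (fun s => Tile.two s t), co r f s ^ 2 / R r s.n ≤ (2 * σ) ^ 2 / R r t.n) :
    ∃ D ⊆ P, (∑ t ∈ D, 1 / R r t.n ≤ 12 * C2 / σ ^ 2) ∧
      ∀ t ∈ P, ∑ s ∈ S.filter (fun s => Tile.two s t ∧ ∀ u ∈ D, ¬ Tile.le s u), co r f s ^ 2 / R r s.n ≤ σ ^ 2 / R r t.n := by
  have hRp := R_pos r
  obtain ⟨D, g, h1, h2, h3, h4, h5, h6⟩ := greedy P (fun s => co r f s ^ 2 / R r s.n) (fun t => σ ^ 2 / R r t.n)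
    (fun s => by have := hRp s.n; positivity) (fun s => by have := hRp s.n; positivity) S.card S le_rfl
  refine ⟨D, h1, ?_, h6⟩
  set A := D.biUnion g with hA
  have hsum : ∀ v : Tile → ℝ, ∑ s ∈ A, v s = ∑ t ∈ D, ∑ s ∈ g t, v s := fun v =>
    Finset.sum_biUnion fun t ht t' ht' hne => h4 t ht t' ht' hne
  have hco0 := fun s => co_nonneg (r := r) hf s
  have hco : ∀ s ∈ A, co r f s ≤ 2 * σ := by
    intro s hs
    obtain ⟨t, ht, hst⟩ := Finset.mem_biUnion.1 hs
    have hsS := (h2 t ht).1 hst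
    have h := hsz s (hSP hsS)
    have hR := hRp s.n
    have h' : co r f s ^ 2 / R r s.n ≤ (2 * σ) ^ 2 / R r s.n := by
      refine le_trans ?_ h
      exact Finset.single_le_sum (f := fun s => co r f s ^ 2 / R r s.n) (fun s _ => by have := hRp s.n; positivity)
        (Finset.mem_filter.2 ⟨hsS, Or.inl rfl⟩)
    rw [div_le_div_iff_of_pos_right hR] at h'
    exact le_of_sq_le_sq h' (by positivity)
  obtain ⟨φ, c, hφ, hc, hBB⟩ := dual_exists (r := r) hf A
  set B := ∑ s ∈ A, co r f s ^ 2 / R r s.n with hBdef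
  set G : ℝ → ℂ := fun y => ∑ s ∈ A, (c s / R r s.n) * φ s y with hG
  change B ≤ 2 * ‖∫ y, G y * f y‖ at hBB
  have hGi : Integrable G := G_integrable A φ c hφ
  have hG2 : Integrable (fun y => ‖G y‖ ^ 2) := G_sq_integrable A φ c hφ
  have hBD : ∑ t ∈ D, σ ^ 2 / R r t.n ≤ B := by
    rw [hBdef, hsum]
    exact Finset.sum_le_sum fun t ht => (h3 t ht).le
  have hRel : ∑ s ∈ A, ∑ s' ∈ A with Tile.Rel s s',
        ‖c s‖ * ‖c s'‖ / R r s'.n * W (R r s.n * (s.lo r - s'.lo r)) ^ 2 ≤ 3 * π * (B + 24 * π * B) := by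
    calc _ ≤ ∑ s ∈ A, co r f s * (2 * σ) * ∑ s' ∈ A with Tile.Rel s s', 1 / R r s'.n * W (R r s.n * (s.lo r - s'.lo r)) ^ 2 := by
          refine Finset.sum_le_sum fun s hs => ?_
          rw [Finset.mul_sum]
          refine Finset.sum_le_sum fun s' hs' => ?_
          rw [hc, hc]
          have := hRp s'.n
          have h7 := hco s' (Finset.mem_filter.1 hs').1
          have h8 := W_nonneg (R r s.n * (s.lo r - s'.lo r))
          have h9 := hco0 s
          calc _ = co r f s * co r f s' * (1 / R r s'.n * W (R r s.n * (s.lo r - s'.lo r)) ^ 2) := by ring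
            _ ≤ _ := by gcongr
      _ = ∑ t ∈ D, ∑ s ∈ g t, co r f s * (2 * σ) * ∑ s' ∈ A with Tile.Rel s s', 1 / R r s'.n * W (R r s.n * (s.lo r - s'.lo r)) ^ 2 := hsum _
      _ ≤ ∑ t ∈ D, ∑ s ∈ g t, 3 * π * (co r f s ^ 2 / R r s.n + σ ^ 2 * (bw r t s ^ 2 / R r s.n)) := by
          refine Finset.sum_le_sum fun t ht => Finset.sum_le_sum fun s hs => ?_
          have h7 := size_inner (r := r) D g (fun t ht => (h2 t ht).2) h5 t ht s hs
          have h9 := hco0 s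
          have hR := hRp s.n
          calc _ ≤ co r f s * (2 * σ) * (bw r t s * (3 * π / R r s.n)) := by gcongr
            _ = 3 * π * ((2 * co r f s * (σ * bw r t s)) / R r s.n) := by ring
            _ ≤ 3 * π * ((co r f s ^ 2 + (σ * bw r t s) ^ 2) / R r s.n) := by
                gcongr; exact two_mul_le_add_sq _ _
            _ = _ := by ring
      _ = 3 * π * (B + ∑ t ∈ D, σ ^ 2 * ∑ s ∈ g t, bw r t s ^ 2 / R r s.n) := by
          rw [hBdef, hsum, ← Finset.sum_add_distrib, Finset.mul_sum]
          refine Finset.sum_congr rfl fun t _ => ?_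
          rw [← Finset.mul_sum, Finset.sum_add_distrib, Finset.mul_sum (a := σ ^ 2)]
      _ ≤ 3 * π * (B + ∑ t ∈ D, σ ^ 2 * (24 * π / R r t.n)) := by
          gcongr with t ht
          exact bw_sum_sq _ _ fun s hs => Tile.two_le ((h2 t ht).2 s hs)
      _ = 3 * π * (B + 24 * π * ∑ t ∈ D, σ ^ 2 / R r t.n) := by
          rw [Finset.mul_sum]; congr 2; exact Finset.sum_congr rfl fun _ _ => by ring
      _ ≤ _ := by gcongr
  have hL2 : ∫ y, ‖G y‖ ^ 2 ≤ C2 * B := by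
    have := ORTH (r := r) A φ c (fun s _ => hφ s)
    refine this.trans ?_
    simp only [hc]
    simp only [hc] at hRel
    calc _ ≤ 12 * π ^ 2 * B + 8 * π * (3 * π * (B + 24 * π * B)) := by gcongr
      _ = _ := by unfold C2; ring
  have hC2 : 0 < C2 := by unfold C2; positivity
  set J : Set ℝ := Set.Icc (-1 : ℝ) 2 with hJ
  have h7 : ‖∫ y, G y * f y‖ ≤ ∫ y in J, ‖G y‖ := by
    refine (norm_integral_le_integral_norm _).trans ?_
    rw [← integral_indicator measurableSet_Icc]
    refine integral_mono (hf.mul_integrable hGi).norm (hGi.norm.indicator measurableSet_Icc) fun y => ?_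
    simp only [norm_mul]
    by_cases hy : y ∈ J
    · rw [Set.indicator_of_mem hy]
      exact mul_le_of_le_one_right (norm_nonneg _) (hf.bdd y)
    · rw [Set.indicator_of_notMem hy, hf.supp y hy]; simp
  have h8 : ∫ y in J, ‖G y‖ ≤ 2 * C2 * 3 / 2 + 1 / (2 * (2 * C2)) * ∫ y, ‖G y‖ ^ 2 := by
    refine amgm_set hGi hG2 measurableSet_Icc ?_ (by norm_num) (by positivity)
    rw [Real.volume_Icc]; norm_num
  have h9 : 1 / (2 * (2 * C2)) * ∫ y, ‖G y‖ ^ 2 ≤ B / 4 := by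
    calc _ ≤ 1 / (2 * (2 * C2)) * (C2 * B) := by gcongr
      _ = _ := by field_simp; ring
  have h10 : B ≤ 12 * C2 := by linarith
  rw [le_div_iff₀ (by positivity)]
  refine le_trans (le_of_eq ?_) (hBD.trans h10)
  rw [Finset.sum_mul]; exact Finset.sum_congr rfl fun _ _ => by ring

end CarlesonProof

end


section
open MeasureTheory
open scoped Real ENNReal

set_option linter.unusedSectionVars false
set_option linter.unusedVariables false
namespace CarlesonProof

lemma Tile.eq_of_le_of_n {s t : Tile} (h : Tile.le s t) (hn : s.n ≤ t.n) : s = t := by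
  obtain ⟨a, b, c⟩ := h
  have hn : s.n = t.n := by omega
  ext
  · exact hn
  · rw [hn] at b; simpa using b
  · rw [hn] at c; simpa using c.symm

lemma X_measurable (r n : ℕ) : Measurable (X r n) := by
  unfold X; exact Int.measurable_floor.comp (measurable_const.mul measurable_id)
lemma F_measurable (r n : ℕ) : Measurable (F r n) := by
  unfold F; exact Int.measurable_floor.comp (measurable_id.div_const _)

variable (r : ℕ) [NeZero r] (θ : ℝ → ℝ) (hθ : Measurable θ)

/-- the set of points selecting the tile -/
def Et (s : Tile) : Set ℝ := {x | x ∈ Set.Ico (0:ℝ) 1 ∧ X r s.n x = s.i ∧ F r s.n (θ x) = s.m}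
/-- its measure -/
noncomputable def em (s : Tile) : ℝ := (volume (Et r θ s)).toReal

include hθ in
lemma Et_meas (s : Tile) : MeasurableSet (Et r θ s) := by
  refine measurableSet_Ico.inter (MeasurableSet.inter ?_ ?_)
  · exact X_measurable r s.n (measurableSet_singleton s.i)
  · exact ((F_measurable r s.n).comp hθ) (measurableSet_singleton s.m)

lemma Et_le_of_mem {s t : Tile} {x : ℝ} (hs : x ∈ Et r θ s) (ht : x ∈ Et r θ t) (hn : t.n ≤ s.n) : Tile.le s t := by
  refine ⟨hn, ?_, ?_⟩
  · rw [← hs.2.1, ← ht.2.1, X_dv r hn]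
  · rw [← hs.2.2, ← ht.2.2, F_dv r hn]

lemma Et_fin (s : Tile) : volume (Et r θ s) ≠ ⊤ := by
  refine ne_top_of_le_ne_top ?_ (measure_mono (fun x hx => hx.1 : Et r θ s ⊆ Set.Ico (0:ℝ) 1))
  rw [Real.volume_Ico]; exact ENNReal.ofReal_ne_top
lemma em_nonneg (s : Tile) : 0 ≤ em r θ s := ENNReal.toReal_nonneg

include hθ in
lemma em_sum (M : Finset Tile) (h : ∀ s ∈ M, ∀ t ∈ M, Tile.le s t → s = t) : ∑ s ∈ M, em r θ s ≤ 1 := by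
  have hd : (M : Set Tile).PairwiseDisjoint (Et r θ) := by
    intro s hs t ht hne
    rw [Function.onFun, Set.disjoint_left]
    intro x hx hx'
    rcases le_total t.n s.n with hn | hn
    · exact hne (h s hs t ht (Et_le_of_mem r θ hx hx' hn))
    · exact hne (h t ht s hs (Et_le_of_mem r θ hx' hx hn)).symm
  unfold em
  rw [← ENNReal.toReal_sum fun s _ => Et_fin r θ s,
    ← measure_biUnion_finset hd fun s _ => Et_meas r θ hθ s]
  have : volume (⋃ s ∈ M, Et r θ s) ≤ 1 := by
    refine (measure_mono (t := Set.Ico (0:ℝ) 1) ?_).trans (by simp)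
    exact Set.iUnion₂_subset fun s _ x hx => hx.1
  simpa using ENNReal.toReal_mono ENNReal.one_ne_top this

open Classical in
include hθ in
lemma mass_lemma (S : Finset Tile) {μ : ℝ} (hμ : 0 < μ) :
    ∃ M ⊆ S, (∑ t ∈ M, 1 / R r t.n ≤ 1 / μ) ∧ ∀ s ∈ S, (∀ u ∈ M, ¬ Tile.le s u) → em r θ s * R r s.n ≤ μ := by
  set Q := S.filter (fun s => μ < em r θ s * R r s.n) with hQ
  set M := Q.filter (fun s => ∀ u ∈ Q, Tile.le s u → s = u) with hM
  refine ⟨M, (Finset.filter_subset _ _).trans (Finset.filter_subset _ _), ?_, ?_⟩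
  · have h1 := em_sum r θ hθ M fun s hs t ht h => (Finset.mem_filter.1 hs).2 t (Finset.mem_filter.1 ht).1 h
    rw [le_div_iff₀ hμ, Finset.sum_mul]
    refine le_trans (Finset.sum_le_sum fun s hs => ?_) h1
    have h2 := (Finset.mem_filter.1 (Finset.mem_filter.1 hs).1).2
    have hR := R_pos r s.n
    rw [one_div_mul_eq_div, div_le_iff₀ hR]; exact h2.le
  · intro s hs hu
    by_contra hlt
    rw [not_le] at hlt
    have hsQ : s ∈ Q := Finset.mem_filter.2 ⟨hs, hlt⟩
    obtain ⟨t, ht, hmin⟩ := (Q.filter (fun u => Tile.le s u)).exists_min_image (fun u => u.n)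
      ⟨s, Finset.mem_filter.2 ⟨hsQ, Tile.le_refl s⟩⟩
    rw [Finset.mem_filter] at ht
    refine hu t (Finset.mem_filter.2 ⟨ht.1, fun u hu' hle => ?_⟩) ht.2
    exact Tile.eq_of_le_of_n hle (hmin u (Finset.mem_filter.2 ⟨hu', Tile.le_trans ht.2 hle⟩))

end CarlesonProof

end


section
open MeasureTheory
open scoped Real ENNReal

set_option linter.unusedSectionVars false
set_option linter.unusedVariables false
namespace CarlesonProof

/-- `θ` in the bottom child of the frequency interval -/
def Tile.w2 (r : ℕ) (s : Tile) (θ : ℝ) : Prop := s.m * R r s.n ≤ θ ∧ θ < s.m * R r s.n + R r s.n / 256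

/-- packet coefficient -/
noncomputable def Ps (f : ℝ → ℂ) (ψ : ℝ → ℂ) (ρ θ x : ℝ) : ℂ := ∫ y, pk ψ ρ θ x y * f y

variable {r : ℕ} [NeZero r]

lemma Tile.w2_of (s : Tile) (hn : 1 ≤ s.n) {θ : ℝ} (h : F r (s.n - 1) θ = 256 * s.m) : s.w2 r θ := by
  rw [F_iff'] at h
  have : R r s.n = R r (s.n - 1) * 256 := by rw [← R_succ]; congr 1; omega
  unfold Tile.w2; rw [this]
  push_cast at h
  exact ⟨by linarith [h.1], by linarith [h.2]⟩

section
variable {ψ : ℝ → ℂ} {g : ℝ → ℝ} {C : ℝ} (M : Mother ψ g C)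
  (hg0 : ∀ η, η ≤ 1 / 128 → g η = 0) (hg1 : ∀ η, 3 / 4 ≤ η → g η = 0)
include M hg0 hg1

lemma pk_FI_zero (s : Tile) {θ : ℝ} (hθ : s.w2 r θ) (x η : ℝ) (hη : η ∉ s.w1 r) :
    FI (pk ψ (R r s.n) θ x) η = 0 := by
  have hR := R_pos r s.n
  rw [M.FI_pk hR]
  suffices g ((η - θ) / R r s.n) = 0 by rw [this]; simp
  by_contra hne
  apply hη
  have h1 : 1 / 128 < (η - θ) / R r s.n := by
    by_contra h; exact hne (hg0 _ (not_lt.1 h))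
  have h2 : (η - θ) / R r s.n < 3 / 4 := by
    by_contra h; exact hne (hg1 _ (not_lt.1 h))
  rw [lt_div_iff₀ hR] at h1
  rw [div_lt_iff₀ hR] at h2
  exact ⟨by linarith [hθ.1], by linarith [hθ.2]⟩

lemma Adm_pk (s : Tile) {θ : ℝ} (hθ : s.w2 r θ) (u : ℝ) :
    Adm r s (fun y => pk ψ (R r s.n) θ u y / ((8 * C / W (R r s.n * (s.lo r - u)) ^ 3 : ℝ) : ℂ)) := by
  have hR := R_pos r s.n
  have hW := W_pos (R r s.n * (s.lo r - u))
  have hC := M.C0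
  refine ⟨(M.pk_cont _ _ _).div_const _, fun y => ?_, fun η hη => ?_⟩
  · rw [norm_div, Complex.norm_real, Real.norm_of_nonneg (by positivity), div_le_iff₀ (by positivity)]
    refine (M.pk_bound_le hR θ u y (k := 3) (by norm_num)).trans ?_
    have h1 := W_mul_le (R r s.n * (s.lo r - u)) (R r s.n * (u - y))
    have e1 : R r s.n * (s.lo r - u) + R r s.n * (u - y) = R r s.n * (s.lo r - y) := by ring
    rw [e1] at h1
    have hWu := W_pos (R r s.n * (u - y))
    have h2 : W (R r s.n * (u - y)) ≤ 2 * W (R r s.n * (s.lo r - y)) / W (R r s.n * (s.lo r - u)) := by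
      rw [le_div_iff₀ hW]; linarith
    calc C * (R r s.n * W (R r s.n * (u - y)) ^ 3) ≤
          C * (R r s.n * (2 * W (R r s.n * (s.lo r - y)) / W (R r s.n * (s.lo r - u))) ^ 3) := by gcongr
      _ = _ := by rw [div_pow, mul_pow]; ring
  · have := pk_FI_zero M hg0 hg1 s hθ u η hη
    unfold FI at *
    simp_rw [← mul_div_assoc]
    rw [integral_div, this, zero_div]

lemma Adm_pk_sub (s : Tile) {θ ξ : ℝ} (hθ : s.w2 r θ) (hξ : s.w2 r ξ) (hne : θ ≠ ξ) {x : ℝ}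
    (hx : x ∈ Set.Ico (s.lo r) (s.hi r)) :
    Adm r s (fun y => (pk ψ (R r s.n) θ x y - pk ψ (R r s.n) ξ x y) /
      ((54 * π * C * (|θ - ξ| / R r s.n) : ℝ) : ℂ)) := by
  have hR := R_pos r s.n
  have hC := M.C0
  have hd : 0 < |θ - ξ| := abs_pos.2 (sub_ne_zero.2 hne)
  refine ⟨((M.pk_cont _ _ _).sub (M.pk_cont _ _ _)).div_const _, fun y => ?_, fun η hη => ?_⟩
  · rw [norm_div, Complex.norm_real, Real.norm_of_nonneg (by positivity), div_le_iff₀ (by positivity)]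
    set v := R r s.n * (x - y) with hv
    have h1 : pk ψ (R r s.n) θ x y - pk ψ (R r s.n) ξ x y = R r s.n * ψ v * (e (θ * (x - y)) - e (ξ * (x - y))) := by
      unfold pk; ring
    rw [h1, norm_mul, norm_mul, Complex.norm_real, Real.norm_of_nonneg hR.le]
    have h2 : ‖e (θ * (x - y)) - e (ξ * (x - y))‖ ≤ 2 * π * (|θ - ξ| / R r s.n) * |v| := by
      refine (e_sub_le _ _).trans (le_of_eq ?_)
      rw [← sub_mul, abs_mul, hv, abs_mul, abs_of_pos hR]
      field_simp
    have h3 : |v| * W v ≤ 1 := by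
      unfold W
      rw [← div_eq_mul_inv, div_le_one (by positivity)]
      nlinarith [sq_abs v, sq_nonneg (|v| - 1), abs_nonneg v]
    have hWv := W_pos v
    have h4 : W v ≤ 3 * W (R r s.n * (s.lo r - y)) := by
      have := W_shift (t := R r s.n * (s.lo r - y)) (h := R r s.n * (x - s.lo r)) (by
        rw [abs_of_nonneg (mul_nonneg hR.le (by linarith [hx.1]))]
        have h5 := Tile.len r s
        have : x - s.lo r ≤ 1 / R r s.n := by linarith [hx.2]
        rw [le_div_iff₀ hR] at this; linarith)
      have e1 : R r s.n * (s.lo r - y) + R r s.n * (x - s.lo r) = v := by rw [hv]; ring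
      rwa [e1] at this
    calc R r s.n * ‖ψ v‖ * ‖e (θ * (x - y)) - e (ξ * (x - y))‖
        ≤ R r s.n * (C * W v ^ 6) * (2 * π * (|θ - ξ| / R r s.n) * |v|) := by
          gcongr; exact M.decay v
      _ = 2 * π * C * (|θ - ξ| / R r s.n) * R r s.n * (W v ^ 5 * (|v| * W v)) := by ring
      _ ≤ 2 * π * C * (|θ - ξ| / R r s.n) * R r s.n * (W v ^ 3 * 1) := by
          exact mul_le_mul_of_nonneg_left (mul_le_mul (W_pow_le (a := 3) (b := 5) (by norm_num)) h3 (by positivity) (by positivity)) (by positivity)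
      _ ≤ 2 * π * C * (|θ - ξ| / R r s.n) * R r s.n * ((3 * W (R r s.n * (s.lo r - y))) ^ 3 * 1) := by gcongr
      _ = _ := by ring
  · have h1 := pk_FI_zero M hg0 hg1 s hθ x η hη
    have h2 := pk_FI_zero M hg0 hg1 s hξ x η hη
    unfold FI at *
    simp_rw [← mul_div_assoc, mul_sub]
    have i1 : ∀ θ, Integrable (fun y => e (y * η) * pk ψ (R r s.n) θ x y) := fun θ =>
      (M.pk_integrable hR θ x).bdd_mul (c := 1) (Continuous.aestronglyMeasurable (by fun_prop))
        (Filter.Eventually.of_forall fun y => by simp)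
    rw [integral_div, integral_sub (i1 θ) (i1 ξ), h1, h2]; simp

variable {f : ℝ → ℂ} (hf : Fok f)
include hf

lemma Ps_le (s : Tile) {θ : ℝ} (hθ : s.w2 r θ) (u : ℝ) :
    ‖Ps f ψ (R r s.n) θ u‖ ≤ 8 * C / W (R r s.n * (s.lo r - u)) ^ 3 * co r f s := by
  have hC := M.C0
  have := W_pos (R r s.n * (s.lo r - u))
  exact le_co_mul hf (by positivity) (Adm_pk M hg0 hg1 s hθ u)

lemma Ps_le_near (s : Tile) {θ : ℝ} (hθ : s.w2 r θ) {u : ℝ} (hu : u ∈ Set.Ico (s.lo r) (s.hi r)) :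
    ‖Ps f ψ (R r s.n) θ u‖ ≤ 64 * C * co r f s := by
  have hC := M.C0
  have hR := R_pos r s.n
  have h0 := co_nonneg (r := r) hf s
  refine (Ps_le M hg0 hg1 hf s hθ u).trans ?_
  gcongr
  have hW : 1 / 2 ≤ W (R r s.n * (s.lo r - u)) := by
    have h5 := Tile.len r s
    have : u - s.lo r ≤ 1 / R r s.n := by linarith [hu.2]
    rw [le_div_iff₀ hR] at this
    have h6 : 0 ≤ R r s.n * (u - s.lo r) := mul_nonneg hR.le (by linarith [hu.1])
    unfold W
    rw [one_div]
    apply inv_anti₀ (by positivity)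
    nlinarith
  rw [div_le_iff₀ (by positivity)]
  calc 8 * C = 64 * C * (1 / 2) ^ 3 := by ring
    _ ≤ _ := by gcongr

lemma Ps_sub_le (s : Tile) {θ ξ : ℝ} (hθ : s.w2 r θ) (hξ : s.w2 r ξ) {x : ℝ}
    (hx : x ∈ Set.Ico (s.lo r) (s.hi r)) :
    ‖Ps f ψ (R r s.n) θ x - Ps f ψ (R r s.n) ξ x‖ ≤ 54 * π * C * (|θ - ξ| / R r s.n) * co r f s := by
  have hC := M.C0
  have hR := R_pos r s.n
  by_cases hne : θ = ξ
  · subst hne; simp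
  have hd : 0 < |θ - ξ| := abs_pos.2 (sub_ne_zero.2 hne)
  have := le_co_mul hf (by positivity) (Adm_pk_sub M hg0 hg1 s hθ hξ hne hx)
  simp_rw [sub_mul] at this
  rwa [integral_sub (hf.mul_integrable (M.pk_integrable hR θ x)) (hf.mul_integrable (M.pk_integrable hR ξ x))] at this
end

lemma mm0 (η : ℝ) (h : η ≤ 1 / 128) : mm η = 0 := mm_zero_left (by linarith)
lemma mm1 (η : ℝ) (h : 3 / 4 ≤ η) : mm η = 0 := mm_zero_right (by linarith)
lemma mt0 (η : ℝ) (h : η ≤ 1 / 128) : mt η = 0 := mt_zero_left h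
lemma mt1 (η : ℝ) (h : 3 / 4 ≤ η) : mt η = 0 := mt_zero_right h

end CarlesonProof

end


section
open MeasureTheory
open scoped Real ENNReal

set_option linter.unusedSectionVars false
set_option linter.unusedVariables false
namespace CarlesonProof

section
variable {ψ : ℝ → ℂ} {g : ℝ → ℝ} {C : ℝ} (M : Mother ψ g C)
include M

lemma Mother.pk_bdd {ρ : ℝ} (hρ : 0 < ρ) (θ x y : ℝ) : ‖pk ψ ρ θ x y‖ ≤ C * ρ := by
  have := M.pk_bound_le hρ θ x y (k := 0) (by norm_num)
  simpa using this

lemma Mother.pk_mul_integrable {ρ ρ' : ℝ} (hρ : 0 < ρ) (hρ' : 0 < ρ') (ξ x x' : ℝ) :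
    Integrable (fun u => pk ψ ρ ξ x u * (starRingEnd ℂ) (pk ψ ρ' ξ x' u)) := by
  refine (M.pk_integrable hρ ξ x).mul_bdd (c := C * ρ') ?_ ?_
  · exact (Complex.continuous_conj.comp (M.pk_cont ρ' ξ x')).aestronglyMeasurable
  · exact Filter.Eventually.of_forall fun y => by rw [RCLike.norm_conj]; exact M.pk_bdd hρ' _ _ _

lemma Mother.pk_inner {ρ ρ' : ℝ} (hρ : 0 < ρ) (hn : ρ ≤ ρ') (ξ x x' : ℝ) :
    ‖∫ u, pk ψ ρ ξ x u * (starRingEnd ℂ) (pk ψ ρ' ξ x' u)‖ ≤ C ^ 2 * (4 * π * ρ * W (ρ * (x - x'))) := by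
  have hρ' : 0 < ρ' := hρ.trans_le hn
  have hC := M.C0
  have h2 : ∫ u, (ρ * W (ρ * (x - u)) ^ 3) * (ρ' * W (ρ' * (x' - u)) ^ 3) ≤ 4 * π * ρ * W (ρ * (x - x')) := by
    refine (P2_integral hρ hn x x').trans ?_
    have := W_pow_le_self (t := ρ * (x - x')) (b := 2) (by norm_num)
    gcongr
  refine le_trans ?_ (mul_le_mul_of_nonneg_left h2 (by positivity))
  rw [← integral_const_mul]
  refine (norm_integral_le_integral_norm _).trans ?_
  refine integral_mono_of_nonneg (Filter.Eventually.of_forall fun y => norm_nonneg _) ?_ ?_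
  · refine Integrable.const_mul ?_ _
    have h1 := (W_scale_integrable hρ' x').const_mul ρ'
    refine (h1.const_mul (4 * ρ * W (ρ * (x - x')) ^ 2)).mono' ?_ ?_
    · have := W_continuous
      exact Continuous.aestronglyMeasurable (by fun_prop)
    · refine Filter.Eventually.of_forall fun u => ?_
      have := W_nonneg (ρ * (x - u)); have := W_nonneg (ρ' * (x' - u))
      rw [Real.norm_of_nonneg (by positivity)]
      exact P2_point hρ hn _ _ u
  · refine Filter.Eventually.of_forall fun y => ?_
    simp only [norm_mul, RCLike.norm_conj]
    have := W_nonneg (ρ * (x - y))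
    calc _ ≤ (C * (ρ * W (ρ * (x - y)) ^ 3)) * (C * (ρ' * W (ρ' * (x' - y)) ^ 3)) :=
          mul_le_mul (M.pk_bound_le hρ _ _ _ (by norm_num)) (M.pk_bound_le hρ' _ _ _ (by norm_num)) (norm_nonneg _) (by positivity)
      _ = _ := by ring
end

variable {r : ℕ} [NeZero r]
variable {ι : Type*} (Q : Finset ι) (p q x : ι → ℝ) 
  (hpx : ∀ k ∈ Q, p k ≤ x k) (hxq : ∀ k ∈ Q, x k ≤ q k)
  (hdis : (Q : Set ι).PairwiseDisjoint (fun k => Set.Ico (p k) (q k)))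
  (ε : ι → ℂ) (hε : ∀ k, ‖ε k‖ = 1) (ξ : ℝ)

/-- Bessel type sum -/
noncomputable def Gam (r : ℕ) (l : ι → ℕ) (y : ℝ) : ℂ :=
  ∑ k ∈ Q, (((q k - p k : ℝ) : ℂ) * ε k) * pk zeta (R r (l k)) ξ (x k) y

include hpx hxq hdis hε in
open Classical in
lemma Gam_bound (l : ι → ℕ) (hl : ∀ k ∈ Q, q k - p k ≤ 1 / R r (l k)) :
    ∫ y, ‖Gam Q p q x ε ξ r l y‖ ^ 2 ≤ 24 * π ^ 2 * CM ^ 2 * ∑ k ∈ Q, (q k - p k) := by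
  have M := zeta_mother
  have hCM := CM_pos
  have hL : ∀ k ∈ Q, 0 ≤ q k - p k := fun k hk => by linarith [hpx k hk, hxq k hk]
  unfold Gam
  have hconv : ∀ k k' y, ((((q k - p k : ℝ) : ℂ) * ε k) * pk zeta (R r (l k)) ξ (x k) y) *
      (starRingEnd ℂ) ((((q k' - p k' : ℝ) : ℂ) * ε k') * pk zeta (R r (l k')) ξ (x k') y) =
      ((((q k - p k : ℝ) : ℂ) * ε k) * (starRingEnd ℂ) (((q k' - p k' : ℝ) : ℂ) * ε k')) *
      (pk zeta (R r (l k)) ξ (x k) y * (starRingEnd ℂ) (pk zeta (R r (l k')) ξ (x k') y)) := by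
    intro k k' y; simp only [map_mul]; ring
  refine (norm_sq_sum_le Q _ ?_).trans ?_
  · intro k _ k' _
    simp_rw [hconv]
    exact (M.pk_mul_integrable (R_pos r _) (R_pos r _) _ _ _).const_mul _
  set B : ι → ι → ℝ := fun k k' => if l k ≤ l k' then
    (q k - p k) * (CM ^ 2 * (4 * π * R r (l k))) * ((q k' - p k') * W (R r (l k) * (x k - x k'))) else 0 with hB
  have hB0 : ∀ k ∈ Q, ∀ k' ∈ Q, 0 ≤ B k k' := by
    intro k hk k' hk'
    have := hL k hk; have := hL k' hk'; have := R_pos r (l k); have := W_nonneg (R r (l k) * (x k - x k'))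
    simp only [hB]; split_ifs <;> positivity
  have hn : ∀ k ∈ Q, ∀ k' ∈ Q, ‖∫ y, ((((q k - p k : ℝ) : ℂ) * ε k) * pk zeta (R r (l k)) ξ (x k) y) *
      (starRingEnd ℂ) ((((q k' - p k' : ℝ) : ℂ) * ε k') * pk zeta (R r (l k')) ξ (x k') y)‖ =
      (q k - p k) * (q k' - p k') * ‖∫ y, pk zeta (R r (l k)) ξ (x k) y * (starRingEnd ℂ) (pk zeta (R r (l k')) ξ (x k') y)‖ := by
    intro k hk k' hk'
    simp_rw [hconv]
    rw [integral_const_mul, norm_mul, norm_mul, norm_mul, RCLike.norm_conj, norm_mul, hε, hε, Complex.norm_real,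
      Complex.norm_real, Real.norm_of_nonneg (hL k hk), Real.norm_of_nonneg (hL k' hk')]
    ring
  have hle : ∀ k ∈ Q, ∀ k' ∈ Q, l k ≤ l k' → (q k - p k) * (q k' - p k') * ‖∫ y, pk zeta (R r (l k)) ξ (x k) y * (starRingEnd ℂ) (pk zeta (R r (l k')) ξ (x k') y)‖ ≤ B k k' := by
    intro k hk k' hk' h
    simp only [hB, if_pos h]
    have h1 := M.pk_inner (R_pos r (l k)) (R_mono r h) ξ (x k) (x k')
    have := hL k hk; have := hL k' hk'
    calc _ ≤ (q k - p k) * (q k' - p k') * (CM ^ 2 * (4 * π * R r (l k) * W (R r (l k) * (x k - x k')))) := by gcongr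
      _ = _ := by ring
  have hsum : ∑ k ∈ Q, ∑ k' ∈ Q, B k k' ≤ 12 * π ^ 2 * CM ^ 2 * ∑ k ∈ Q, (q k - p k) := by
    rw [Finset.mul_sum]
    refine Finset.sum_le_sum fun k hk => ?_
    simp only [hB]
    rw [← Finset.sum_filter, ← Finset.mul_sum]
    have hR := R_pos r (l k)
    have h1 := SUMW (Q.filter (fun k' => l k ≤ l k')) p q x hR (x k)
      (fun k' h => hpx k' (Finset.mem_filter.1 h).1) (fun k' h => hxq k' (Finset.mem_filter.1 h).1)
      (fun k' h => (hl k' (Finset.mem_filter.1 h).1).trans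
        (one_div_le_one_div_of_le hR (R_mono r (Finset.mem_filter.1 h).2)))
      (hdis.subset (by exact_mod_cast Finset.filter_subset _ _))
    have := hL k hk
    calc _ ≤ (q k - p k) * (CM ^ 2 * (4 * π * R r (l k))) * (3 * π / R r (l k)) := by gcongr
      _ = _ := by field_simp; ring
  calc _ ≤ ∑ k ∈ Q, ∑ k' ∈ Q, (B k k' + B k' k) := by
        refine Finset.sum_le_sum fun k hk => Finset.sum_le_sum fun k' hk' => ?_
        rw [hn k hk k' hk']
        rcases le_total (l k) (l k') with h | h
        · linarith [hle k hk k' hk' h, hB0 k' hk' k hk]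
        · have := hle k' hk' k hk h
          rw [conj_integral_swap, mul_comm (q k' - p k')] at this
          linarith [hB0 k hk k' hk']
    _ = 2 * ∑ k ∈ Q, ∑ k' ∈ Q, B k k' := by
        simp_rw [Finset.sum_add_distrib]
        rw [Finset.sum_comm (f := fun k k' => B k' k)]; ring
    _ ≤ 2 * (12 * π ^ 2 * CM ^ 2 * ∑ k ∈ Q, (q k - p k)) := by gcongr
    _ = _ := by ring

/-- the scale `n` part -/
noncomputable def Gn (r : ℕ) (b d : ι → ℕ) (n : ℕ) (y : ℝ) : ℂ :=
  ∑ k ∈ Q with b k < n ∧ n ≤ d k, (((q k - p k : ℝ) : ℂ) * ε k) * pk psi (R r n) ξ (x k) y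

lemma FI_sum {κ : Type*} (A : Finset κ) (c : κ → ℂ) (φ : κ → ℝ → ℂ) (h : ∀ k ∈ A, Integrable (φ k)) (η : ℝ) :
    FI (fun y => ∑ k ∈ A, c k * φ k y) η = ∑ k ∈ A, c k * FI (φ k) η := by
  unfold FI
  simp_rw [Finset.mul_sum]
  rw [integral_finsetSum]
  · refine Finset.sum_congr rfl fun k _ => ?_
    rw [← integral_const_mul]; congr 1; ext y; ring
  · intro k hk
    refine Integrable.bdd_mul (c := 1) ((h k hk).const_mul _) (Continuous.aestronglyMeasurable (by fun_prop))
        (Filter.Eventually.of_forall fun y => by simp)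

lemma Gn_integrable (b d : ι → ℕ) (n : ℕ) : Integrable (Gn Q p q x ε ξ r b d n) :=
  integrable_finsetSum _ fun k _ => (psi_mother.pk_integrable (R_pos r n) ξ _).const_mul _
lemma Gn_cont (b d : ι → ℕ) (n : ℕ) : Continuous (Gn Q p q x ε ξ r b d n) :=
  continuous_finsetSum _ fun k _ => continuous_const.mul (psi_mother.pk_cont _ _ _)
lemma Gam_integrable (l : ι → ℕ) : Integrable (Gam Q p q x ε ξ r l) :=
  integrable_finsetSum _ fun k _ => (zeta_mother.pk_integrable (R_pos r _) ξ _).const_mul _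
lemma Gam_cont (l : ι → ℕ) : Continuous (Gam Q p q x ε ξ r l) :=
  continuous_finsetSum _ fun k _ => continuous_const.mul (zeta_mother.pk_cont _ _ _)

lemma FI_Gn (b d : ι → ℕ) (hbd : ∀ k ∈ Q, b k ≤ d k) (n : ℕ) (η : ℝ) :
    FI (Gn Q p q x ε ξ r b d n) η = mm ((η - ξ) / R r n) *
      (FI (Gam Q p q x ε ξ r d) η - FI (Gam Q p q x ε ξ r b) η) := by
  unfold Gn Gam
  rw [FI_sum _ _ _ fun k _ => psi_mother.pk_integrable (R_pos r n) ξ _,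
    FI_sum _ _ _ fun k _ => zeta_mother.pk_integrable (R_pos r _) ξ _,
    FI_sum _ _ _ fun k _ => zeta_mother.pk_integrable (R_pos r _) ξ _,
    ← Finset.sum_sub_distrib, Finset.mul_sum, Finset.sum_filter]
  refine Finset.sum_congr rfl fun k hk => ?_
  rw [psi_mother.FI_pk (R_pos r n), zeta_mother.FI_pk (R_pos r _), zeta_mother.FI_pk (R_pos r _)]
  have hRn := R_pos r n
  by_cases hz : mm ((η - ξ) / R r n) = 0
  · rw [hz]; simp
  have h1 : 1 / 64 < (η - ξ) / R r n := by
    by_contra h; exact hz (mm_zero_left (not_lt.1 h))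
  have h2 : (η - ξ) / R r n < 1 / 2 := by
    by_contra h; exact hz (mm_zero_right (not_lt.1 h))
  rw [lt_div_iff₀ hRn] at h1
  rw [div_lt_iff₀ hRn] at h2
  have z1 : ∀ a, n ≤ a → mz ((η - ξ) / R r a) = 1 := by
    intro a ha
    have hRa := R_pos r a
    have := R_mono r ha
    apply mz_one
    · apply div_nonneg _ hRa.le; linarith
    · rw [div_le_iff₀ hRa]; linarith
  have z0 : ∀ a, a < n → mz ((η - ξ) / R r a) = 0 := by
    intro a ha
    have hRa := R_pos r a
    have := R_mono r (show a + 1 ≤ n from ha)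
    rw [R_succ] at this
    apply mz_zero_right
    rw [le_div_iff₀ hRa]; linarith
  have := hbd k hk
  split_ifs with h
  · rw [z1 _ h.2, z0 _ h.1]; push_cast; ring
  · rw [not_and_or, not_lt, not_le] at h
    rcases h with h | h
    · rw [z1 _ h, z1 _ (h.trans this)]; ring
    · rw [z0 _ h, z0 _ (this.trans_lt h)]; ring

lemma parseval_norm {φ : ℝ → ℂ} (hc : Continuous φ) (hi : Integrable φ) (hF : Integrable (FI φ)) :
    ∫ y, ‖φ y‖ ^ 2 = ∫ η, ‖FI φ η‖ ^ 2 := by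
  have h := parseval hi hc hi hF
  simp_rw [Complex.mul_conj, Complex.normSq_eq_norm_sq] at h
  rw [integral_complex_ofReal, integral_complex_ofReal] at h
  exact_mod_cast h

lemma sq_integrable {φ : ℝ → ℂ} (hi : Integrable φ) {K : ℝ} (hK : ∀ y, ‖φ y‖ ≤ K) : Integrable (fun y => ‖φ y‖ ^ 2) := by
  have h1 := hi.norm
  have h2 := h1.mul_bdd (c := K) h1.aestronglyMeasurable (Filter.Eventually.of_forall fun y => by
    rw [norm_norm]; exact hK y)
  simpa [sq] using h2

lemma FI_le {φ : ℝ → ℂ} (η : ℝ) : ‖FI φ η‖ ≤ ∫ y, ‖φ y‖ := by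
  unfold FI
  refine (norm_integral_le_integral_norm _).trans (le_of_eq ?_)
  simp

lemma Mother.FI_integrable {ψ : ℝ → ℂ} {g : ℝ → ℝ} {C : ℝ} (M : Mother ψ g C) (hg : Continuous g)
    (hs : HasCompactSupport g) {ρ : ℝ} (hρ : 0 < ρ) (θ x : ℝ) : Integrable (FI (pk ψ ρ θ x)) := by
  have h1 : FI (pk ψ ρ θ x) = fun η => e (x * η) * g ((η - θ) / ρ) := by
    ext η; exact M.FI_pk hρ θ x η
  rw [h1]
  have h2 : Integrable g := hg.integrable_of_hasCompactSupport hs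
  have h3 : Integrable (fun η => g ((η - θ) / ρ)) := (h2.comp_div hρ.ne').comp_sub_right θ
  exact h3.ofReal.bdd_mul (c := 1) (Continuous.aestronglyMeasurable (by fun_prop))
        (Filter.Eventually.of_forall fun y => by simp)

lemma FI_sum_integrable {κ : Type*} (A : Finset κ) (c : κ → ℂ) (φ : κ → ℝ → ℂ) (h : ∀ k ∈ A, Integrable (φ k))
    (h' : ∀ k ∈ A, Integrable (FI (φ k))) : Integrable (FI (fun y => ∑ k ∈ A, c k * φ k y)) := by
  have : FI (fun y => ∑ k ∈ A, c k * φ k y) = fun η => ∑ k ∈ A, c k * FI (φ k) η := by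
    ext η; exact FI_sum A c φ h η
  rw [this]
  exact integrable_finsetSum _ fun k hk => (h' k hk).const_mul _

lemma Gn_FI_integrable (b d : ι → ℕ) (n : ℕ) : Integrable (FI (Gn Q p q x ε ξ r b d n)) :=
  FI_sum_integrable _ _ _ (fun k _ => psi_mother.pk_integrable (R_pos r n) ξ _)
    fun k _ => psi_mother.FI_integrable mm_smooth.continuous mm_supp (R_pos r n) ξ _
lemma Gam_FI_integrable (l : ι → ℕ) : Integrable (FI (Gam Q p q x ε ξ r l)) :=
  FI_sum_integrable _ _ _ (fun k _ => zeta_mother.pk_integrable (R_pos r _) ξ _)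
    fun k _ => zeta_mother.FI_integrable mz_smooth.continuous mz_supp (R_pos r _) ξ _
lemma Gam_bdd (l : ι → ℕ) : ∃ K, ∀ y, ‖Gam Q p q x ε ξ r l y‖ ≤ K := by
  refine ⟨∑ k ∈ Q, ‖((q k - p k : ℝ) : ℂ) * ε k‖ * (CM * R r (l k)), fun y => ?_⟩
  refine (norm_sum_le _ _).trans (Finset.sum_le_sum fun k _ => ?_)
  rw [norm_mul]
  exact mul_le_mul_of_nonneg_left (zeta_mother.pk_bdd (R_pos r _) _ _ _) (norm_nonneg _)
lemma Gn_bdd (b d : ι → ℕ) (n : ℕ) : ∃ K, ∀ y, ‖Gn Q p q x ε ξ r b d n y‖ ≤ K := by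
  refine ⟨∑ k ∈ Q with b k < n ∧ n ≤ d k, ‖((q k - p k : ℝ) : ℂ) * ε k‖ * (CM * R r n), fun y => ?_⟩
  refine (norm_sum_le _ _).trans (Finset.sum_le_sum fun k _ => ?_)
  rw [norm_mul]
  exact mul_le_mul_of_nonneg_left (psi_mother.pk_bdd (R_pos r _) _ _ _) (norm_nonneg _)
lemma Gn_sq_integrable (b d : ι → ℕ) (n : ℕ) : Integrable (fun y => ‖Gn Q p q x ε ξ r b d n y‖ ^ 2) :=
  sq_integrable (Gn_integrable Q p q x ε ξ b d n) (Gn_bdd Q p q x ε ξ b d n).choose_spec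
lemma Gam_sq_integrable (l : ι → ℕ) : Integrable (fun y => ‖Gam Q p q x ε ξ r l y‖ ^ 2) :=
  sq_integrable (Gam_integrable Q p q x ε ξ l) (Gam_bdd Q p q x ε ξ l).choose_spec

lemma mm_sq_sum (B : Finset ℕ) (v : ℝ) : ∑ n ∈ B, |mm (v / R r n)| ^ 2 ≤ 1 := by
  classical
  by_cases h : ∃ n ∈ B, mm (v / R r n) ≠ 0
  · obtain ⟨n, hn, hne⟩ := h
    rw [Finset.sum_eq_single_of_mem n hn]
    · exact pow_le_one₀ (abs_nonneg _) (mm_abs_le _)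
    · intro n' hn' hnn
      suffices mm (v / R r n') = 0 by rw [this]; simp
      have hRn := R_pos r n
      have hRn' := R_pos r n'
      have h1 : 1 / 64 < v / R r n := by
        by_contra h; exact hne (mm_zero_left (not_lt.1 h))
      have h2 : v / R r n < 1 / 2 := by
        by_contra h; exact hne (mm_zero_right (not_lt.1 h))
      rw [lt_div_iff₀ hRn] at h1
      rw [div_lt_iff₀ hRn] at h2
      rcases lt_or_gt_of_ne hnn with h | h
      · have := R_mono r (show n' + 1 ≤ n from h)
        rw [R_succ] at this
        apply mm_zero_right
        rw [le_div_iff₀ hRn']; linarith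
      · have := R_mono r (show n + 1 ≤ n' from h)
        rw [R_succ] at this
        apply mm_zero_left
        rw [div_le_iff₀ hRn']; linarith
  · push Not at h
    rw [Finset.sum_eq_zero fun n hn => by rw [h n hn]; simp]
    exact zero_le_one

include hpx hxq hdis hε in
lemma Gn_sum (b d : ι → ℕ) (hbd : ∀ k ∈ Q, b k ≤ d k) (hd : ∀ k ∈ Q, q k - p k ≤ 1 / R r (d k)) (B : Finset ℕ) :
    ∑ n ∈ B, ∫ y, ‖Gn Q p q x ε ξ r b d n y‖ ^ 2 ≤ 96 * π ^ 2 * CM ^ 2 * ∑ k ∈ Q, (q k - p k) := by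
  have hb : ∀ k ∈ Q, q k - p k ≤ 1 / R r (b k) := fun k hk =>
    (hd k hk).trans (one_div_le_one_div_of_le (R_pos r _) (R_mono r (hbd k hk)))
  set Γ : ℝ → ℂ := fun y => Gam Q p q x ε ξ r d y - Gam Q p q x ε ξ r b y with hΓ
  have hΓi : Integrable Γ := (Gam_integrable Q p q x ε ξ d).sub (Gam_integrable Q p q x ε ξ b)
  have hΓc : Continuous Γ := (Gam_cont Q p q x ε ξ d).sub (Gam_cont Q p q x ε ξ b)
  have hFΓ : FI Γ = fun η => FI (Gam Q p q x ε ξ r d) η - FI (Gam Q p q x ε ξ r b) η := by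
    ext η
    have i1 : ∀ φ : ℝ → ℂ, Integrable φ → Integrable (fun y => e (y * η) * φ y) := fun φ h =>
      h.bdd_mul (c := 1) (Continuous.aestronglyMeasurable (by fun_prop))
        (Filter.Eventually.of_forall fun y => by simp)
    unfold FI
    rw [← integral_sub (i1 _ (Gam_integrable Q p q x ε ξ d)) (i1 _ (Gam_integrable Q p q x ε ξ b))]
    congr 1; ext y; simp only [hΓ]; ring
  have hFΓi : Integrable (FI Γ) := by
    rw [hFΓ]; exact (Gam_FI_integrable Q p q x ε ξ d).sub (Gam_FI_integrable Q p q x ε ξ b)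
  have hFΓ2 : Integrable (fun η => ‖FI Γ η‖ ^ 2) := sq_integrable hFΓi fun η => FI_le η
  calc ∑ n ∈ B, ∫ y, ‖Gn Q p q x ε ξ r b d n y‖ ^ 2 = ∑ n ∈ B, ∫ η, ‖FI (Gn Q p q x ε ξ r b d n) η‖ ^ 2 :=
        Finset.sum_congr rfl fun n _ => parseval_norm (Gn_cont Q p q x ε ξ b d n) (Gn_integrable Q p q x ε ξ b d n)
          (Gn_FI_integrable Q p q x ε ξ b d n)
    _ = ∫ η, ∑ n ∈ B, ‖FI (Gn Q p q x ε ξ r b d n) η‖ ^ 2 := by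
        rw [integral_finsetSum]
        exact fun n _ => sq_integrable (Gn_FI_integrable Q p q x ε ξ b d n) fun η => FI_le η
    _ ≤ ∫ η, ‖FI Γ η‖ ^ 2 := by
        refine integral_mono (integrable_finsetSum _ fun n _ => sq_integrable (Gn_FI_integrable Q p q x ε ξ b d n) fun η => FI_le η) hFΓ2 fun η => ?_
        simp only
        calc ∑ n ∈ B, ‖FI (Gn Q p q x ε ξ r b d n) η‖ ^ 2 = ∑ n ∈ B, |mm ((η - ξ) / R r n)| ^ 2 * ‖FI Γ η‖ ^ 2 := by
              refine Finset.sum_congr rfl fun n _ => ?_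
              rw [FI_Gn Q p q x ε ξ b d hbd n η, hFΓ, norm_mul, Complex.norm_real, mul_pow, Real.norm_eq_abs]
          _ ≤ 1 * ‖FI Γ η‖ ^ 2 := by
              rw [← Finset.sum_mul]
              exact mul_le_mul_of_nonneg_right (mm_sq_sum B _) (by positivity)
          _ = _ := one_mul _
    _ = ∫ y, ‖Γ y‖ ^ 2 := (parseval_norm hΓc hΓi hFΓi).symm
    _ ≤ ∫ y, (2 * ‖Gam Q p q x ε ξ r d y‖ ^ 2 + 2 * ‖Gam Q p q x ε ξ r b y‖ ^ 2) := by
        refine integral_mono_of_nonneg (Filter.Eventually.of_forall fun y => by positivity)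
          (((Gam_sq_integrable Q p q x ε ξ d).const_mul 2).add ((Gam_sq_integrable Q p q x ε ξ b).const_mul 2))
          (Filter.Eventually.of_forall fun y => ?_)
        simp only [hΓ]
        have h1 := norm_sub_le (Gam Q p q x ε ξ r d y) (Gam Q p q x ε ξ r b y)
        have h2 := norm_nonneg (Gam Q p q x ε ξ r d y - Gam Q p q x ε ξ r b y)
        nlinarith [sq_nonneg (‖Gam Q p q x ε ξ r d y‖ - ‖Gam Q p q x ε ξ r b y‖)]
    _ = 2 * (∫ y, ‖Gam Q p q x ε ξ r d y‖ ^ 2) + 2 * ∫ y, ‖Gam Q p q x ε ξ r b y‖ ^ 2 := by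
        rw [integral_add ((Gam_sq_integrable Q p q x ε ξ d).const_mul 2) ((Gam_sq_integrable Q p q x ε ξ b).const_mul 2),
          integral_const_mul, integral_const_mul]
    _ ≤ _ := by
        have h1 := Gam_bound Q p q x hpx hxq hdis ε hε ξ d hd
        have h2 := Gam_bound Q p q x hpx hxq hdis ε hε ξ b hb
        linarith

end CarlesonProof

end


section
open MeasureTheory
open scoped Real ENNReal

set_option linter.unusedSectionVars false
set_option linter.unusedVariables false
namespace CarlesonProof

lemma Fok.integrable {f : ℝ → ℂ} (hf : Fok f) : Integrable f := by
  have h1 : Integrable (Set.indicator (Set.Icc (-1:ℝ) 2) (fun _ => (1:ℝ))) :=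
    (integrable_indicator_iff measurableSet_Icc).2 (by simp)
  refine h1.mono' hf.meas.aestronglyMeasurable (Filter.Eventually.of_forall fun x => ?_)
  by_cases h : x ∈ Set.Icc (-1:ℝ) 2
  · simpa [h] using hf.bdd x
  · simp [h, hf.supp x h]

section
variable {ψ : ℝ → ℂ} {g : ℝ → ℝ} {C : ℝ} (M : Mother ψ g C) {f : ℝ → ℂ} (hf : Fok f)
include M hf

lemma Ps_cont {ρ : ℝ} (hρ : 0 < ρ) (θ : ℝ) : Continuous (Ps f ψ ρ θ) := by
  unfold Ps
  refine continuous_of_dominated (bound := fun y => C * ρ * ‖f y‖) (fun u => ?_) (fun u => ?_) ?_ ?_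
  · exact ((M.pk_cont _ _ _).aestronglyMeasurable).mul hf.meas.aestronglyMeasurable
  · refine Filter.Eventually.of_forall fun y => ?_
    rw [norm_mul]
    exact mul_le_mul_of_nonneg_right (M.pk_bdd hρ _ _ _) (norm_nonneg _)
  · exact hf.integrable.norm.const_mul _
  · exact Filter.Eventually.of_forall fun y => (M.pk_cont' _ _ _).mul continuous_const

lemma Ps_bdd {ρ : ℝ} (hρ : 0 < ρ) (θ u : ℝ) : ‖Ps f ψ ρ θ u‖ ≤ C * π := by
  refine (hf.norm_integral_le (M.pk_integrable hρ θ u)).trans ?_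
  have hi := ((W_scale_pow_integrable hρ u (k := 1) (by norm_num)).const_mul ρ).const_mul C
  refine (integral_mono (M.pk_integrable hρ θ u).norm hi fun y => M.pk_bound_le hρ θ u y (by norm_num)).trans ?_
  simp only [pow_one]
  rw [integral_const_mul, integral_const_mul, W_scale_integral hρ]
  exact le_of_eq (by field_simp)
end

lemma Ps_repr {f : ℝ → ℂ} (hf : Fok f) {ρ : ℝ} (hρ : 0 < ρ) (ξ x : ℝ) :
    Ps f psi ρ ξ x = ∫ u, pk psi ρ ξ x u * Ps f psit ρ ξ u := by
  have Mt := psit_mother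
  have M := psi_mother
  have hc : Continuous (fun z : ℝ × ℝ => pk psi ρ ξ x z.2 * pk psit ρ ξ z.2 z.1) := by
    have := M.cont; have := Mt.cont
    unfold pk; fun_prop
  have hint : Integrable (Function.uncurry fun y u => pk psi ρ ξ x u * pk psit ρ ξ u y * f y) (volume.prod volume) := by
    have h1 : Integrable (fun z : ℝ × ℝ => (CM * ρ) * (‖f z.1‖ * ‖pk psi ρ ξ x z.2‖)) (volume.prod volume) :=
      (Integrable.mul_prod hf.integrable.norm (M.pk_integrable hρ ξ x).norm).const_mul _
    refine h1.mono' ?_ ?_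
    · exact hc.aestronglyMeasurable.mul (hf.meas.comp measurable_fst).aestronglyMeasurable
    · refine Filter.Eventually.of_forall fun z => ?_
      simp only [Function.uncurry, norm_mul]
      have := Mt.pk_bdd hρ ξ z.2 z.1
      calc ‖pk psi ρ ξ x z.2‖ * ‖pk psit ρ ξ z.2 z.1‖ * ‖f z.1‖
          ≤ ‖pk psi ρ ξ x z.2‖ * (CM * ρ) * ‖f z.1‖ := by gcongr
        _ = _ := by ring
  calc Ps f psi ρ ξ x = ∫ y, ∫ u, pk psi ρ ξ x u * pk psit ρ ξ u y * f y := by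
        unfold Ps; congr 1; ext y; rw [integral_mul_const, reproducing hρ]
    _ = ∫ u, ∫ y, pk psi ρ ξ x u * pk psit ρ ξ u y * f y := integral_integral_swap hint
    _ = _ := by
        congr 1; ext u; unfold Ps; rw [← integral_const_mul]; congr 1; ext y; ring

lemma W_out {ρ α β x u : ℝ} (h : x ∈ Set.Ico α β ∧ u ∉ Set.Ico α β ∨ x ∉ Set.Ico α β ∧ u ∈ Set.Ico α β) :
    W (ρ * (x - u)) ≤ W (ρ * (α - x)) + W (ρ * (β - x)) := by
  have key : |α - x| ≤ |x - u| ∨ |β - x| ≤ |x - u| := by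
    simp only [Set.mem_Ico, not_and_or, not_le, not_lt] at h
    rcases h with ⟨⟨h1, h2⟩, h | h⟩ | ⟨h | h, h1, h2⟩
    · left; rw [abs_of_nonpos (by linarith), abs_of_nonneg (by linarith)]; linarith
    · right; rw [abs_of_nonneg (by linarith), abs_of_nonpos (by linarith)]; linarith
    · left; rw [abs_of_nonneg (by linarith), abs_of_nonpos (by linarith)]; linarith
    · right; rw [abs_of_nonpos (by linarith), abs_of_nonneg (by linarith)]; linarith
  have h1 := W_nonneg (ρ * (α - x)); have h2 := W_nonneg (ρ * (β - x))
  rcases key with h | h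
  · have : W (ρ * (x - u)) ≤ W (ρ * (α - x)) := W_anti (by rw [abs_mul, abs_mul]; gcongr)
    linarith
  · have : W (ρ * (x - u)) ≤ W (ρ * (β - x)) := W_anti (by rw [abs_mul, abs_mul]; gcongr)
    linarith

section
variable {r : ℕ} [NeZero r]
variable {ι : Type*} (Q : Finset ι) (p q x : ι → ℝ) 
  (hpx : ∀ k ∈ Q, p k ≤ x k) (hxq : ∀ k ∈ Q, x k < q k)
  (hdis : (Q : Set ι).PairwiseDisjoint (fun k => Set.Ico (p k) (q k)))
  (ε : ι → ℂ) (hε : ∀ k, ‖ε k‖ = 1) (ξ : ℝ)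
include hpx hxq hdis hε

/-- estimate at one level -/
lemma level_est (b d : ι → ℕ) (n : ℕ) (hd : ∀ k ∈ Q, q k - p k ≤ 1 / R r (d k)) {α β : ℝ}
    (hI : ∀ k ∈ Q, x k ∈ Set.Ico α β) (Ψ : ℝ → ℂ) {σ c : ℝ} (hσ : 0 < σ) (hc : 0 ≤ c)
    (T : Finset Tile) (hT : ∀ s ∈ T, s.n = n) (a : Tile → ℝ)
    (hon : ∀ u, (∃ s ∈ T, u ∈ Set.Ico (s.lo r) (s.hi r) ∧ ‖Ψ u‖ ≤ a s) ∨
      ((u ∉ Set.Ico α β ∨ ∃ k ∈ Q, d k < n ∧ u ∈ Set.Ico (p k) (q k)) ∧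
        ∀ k ∈ Q, b k < n → n ≤ d k → ‖Ψ u‖ ≤ c / W (R r n * (x k - u)) ^ 3)) :
    ‖∫ u, Gn Q p q x ε ξ r b d n u * Ψ u‖ ≤ σ / 2 * (∫ u, ‖Gn Q p q x ε ξ r b d n u‖ ^ 2) +
      1 / (2 * σ) * (∑ s ∈ T, (a s) ^ 2 / R r s.n) +
      CM * c * (6 * π ^ 2) * (1 / R r n * (1 + ∑ k ∈ Q with d k < n, (1:ℝ))) := by
  classical
  have hR := R_pos r n
  have hL : ∀ k ∈ Q, 0 ≤ q k - p k := fun k hk => by linarith [hpx k hk, hxq k hk]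
  set A := Q.filter (fun k => b k < n ∧ n ≤ d k) with hA
  set A' := Q.filter (fun k => d k < n) with hA'
  set G := Gn Q p q x ε ξ r b d n with hG
  set E : ι → ℝ := fun k => (W (R r n * (α - x k)) + W (R r n * (β - x k))) +
    ∑ k' ∈ A', (W (R r n * (p k' - x k)) + W (R r n * (q k' - x k))) with hE
  have hE0 : ∀ k, 0 ≤ E k := fun k => by
    have := W_nonneg (R r n * (α - x k)); have := W_nonneg (R r n * (β - x k))
    have : 0 ≤ ∑ k' ∈ A', (W (R r n * (p k' - x k)) + W (R r n * (q k' - x k))) :=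
      Finset.sum_nonneg fun k' _ => add_nonneg (W_nonneg _) (W_nonneg _)
    simp only [hE]; positivity
  have hCM := CM_pos
  set m1 : ℝ → ℝ := fun u => σ / 2 * ‖G u‖ ^ 2 with hm1
  set m2 : ℝ → ℝ := fun u => 1 / (2 * σ) * ∑ s ∈ T, (Set.Ico (s.lo r) (s.hi r)).indicator (fun _ => (a s) ^ 2) u with hm2
  set m3 : ℝ → ℝ := fun u => ∑ k ∈ A, ((q k - p k) * E k * (CM * c * R r n)) * W (R r n * (x k - u)) with hm3
  have i1 : Integrable m1 := (Gn_sq_integrable Q p q x ε ξ b d n).const_mul _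
  have i2 : Integrable m2 := (integrable_finsetSum _ fun s _ =>
    (integrable_indicator_iff measurableSet_Ico).2 (by simp)).const_mul _
  have i3 : Integrable m3 := integrable_finsetSum _ fun k _ => (W_scale_integrable hR _).const_mul _
  have hm2n : ∀ u, ∀ s ∈ T, 0 ≤ (Set.Ico (s.lo r) (s.hi r)).indicator (fun _ => (a s) ^ 2) u :=
    fun u s _ => Set.indicator_nonneg (fun _ _ => sq_nonneg _) _
  have hm20 : ∀ u, 0 ≤ m2 u := fun u => mul_nonneg (by positivity) (Finset.sum_nonneg (hm2n u))
  have hm30 : ∀ u, 0 ≤ m3 u := fun u => Finset.sum_nonneg fun k hk => by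
    have := hL k (Finset.mem_filter.1 hk).1; have := hE0 k; have := W_nonneg (R r n * (x k - u))
    positivity
  have hm10 : ∀ u, 0 ≤ m1 u := fun u => by simp only [hm1]; positivity
  have hpt : ∀ u, ‖G u * Ψ u‖ ≤ m1 u + m2 u + m3 u := by
    intro u
    rw [norm_mul]
    rcases hon u with ⟨s, hs, hu, hle⟩ | ⟨hu, hle⟩
    · have h1 : (a s) ^ 2 ≤ ∑ s ∈ T, (Set.Ico (s.lo r) (s.hi r)).indicator (fun _ => (a s) ^ 2) u := by
        have := Finset.single_le_sum (hm2n u) hs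
        simpa [hu] using this
      have h2 : 1 / (2 * σ) * (a s) ^ 2 ≤ m2 u := mul_le_mul_of_nonneg_left h1 (by positivity)
      have h3 : ‖G u‖ * ‖Ψ u‖ ≤ σ / 2 * ‖G u‖ ^ 2 + 1 / (2 * σ) * (a s) ^ 2 := by
        have h4 : ‖G u‖ * ‖Ψ u‖ ≤ ‖G u‖ * a s := by gcongr
        have h5 : σ / 2 * ‖G u‖ ^ 2 + 1 / (2 * σ) * (a s) ^ 2 - ‖G u‖ * a s = 1 / (2 * σ) * (σ * ‖G u‖ - a s) ^ 2 := by
          field_simp; ring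
        have : 0 ≤ 1 / (2 * σ) * (σ * ‖G u‖ - a s) ^ 2 := by positivity
        linarith
      have := hm30 u
      simp only [hm1]
      linarith
    · have h1 : ‖G u‖ * ‖Ψ u‖ ≤ m3 u := by
        have h2 : ‖G u‖ ≤ ∑ k ∈ A, (q k - p k) * (CM * (R r n * W (R r n * (x k - u)) ^ 5)) := by
          simp only [hG, Gn]
          refine (norm_sum_le _ _).trans (Finset.sum_le_sum fun k hk => ?_)
          have := hL k (Finset.mem_filter.1 hk).1
          rw [norm_mul, norm_mul, hε, mul_one, Complex.norm_real, Real.norm_of_nonneg this]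
          exact mul_le_mul_of_nonneg_left (psi_mother.pk_bound_le hR ξ _ _ (by norm_num)) this
        refine (mul_le_mul_of_nonneg_right h2 (norm_nonneg _)).trans ?_
        rw [Finset.sum_mul]
        refine Finset.sum_le_sum fun k hk => ?_
        obtain ⟨hkQ, hk1, hk2⟩ := Finset.mem_filter.1 hk
        have h3 := hL k hkQ
        have hW := W_pos (R r n * (x k - u))
        have h4 : W (R r n * (x k - u)) ≤ E k := by
          simp only [hE]
          have n1 := W_nonneg (R r n * (α - x k)); have n2 := W_nonneg (R r n * (β - x k))
          have n3 : ∀ k' ∈ A', 0 ≤ (W (R r n * (p k' - x k)) + W (R r n * (q k' - x k))) := 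
            fun k' _ => add_nonneg (W_nonneg _) (W_nonneg _)
          rcases hu with hu | ⟨k', hk', hdn, hu⟩
          · have := W_out (ρ := R r n) (Or.inl ⟨hI k hkQ, hu⟩)
            have := Finset.sum_nonneg n3
            linarith
          · have hm : k' ∈ A' := Finset.mem_filter.2 ⟨hk', hdn⟩
            have hne : k ≠ k' := by rintro rfl; omega
            have hx : x k ∉ Set.Ico (p k') (q k') := fun hx =>
              Set.disjoint_left.1 (hdis hkQ hk' hne) ⟨hpx k hkQ, hxq k hkQ⟩ hx
            have := W_out (ρ := R r n) (Or.inr ⟨hx, hu⟩)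
            have := Finset.single_le_sum n3 hm
            linarith
        calc (q k - p k) * (CM * (R r n * W (R r n * (x k - u)) ^ 5)) * ‖Ψ u‖
            ≤ (q k - p k) * (CM * (R r n * W (R r n * (x k - u)) ^ 5)) * (c / W (R r n * (x k - u)) ^ 3) := by
              gcongr; exact hle k hkQ hk1 hk2
          _ = (q k - p k) * W (R r n * (x k - u)) * (CM * c * R r n) * W (R r n * (x k - u)) := by
              field_simp
          _ ≤ _ := by gcongr
      have := hm20 u; have := hm10 u
      linarith
  have e1 : ∫ u, m1 u = σ / 2 * (∫ u, ‖G u‖ ^ 2) := integral_const_mul _ _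
  have e2 : ∫ u, m2 u = 1 / (2 * σ) * (∑ s ∈ T, (a s) ^ 2 / R r s.n) := by
    simp only [hm2]
    rw [integral_const_mul, integral_finsetSum _ fun s _ =>
      (integrable_indicator_iff measurableSet_Ico).2 (by simp)]
    congr 1
    refine Finset.sum_congr rfl fun s _ => ?_
    rw [integral_indicator measurableSet_Ico, setIntegral_const, smul_eq_mul, Measure.real, Real.volume_Ico,
      Tile.len, ENNReal.toReal_ofReal (by have := R_pos r s.n; positivity)]
    ring
  have e3 : ∫ u, m3 u ≤ CM * c * (6 * π ^ 2) * (1 / R r n * (1 + ∑ k ∈ Q with d k < n, (1:ℝ))) := by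
    simp only [hm3]
    rw [integral_finsetSum _ fun k _ => (W_scale_integrable hR _).const_mul _]
    simp_rw [integral_const_mul, W_scale_integral hR]
    have hS : ∀ c, ∑ k ∈ A, (q k - p k) * W (R r n * (c - x k)) ≤ 3 * π / R r n := by
      intro c
      refine SUMW A p q x hR c (fun k hk => hpx k (Finset.mem_filter.1 hk).1)
        (fun k hk => (hxq k (Finset.mem_filter.1 hk).1).le) (fun k hk => ?_) ?_
      · obtain ⟨hkQ, hk1, hk2⟩ := Finset.mem_filter.1 hk
        exact (hd k hkQ).trans (one_div_le_one_div_of_le hR (R_mono r hk2))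
      · exact hdis.subset (by intro k hk; exact (Finset.mem_filter.1 hk).1)
    have hS2 : ∑ k ∈ A, (q k - p k) * E k ≤ 6 * π / R r n * (1 + ∑ k ∈ Q with d k < n, (1:ℝ)) := by
      simp only [hE, mul_add, Finset.sum_add_distrib, Finset.mul_sum]
      rw [Finset.sum_comm (s := A) (t := A'), Finset.sum_comm (s := A) (t := A')]
      have h1 := hS α; have h2 := hS β
      have h3 : ∑ k' ∈ A', ∑ k ∈ A, (q k - p k) * W (R r n * (p k' - x k)) ≤ ∑ k' ∈ A', 3 * π / R r n :=
        Finset.sum_le_sum fun k' _ => hS _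
      have h4 : ∑ k' ∈ A', ∑ k ∈ A, (q k - p k) * W (R r n * (q k' - x k)) ≤ ∑ k' ∈ A', 3 * π / R r n :=
        Finset.sum_le_sum fun k' _ => hS _
      have h5 : ∑ k' ∈ A', 6 * π / R r n * 1 = ∑ k' ∈ A', 3 * π / R r n + ∑ k' ∈ A', 3 * π / R r n := by
        rw [← Finset.sum_add_distrib]; refine Finset.sum_congr rfl fun _ _ => by ring
      have h6 : 6 * π / R r n * 1 = 3 * π / R r n + 3 * π / R r n := by ring
      linarith
    calc ∑ k ∈ A, (q k - p k) * E k * (CM * c * R r n) * (π / R r n) = (CM * c * π) * ∑ k ∈ A, (q k - p k) * E k := by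
          rw [Finset.mul_sum]; refine Finset.sum_congr rfl fun k _ => by field_simp
      _ ≤ (CM * c * π) * (6 * π / R r n * (1 + ∑ k ∈ Q with d k < n, (1:ℝ))) := by gcongr
      _ = _ := by ring
  calc ‖∫ u, G u * Ψ u‖ ≤ ∫ u, (m1 u + m2 u + m3 u) := by
        refine norm_integral_le_of_norm_le ((i1.add i2).add i3) (Filter.Eventually.of_forall hpt)
    _ = (∫ u, m1 u) + (∫ u, m2 u) + ∫ u, m3 u := by
        have h1 : ∫ u, (m1 u + m2 u + m3 u) = (∫ u, (m1 u + m2 u)) + ∫ u, m3 u := integral_add (i1.add i2) i3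
        rw [h1, integral_add i1 i2]
    _ ≤ _ := by rw [e1, e2]; linarith
end
end CarlesonProof

end


section
open MeasureTheory
open scoped Real ENNReal

set_option linter.unusedSectionVars false
set_option linter.unusedVariables false
namespace CarlesonProof

/-- tile of level `n` and time index `i` above the frequency of `t` -/
def st (t : Tile) (n : ℕ) (i : ℤ) : Tile := ⟨n, i, dv t.m (n - t.n)⟩
@[simp] lemma st_n (t : Tile) (n : ℕ) (i : ℤ) : (st t n i).n = n := rfl
@[simp] lemma st_i (t : Tile) (n : ℕ) (i : ℤ) : (st t n i).i = i := rfl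
@[simp] lemma st_m (t : Tile) (n : ℕ) (i : ℤ) : (st t n i).m = dv t.m (n - t.n) := rfl

lemma st_self (t : Tile) : st t t.n t.i = t := by
  ext <;> simp
lemma st_le_st (t : Tile) {a b : ℕ} {i j : ℤ} (ha : t.n ≤ a) (hb : a ≤ b) (h : dv i (b - a) = j) :
    Tile.le (st t b i) (st t a j) := by
  refine ⟨hb, h, ?_⟩
  simp only [st_m, st_n, dv_dv]; congr 1; omega
lemma st_le (t : Tile) {b : ℕ} {i : ℤ} (hb : t.n ≤ b) (h : dv i (b - t.n) = t.i) :
    Tile.le (st t b i) t := by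
  have := st_le_st t (_root_.le_refl _) hb h
  rwa [st_self] at this
lemma eq_st_of_le {s t : Tile} (h : Tile.le s t) : s = st t s.n s.i := by
  ext <;> simp [h.2.2]

/-- the spatial cell attached to an index -/
def cl (k : ℕ × ℤ) : Tile := ⟨k.1 + 1, k.2, 0⟩
@[simp] lemma cl_n (k : ℕ × ℤ) : (cl k).n = k.1 + 1 := rfl
@[simp] lemma cl_i (k : ℕ × ℤ) : (cl k).i = k.2 := rfl

open Classical in
/-- cells of a tree -/
noncomputable def cells (S : Finset Tile) (t : Tile) (K : ℕ) : Finset (ℕ × ℤ) :=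
  ((Finset.Icc t.n K).biUnion fun d =>
    (Finset.Ico (t.i * 256 ^ (d + 1 - t.n)) ((t.i + 1) * 256 ^ (d + 1 - t.n))).image fun q => (d, q)).filter
    fun k => st t k.1 (dv k.2 1) ∈ S ∧ st t (k.1 + 1) k.2 ∉ S

lemma mem_cells {S : Finset Tile} {t : Tile} {K : ℕ} {k : ℕ × ℤ} : k ∈ cells S t K ↔
    (t.n ≤ k.1 ∧ k.1 ≤ K) ∧ dv k.2 (k.1 + 1 - t.n) = t.i ∧ st t k.1 (dv k.2 1) ∈ S ∧ st t (k.1 + 1) k.2 ∉ S := by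
  classical
  obtain ⟨d, q⟩ := k
  unfold cells
  simp only [Finset.mem_filter, Finset.mem_biUnion, Finset.mem_image, Finset.mem_Icc, Finset.mem_Ico, dv_iff]
  constructor
  · rintro ⟨⟨d', h1, q', h2, h3⟩, h4⟩
    obtain ⟨rfl, rfl⟩ := Prod.mk.inj h3
    exact ⟨h1, h2, h4⟩
  · rintro ⟨h1, h2, h4⟩
    exact ⟨⟨d, h1, q, h2, rfl⟩, h4⟩

/-- levels at which the tree acts -/
noncomputable def K2 (t : Tile) (K : ℕ) : Finset ℕ :=
  (Finset.Icc (t.n + 1) K).filter fun n => dv t.m (n - 1 - t.n) = 256 * dv t.m (n - t.n)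

lemma mem_K2 {t : Tile} {K n : ℕ} : n ∈ K2 t K ↔ (t.n + 1 ≤ n ∧ n ≤ K) ∧ dv t.m (n - 1 - t.n) = 256 * dv t.m (n - t.n) := by
  simp [K2]

section
variable {r : ℕ} [NeZero r]

/-- base frequency of a tree -/
noncomputable def xi (r : ℕ) (t : Tile) : ℝ := t.m * R r t.n

lemma F_xi (t : Tile) {n : ℕ} (hn : t.n ≤ n) : F r n (xi r t) = dv t.m (n - t.n) := by
  have hR := R_pos r t.n
  have h1 : F r t.n (xi r t) = t.m := by
    rw [F_iff']; unfold xi; constructor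
    · exact _root_.le_refl _
    · nlinarith
  rw [← F_dv r hn, h1]

lemma w2_xi (t : Tile) {K n : ℕ} (hn : n ∈ K2 t K) (i : ℤ) : (st t n i).w2 r (xi r t) := by
  rw [mem_K2] at hn
  refine Tile.w2_of _ (by simp; omega) ?_
  simp only [st_n, st_m]
  rw [F_xi t (by omega), hn.2]

lemma two_st (t : Tile) {K n : ℕ} (hn : n ∈ K2 t K) {i : ℤ} (hi : dv i (n - t.n) = t.i) : Tile.two (st t n i) t := by
  rw [mem_K2] at hn
  exact Or.inr ⟨hn.1.1, hi, hn.2⟩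

lemma dv_X_t {t : Tile} {n : ℕ} (hn : t.n ≤ n) {u : ℝ} (hu : u ∈ Set.Ico (t.lo r) (t.hi r)) :
    dv (X r n u) (n - t.n) = t.i := by
  rw [X_dv r hn]; exact (Tile.mem_I_iff r t u).1 hu

lemma mem_cl {k : ℕ × ℤ} {u : ℝ} : u ∈ Set.Ico ((cl k).lo r) ((cl k).hi r) ↔ X r (k.1 + 1) u = k.2 :=
  Tile.mem_I_iff r (cl k) u

variable (S : Finset Tile) (t : Tile) (K : ℕ) (ht : t ∈ S) (htn : 1 ≤ t.n)
  (hUS : ∀ s ∈ S, ∀ u : Tile, Tile.le s u → 1 ≤ u.n → u ∈ S) (hK : ∀ s ∈ S, s.n ≤ K)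
include ht htn hUS hK

omit ht hK in
lemma cells_par {k : ℕ × ℤ} (hk : k ∈ cells S t K) {n : ℕ} (h1 : t.n ≤ n) (h2 : n ≤ k.1) {u : ℝ}
    (hu : u ∈ Set.Ico ((cl k).lo r) ((cl k).hi r)) : st t n (X r n u) ∈ S := by
  rw [mem_cells] at hk
  rw [mem_cl (r := r) (k := k)] at hu
  refine hUS _ hk.2.2.1 _ (st_le_st t h1 h2 ?_) (by simp; omega)
  rw [dv_dv, ← hu, ← X_dv r (show n ≤ k.1 + 1 by omega)]
  congr 1; omega

omit ht hK in
lemma cells_disj : ((cells S t K : Finset (ℕ × ℤ)) : Set (ℕ × ℤ)).PairwiseDisjoint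
    (fun k => Set.Ico ((cl k).lo r) ((cl k).hi r)) := by
  have key : ∀ k ∈ cells S t K, ∀ k' ∈ cells S t K, ∀ u, u ∈ Set.Ico ((cl k).lo r) ((cl k).hi r) →
      u ∈ Set.Ico ((cl k').lo r) ((cl k').hi r) → ¬ k.1 < k'.1 := by
    intro k hk k' hk' u hu hu' hlt
    have h1 := (mem_cells.1 hk)
    have h2 := cells_par S t K htn hUS hk' (n := k.1 + 1) (by omega) (by omega) hu'
    rw [(mem_cl (r := r) (k := k)).1 hu] at h2
    exact h1.2.2.2 h2
  intro k hk k' hk' hne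
  refine Set.disjoint_left.2 fun u hu hu' => hne ?_
  have h1 := key k hk k' hk' u hu hu'
  have h2 := key k' hk' k hk u hu' hu
  have h3 : k.1 = k'.1 := by omega
  refine Prod.ext h3 ?_
  rw [← (mem_cl (r := r) (k := k)).1 hu, ← (mem_cl (r := r) (k := k')).1 hu', h3]

omit ht hK htn hUS in
lemma cells_sub {k : ℕ × ℤ} (hk : k ∈ cells S t K) : 
    Set.Ico ((cl k).lo r) ((cl k).hi r) ⊆ Set.Ico (t.lo r) (t.hi r) := by
  rw [mem_cells] at hk
  have := Tile.lo_le_of r (s := cl k) (t := t) (by simp; omega) hk.2.1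
  exact Set.Ico_subset_Ico this.1 this.2

omit ht hK in
lemma cells_sum : ∑ k ∈ cells S t K, ((cl k).hi r - (cl k).lo r) ≤ 1 / R r t.n := by
  have h1 : ∑ k ∈ cells S t K, volume (Set.Ico ((cl k).lo r) ((cl k).hi r)) ≤ volume (Set.Ico (t.lo r) (t.hi r)) := by
    rw [← measure_biUnion_finset (cells_disj S t K htn hUS) (fun k _ => measurableSet_Ico)]
    exact measure_mono (Set.iUnion₂_subset fun k hk => cells_sub S t K hk)
  simp_rw [Real.volume_Ico] at h1
  rw [← ENNReal.ofReal_sum_of_nonneg (fun k _ => by linarith [Tile.lo_lt_hi r (cl k)]), Tile.len,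
    ENNReal.ofReal_le_ofReal_iff (by have := R_pos r t.n; positivity)] at h1
  exact h1

lemma cells_cover {n : ℕ} (hn : t.n ≤ n) {u : ℝ} (hu : u ∈ Set.Ico (t.lo r) (t.hi r))
    (h : st t n (X r n u) ∉ S) : ∃ k ∈ cells S t K, k.1 < n ∧ u ∈ Set.Ico ((cl k).lo r) ((cl k).hi r) := by
  classical
  have hex : ∃ j, t.n ≤ j ∧ st t j (X r j u) ∉ S := ⟨n, hn, h⟩
  obtain ⟨h1, h2⟩ := Nat.find_spec hex
  have hle : Nat.find hex ≤ n := Nat.find_min' hex ⟨hn, h⟩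
  set j := Nat.find hex with hj
  have hjt : j ≠ t.n := by
    intro he
    rw [he, (Tile.mem_I_iff r t u).1 hu, st_self] at h2
    exact h2 ht
  have h3 : st t (j - 1) (X r (j - 1) u) ∈ S := by
    by_contra hh
    exact Nat.find_min hex (m := j - 1) (by omega) ⟨by omega, hh⟩
  have e1 : j - 1 + 1 = j := by omega
  refine ⟨(j - 1, X r j u), ?_, by simp; omega, ?_⟩
  · rw [mem_cells]
    simp only [e1]
    refine ⟨⟨by omega, by simpa using hK _ h3⟩, dv_X_t h1 hu, ?_, h2⟩
    have := X_dv r (show j - 1 ≤ j by omega) u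
    rw [show j - (j - 1) = 1 by omega] at this
    rwa [this]
  · rw [mem_cl]; simp only [e1]

/-- constant of the V lemma -/
noncomputable def CV : ℝ := 48 * π ^ 2 * CM ^ 2 + 2048 * CM ^ 2 + 5184 * π ^ 2 * CM ^ 2

open Classical in
lemma V_lemma {f : ℝ → ℂ} (hf : Fok f) {σ : ℝ} (hσ : 0 < σ)
    (hsz : ∑ s ∈ S.filter (fun s => Tile.two s t), co r f s ^ 2 / R r s.n ≤ σ ^ 2 / R r t.n)
    (hco : ∀ s ∈ S, co r f s ≤ σ) (x : ℕ × ℤ → ℝ)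
    (hx : ∀ k ∈ cells S t K, x k ∈ Set.Ico ((cl k).lo r) ((cl k).hi r))
    (b : ℕ × ℤ → ℕ) (hb : ∀ k ∈ cells S t K, b k ≤ k.1) :
    ∑ k ∈ cells S t K, ((cl k).hi r - (cl k).lo r) *
      ‖∑ n ∈ (K2 t K).filter (fun n => b k < n ∧ n ≤ k.1), Ps f psi (R r n) (xi r t) (x k)‖ ≤ CV * σ / R r t.n := by
  have hCM := CM_pos
  set Q := cells S t K with hQ
  set ξ := xi r t with hξ
  set p : ℕ × ℤ → ℝ := fun k => (cl k).lo r with hp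
  set q : ℕ × ℤ → ℝ := fun k => (cl k).hi r with hq
  set d : ℕ × ℤ → ℕ := fun k => k.1 with hd
  set z : ℕ × ℤ → ℂ := fun k => ∑ n ∈ (K2 t K).filter (fun n => b k < n ∧ n ≤ k.1), Ps f psi (R r n) ξ (x k) with hz
  have hRt := R_pos r t.n
  have hlt : ∀ k, p k < q k := fun k => Tile.lo_lt_hi r _
  have hεe : ∀ k, ∃ c : ℂ, ‖c‖ = 1 ∧ (‖z k‖ : ℂ) = c * z k := fun k => by
    obtain ⟨c, h1, h2⟩ := RCLike.exists_norm_eq_mul_self (z k)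
    exact ⟨c, h1, h2⟩
  choose ε hε hεz using hεe
  have hpx : ∀ k ∈ Q, p k ≤ x k := fun k hk => (hx k hk).1
  have hxq : ∀ k ∈ Q, x k < q k := fun k hk => (hx k hk).2
  have hdis : (Q : Set (ℕ × ℤ)).PairwiseDisjoint (fun k => Set.Ico (p k) (q k)) := cells_disj S t K htn hUS
  have hlen : ∀ k, q k - p k = 1 / R r (k.1 + 1) := fun k => Tile.len r (cl k)
  have hdl : ∀ k ∈ Q, q k - p k ≤ 1 / R r (d k) := fun k _ => by
    rw [hlen]; exact one_div_le_one_div_of_le (R_pos r _) (R_mono r (by simp [hd]))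
  have hsumL : ∑ k ∈ Q, (q k - p k) ≤ 1 / R r t.n := cells_sum S t K htn hUS
  set G := Gn Q p q x ε ξ r b d with hG
  set Ψ : ℕ → ℝ → ℂ := fun n => Ps f psit (R r n) ξ with hΨ
  set T : ℕ → Finset Tile := fun n => S.filter (fun s => s.n = n ∧ Tile.two s t) with hT
  -- the main identity
  have hmain : ((∑ k ∈ Q, (q k - p k) * ‖z k‖ : ℝ) : ℂ) = ∑ n ∈ K2 t K, ∫ u, G n u * Ψ n u := by
    have h1 : ∀ n, ∫ u, G n u * Ψ n u = ∑ k ∈ Q, if b k < n ∧ n ≤ k.1 then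
        (((q k - p k : ℝ) : ℂ) * ε k) * Ps f psi (R r n) ξ (x k) else 0 := by
      intro n
      simp only [hG, Gn]
      rw [← Finset.sum_filter]
      simp_rw [Finset.sum_mul]
      rw [integral_finsetSum]
      · refine Finset.sum_congr rfl fun k _ => ?_
        rw [Ps_repr hf (R_pos r n), ← integral_const_mul]
        congr 1; ext u; ring
      · intro k _
        refine Integrable.mul_bdd (c := CM * π) ((psi_mother.pk_integrable (R_pos r n) ξ _).const_mul _) ?_ ?_
        · exact (Ps_cont psit_mother hf (R_pos r n) ξ).aestronglyMeasurable
        · exact Filter.Eventually.of_forall fun u => Ps_bdd psit_mother hf (R_pos r n) ξ u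
    simp_rw [h1]
    rw [Finset.sum_comm]
    push_cast
    refine Finset.sum_congr rfl fun k _ => ?_
    rw [hεz, hz, ← Finset.sum_filter, ← Finset.mul_sum]
    push_cast; ring
  have hlev : ∀ n ∈ K2 t K, ‖∫ u, G n u * Ψ n u‖ ≤ σ / 2 * (∫ u, ‖G n u‖ ^ 2) +
      1 / (2 * σ) * (∑ s ∈ T n, (64 * CM * co r f s) ^ 2 / R r s.n) +
      CM * (216 * CM * σ) * (6 * π ^ 2) * (1 / R r n * (1 + ∑ k ∈ Q with d k < n, (1:ℝ))) := by
    intro n hn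
    have hn' := mem_K2.1 hn
    have hR := R_pos r n
    refine level_est Q p q x hpx hxq hdis ε hε ξ b d n hdl (α := t.lo r) (β := t.hi r)
      (fun k hk => cells_sub S t K hk (hx k hk)) (Ψ n) hσ (by positivity) (T n)
      (fun s hs => (Finset.mem_filter.1 hs).2.1) (fun s => 64 * CM * co r f s) fun u => ?_
    by_cases hu : u ∈ Set.Ico (t.lo r) (t.hi r) ∧ st t n (X r n u) ∈ S
    · left
      obtain ⟨hu, hs⟩ := hu
      have hmem : u ∈ Set.Ico ((st t n (X r n u)).lo r) ((st t n (X r n u)).hi r) := by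
        rw [Tile.mem_I_iff]; simp
      refine ⟨_, Finset.mem_filter.2 ⟨hs, rfl, two_st t hn (dv_X_t (by omega) hu)⟩, hmem, ?_⟩
      exact Ps_le_near psit_mother mt0 mt1 hf _ (w2_xi t hn _) hmem
    · right
      refine ⟨?_, fun k hk hk1 hk2 => ?_⟩
      · by_cases hu1 : u ∈ Set.Ico (t.lo r) (t.hi r)
        · right
          exact cells_cover S t K ht htn hUS hK (by omega) hu1 fun h => hu ⟨hu1, h⟩
        · exact Or.inl hu1
      · set s := st t n (X r n (x k)) with hs
        have hsS : s ∈ S := cells_par S t K htn hUS hk (by omega) hk2 (hx k hk)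
        have hmem : x k ∈ Set.Ico (s.lo r) (s.hi r) := by rw [Tile.mem_I_iff]; simp [hs]
        have h1 := Ps_le psit_mother mt0 mt1 hf s (w2_xi (r := r) t hn (X r n (x k))) u
        refine h1.trans ?_
        have hsn : s.n = n := rfl
        rw [hsn]
        have w1 := W_pos (R r n * (s.lo r - u)); have w2 := W_pos (R r n * (x k - u))
        have h2 : W (R r n * (x k - u)) ≤ 3 * W (R r n * (s.lo r - u)) := by
          have := W_shift (t := R r n * (s.lo r - u)) (h := R r n * (x k - s.lo r)) ?_
          · convert this using 2; ring
          · have h3 := Tile.len r s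
            rw [hsn] at h3
            have h4 : x k - s.lo r ≤ 1 / R r n := by linarith [hmem.2]
            rw [abs_of_nonneg (mul_nonneg hR.le (by linarith [hmem.1]))]
            rwa [le_div_iff₀ hR, mul_comm] at h4
        have h3 : W (R r n * (x k - u)) ^ 3 ≤ 27 * W (R r n * (s.lo r - u)) ^ 3 := by
          calc _ ≤ (3 * W (R r n * (s.lo r - u))) ^ 3 := by gcongr
            _ = _ := by ring
        have h4 : 8 * CM / W (R r n * (s.lo r - u)) ^ 3 ≤ 216 * CM / W (R r n * (x k - u)) ^ 3 := by
          rw [div_le_div_iff₀ (by positivity) (by positivity)]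
          nlinarith
        have h5 := hco s hsS
        have h6 := co_nonneg (r := r) hf s
        calc _ ≤ 216 * CM / W (R r n * (x k - u)) ^ 3 * σ := by gcongr
          _ = _ := by ring
  have hsum1 := Gn_sum Q p q x hpx (fun k hk => (hxq k hk).le) hdis ε hε ξ b d hb hdl (K2 t K)
  have hsum2 : ∑ n ∈ K2 t K, ∑ s ∈ T n, (64 * CM * co r f s) ^ 2 / R r s.n ≤ 4096 * CM ^ 2 * (σ ^ 2 / R r t.n) := by
    have h1 : ∑ n ∈ K2 t K, ∑ s ∈ T n, co r f s ^ 2 / R r s.n ≤ σ ^ 2 / R r t.n := by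
      refine _root_.le_trans ?_ hsz
      rw [← Finset.sum_biUnion]
      · refine Finset.sum_le_sum_of_subset_of_nonneg ?_ fun s _ _ => by have := R_pos r s.n; positivity
        intro s hs
        simp only [Finset.mem_biUnion, hT, Finset.mem_filter] at hs ⊢
        obtain ⟨n, _, h1, h2, h3⟩ := hs
        exact ⟨h1, h3⟩
      · intro n _ n' _ hne
        refine Finset.disjoint_left.2 fun s hs hs' => hne ?_
        rw [← (Finset.mem_filter.1 hs).2.1, ← (Finset.mem_filter.1 hs').2.1]
    calc _ = 4096 * CM ^ 2 * ∑ n ∈ K2 t K, ∑ s ∈ T n, co r f s ^ 2 / R r s.n := by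
          rw [Finset.mul_sum]; refine Finset.sum_congr rfl fun n _ => ?_
          rw [Finset.mul_sum]; refine Finset.sum_congr rfl fun s _ => ?_
          ring
      _ ≤ _ := by gcongr
  have hsum3 : ∑ n ∈ K2 t K, 1 / R r n * (1 + ∑ k ∈ Q with d k < n, (1:ℝ)) ≤ 4 / R r t.n := by
    simp_rw [mul_add, mul_one]
    rw [Finset.sum_add_distrib]
    have h1 := geom_R (r := r) (K2 t K) t.n fun n hn => by rw [mem_K2] at hn; omega
    have h2 : ∑ n ∈ K2 t K, 1 / R r n * ∑ k ∈ Q with d k < n, (1:ℝ) ≤ ∑ k ∈ Q, 2 * (q k - p k) := by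
      simp_rw [Finset.mul_sum, mul_one, Finset.sum_filter]
      rw [Finset.sum_comm]
      refine Finset.sum_le_sum fun k _ => ?_
      rw [← Finset.sum_filter, hlen]
      have := geom_R (r := r) ((K2 t K).filter fun n => d k < n) (k.1 + 1) fun n hn => (Finset.mem_filter.1 hn).2
      calc _ ≤ _ := this
        _ = _ := by ring
    rw [← Finset.mul_sum] at h2
    have : 4 / R r t.n = 2 / R r t.n + 2 * (1 / R r t.n) := by ring
    linarith
  have hfin : ∑ k ∈ Q, (q k - p k) * ‖z k‖ ≤ ∑ n ∈ K2 t K, ‖∫ u, G n u * Ψ n u‖ := by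
    have h0 : 0 ≤ ∑ k ∈ Q, (q k - p k) * ‖z k‖ := Finset.sum_nonneg fun k _ =>
      mul_nonneg (by linarith [hlt k]) (norm_nonneg _)
    rw [← Complex.norm_of_nonneg h0, hmain]
    exact norm_sum_le _ _
  refine hfin.trans ((Finset.sum_le_sum hlev).trans ?_)
  rw [Finset.sum_add_distrib, Finset.sum_add_distrib, ← Finset.mul_sum, ← Finset.mul_sum, ← Finset.mul_sum]
  have a1 : σ / 2 * ∑ n ∈ K2 t K, (∫ u, ‖G n u‖ ^ 2) ≤ σ / 2 * (96 * π ^ 2 * CM ^ 2 * (1 / R r t.n)) := by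
    refine mul_le_mul_of_nonneg_left (hsum1.trans ?_) (by positivity)
    exact mul_le_mul_of_nonneg_left hsumL (by positivity)
  have a2 := mul_le_mul_of_nonneg_left hsum2 (show 0 ≤ 1 / (2 * σ) by positivity)
  have a3 := mul_le_mul_of_nonneg_left hsum3 (show 0 ≤ CM * (216 * CM * σ) * (6 * π ^ 2) by positivity)
  refine (add_le_add (add_le_add a1 a2) a3).trans (le_of_eq ?_)
  unfold CV
  field_simp
  ring
end
end CarlesonProof

end


section
open MeasureTheory
open scoped Real ENNReal

set_option linter.unusedSectionVars false
set_option linter.unusedVariables false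
namespace CarlesonProof

lemma exists_near_max {α : Type*} [Nonempty α] (g : α → ℝ) (B : ℝ) (h0 : ∀ a, 0 ≤ g a) (hB : ∀ a, g a ≤ B) :
    ∃ a, ∀ a', g a' ≤ 2 * g a := by
  by_cases h : ∃ a, 0 < g a
  · obtain ⟨a₀, ha₀⟩ := h
    have hb : BddAbove (Set.range g) := ⟨B, by rintro _ ⟨a, rfl⟩; exact hB a⟩
    have hpos : 0 < ⨆ a, g a := ha₀.trans_le (le_ciSup hb a₀)
    obtain ⟨a, ha⟩ := exists_lt_of_lt_ciSup (show (⨆ a, g a) / 2 < ⨆ a, g a by linarith)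
    exact ⟨a, fun a' => by have := le_ciSup hb a'; linarith⟩
  · push Not at h
    exact ⟨Classical.arbitrary α, fun a' => by have := h a'; have := h0 (Classical.arbitrary α); linarith⟩

/-- the tile over the graph of `θ` at `x` -/
noncomputable def tau (r : ℕ) (θ : ℝ → ℝ) (n : ℕ) (x : ℝ) : Tile := ⟨n, X r n x, F r n (θ x)⟩
@[simp] lemma tau_n (r : ℕ) (θ : ℝ → ℝ) (n : ℕ) (x : ℝ) : (tau r θ n x).n = n := rfl
@[simp] lemma tau_i (r : ℕ) (θ : ℝ → ℝ) (n : ℕ) (x : ℝ) : (tau r θ n x).i = X r n x := rfl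
@[simp] lemma tau_m (r : ℕ) (θ : ℝ → ℝ) (n : ℕ) (x : ℝ) : (tau r θ n x).m = F r n (θ x) := rfl

/-- lowest child condition -/
def ch (r : ℕ) (n : ℕ) (v : ℝ) : Prop := F r (n - 1) v = 256 * F r n v

/-- constant of the tree lemma -/
noncomputable def CT : ℝ := 256 * ((64 + 108 * π) * CM + 2 * CV)

lemma CV_pos : 0 < CV := by have := CM_pos; unfold CV; positivity
lemma CT_pos : 0 < CT := by have := CM_pos; have := CV_pos; unfold CT; positivity

section
variable {r : ℕ} [NeZero r]

open Classical in
lemma tree_lemma (S : Finset Tile) (t : Tile) (K : ℕ) (ht : t ∈ S) (htn : 1 ≤ t.n)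
    (hUS : ∀ s ∈ S, ∀ u : Tile, Tile.le s u → 1 ≤ u.n → u ∈ S) (hK : ∀ s ∈ S, s.n ≤ K)
    {f : ℝ → ℂ} (hf : Fok f) {σ : ℝ} (hσ : 0 < σ)
    (hsz : ∑ s ∈ S.filter (fun s => Tile.two s t), co r f s ^ 2 / R r s.n ≤ σ ^ 2 / R r t.n)
    (hco : ∀ s ∈ S, co r f s ≤ σ) (θ : ℝ → ℝ) (hθ : Measurable θ) {μ : ℝ} (hμ : 0 ≤ μ)
    (hem : ∀ s ∈ S, em r θ s * R r s.n ≤ μ) :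
    ∃ h : ℝ → ℝ≥0∞, Measurable h ∧ ∫⁻ x in Set.Ico (0:ℝ) 1, h x ≤ ENNReal.ofReal (CT * σ * μ / R r t.n) ∧
      ∀ x ∈ Set.Ico (0:ℝ) 1, ‖∑ n ∈ (Finset.Icc 1 K).filter (fun n => ch r n (θ x) ∧ tau r θ n x ∈ S ∧
        Tile.le (tau r θ n x) t), Ps f psi (R r n) (θ x) x‖ₑ ≤ h x := by
  have hCM := CM_pos
  have hRt := R_pos r t.n
  set Q := cells S t K with hQ
  set ξ := xi r t with hξ
  set Z : ℕ × ℤ → ℕ → ℝ → ℂ := fun k b x =>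
    ∑ n ∈ (K2 t K).filter (fun n => b < n ∧ n ≤ k.1), Ps f psi (R r n) ξ x with hZ
  have hex : ∀ k : ℕ × ℤ, ∃ x b, (x ∈ Set.Ico ((cl k).lo r) ((cl k).hi r) ∧ b ≤ k.1) ∧
      ∀ x' b', x' ∈ Set.Ico ((cl k).lo r) ((cl k).hi r) → b' ≤ k.1 → ‖Z k b' x'‖ ≤ 2 * ‖Z k b x‖ := by
    intro k
    have hne : Nonempty (Set.Ico ((cl k).lo r) ((cl k).hi r) × Set.Iic k.1) :=
      ⟨⟨⟨(cl k).lo r, Set.left_mem_Ico.2 (Tile.lo_lt_hi r _)⟩, ⟨k.1, Set.mem_Iic.2 (_root_.le_refl _)⟩⟩⟩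
    obtain ⟨⟨⟨x, hx⟩, ⟨b, hb⟩⟩, h⟩ := exists_near_max
      (fun z : Set.Ico ((cl k).lo r) ((cl k).hi r) × Set.Iic k.1 => ‖Z k z.2 z.1‖)
      (∑ n ∈ K2 t K, CM * π) (fun _ => norm_nonneg _) (fun z => by
        refine (norm_sum_le _ _).trans ?_
        refine _root_.le_trans (Finset.sum_le_sum fun n _ => Ps_bdd psi_mother hf (R_pos r n) ξ _) ?_
        exact Finset.sum_le_sum_of_subset_of_nonneg (Finset.filter_subset _ _) fun _ _ _ => by positivity)
    exact ⟨x, b, ⟨hx, hb⟩, fun x' b' hx' hb' => h (⟨x', hx'⟩, ⟨b', hb'⟩)⟩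
  choose x b hxb hmax using hex
  set v : ℕ × ℤ → ℝ := fun k => (64 + 108 * π) * CM * σ + 2 * ‖Z k (b k) (x k)‖ with hv
  have hv0 : ∀ k, 0 ≤ v k := fun k => by simp only [hv]; positivity
  set Bk : ℕ × ℤ → Set ℝ := fun k => {y | (y ∈ Set.Ico (0:ℝ) 1 ∧ X r (k.1 + 1) y = k.2) ∧
    F r k.1 (θ y) = dv t.m (k.1 - t.n)} with hBk
  have hBm : ∀ k, MeasurableSet (Bk k) := fun k =>
    (measurableSet_Ico.inter ((X_measurable r _) (measurableSet_singleton _))).inter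
      (((F_measurable r _).comp hθ) (measurableSet_singleton _))
  set L : ℕ × ℤ → ℝ := fun k => (cl k).hi r - (cl k).lo r with hL
  have hLk : ∀ k, L k = 1 / R r (k.1 + 1) := fun k => Tile.len r (cl k)
  have hBv : ∀ k ∈ Q, volume (Bk k) ≤ ENNReal.ofReal (256 * μ * L k) := by
    intro k hk
    have hk' := mem_cells.1 hk
    have hsub : Bk k ⊆ Et r θ (st t k.1 (dv k.2 1)) := by
      rintro y ⟨⟨h1, h2⟩, h3⟩
      refine ⟨h1, ?_, h3⟩
      simp only [st_n, st_i]
      rw [← h2, ← X_dv r (show k.1 ≤ k.1 + 1 by omega)]; congr 1; omega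
    refine (measure_mono hsub).trans ?_
    rw [← ENNReal.ofReal_toReal (Et_fin r θ (st t k.1 (dv k.2 1)))]
    refine ENNReal.ofReal_le_ofReal ?_
    have h1 := hem _ hk'.2.2.1
    have hR := R_pos r k.1
    have h2 : em r θ (st t k.1 (dv k.2 1)) ≤ μ / R r k.1 := by rw [le_div_iff₀ hR]; exact h1
    refine h2.trans (le_of_eq ?_)
    rw [hLk, R_succ]; field_simp
  refine ⟨fun y => ∑ k ∈ Q, (Bk k).indicator (fun _ => ENNReal.ofReal (v k)) y, ?_, ?_, ?_⟩
  · exact Finset.measurable_fun_sum _ fun k _ => measurable_const.indicator (hBm k)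
  · rw [lintegral_finsetSum _ fun k _ => measurable_const.indicator (hBm k)]
    have hV := V_lemma S t K ht htn hUS hK hf hσ hsz hco x (fun k _ => (hxb k).1) b (fun k _ => (hxb k).2)
    have hc := cells_sum (r := r) S t K htn hUS
    calc ∑ k ∈ Q, ∫⁻ y in Set.Ico (0:ℝ) 1, (Bk k).indicator (fun _ => ENNReal.ofReal (v k)) y
        ≤ ∑ k ∈ Q, ENNReal.ofReal (v k * (256 * μ * L k)) := by
          refine Finset.sum_le_sum fun k hk => ?_
          rw [lintegral_indicator (hBm k), setLIntegral_const, ENNReal.ofReal_mul (hv0 k)]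
          gcongr
          exact (Measure.restrict_apply_le _ _).trans (hBv k hk)
      _ = ENNReal.ofReal (∑ k ∈ Q, v k * (256 * μ * L k)) := by
          rw [ENNReal.ofReal_sum_of_nonneg]
          intro k _
          have := hv0 k; have := hLk k; have := R_pos r (k.1 + 1)
          have : 0 ≤ L k := by rw [hLk]; positivity
          positivity
      _ ≤ _ := by
          refine ENNReal.ofReal_le_ofReal ?_
          have e1 : ∑ k ∈ Q, v k * (256 * μ * L k) = 256 * μ * ((64 + 108 * π) * CM * σ * ∑ k ∈ Q, L k +
              2 * ∑ k ∈ Q, L k * ‖Z k (b k) (x k)‖) := by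
            rw [Finset.mul_sum, Finset.mul_sum, ← Finset.sum_add_distrib, Finset.mul_sum]
            refine Finset.sum_congr rfl fun k _ => ?_
            simp only [hv]; ring
          rw [e1]
          calc _ ≤ 256 * μ * ((64 + 108 * π) * CM * σ * (1 / R r t.n) + 2 * (CV * σ / R r t.n)) := by
                gcongr
            _ = _ := by unfold CT; ring
  · intro y hy
    set A := (Finset.Icc 1 K).filter (fun n => ch r n (θ y) ∧ tau r θ n y ∈ S ∧ Tile.le (tau r θ n y) t) with hA
    by_cases hne : A = ∅
    · rw [hne]; simp
    obtain ⟨n₀, hn₀⟩ := Finset.nonempty_iff_ne_empty.2 hne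
    obtain ⟨h01, h02, h03, h04⟩ := Finset.mem_filter.1 hn₀
    rw [Finset.mem_Icc] at h01
    have hyt : y ∈ Set.Ico (t.lo r) (t.hi r) := by
      rw [Tile.mem_I_iff, ← X_dv r h04.1]; exact h04.2.1
    have hbex : ∃ n, t.n ≤ n ∧ F r n (θ y) = dv t.m (n - t.n) := ⟨n₀, h04.1, h04.2.2.symm⟩
    obtain ⟨hb1, hb2⟩ := Nat.find_spec hbex
    set β := Nat.find hbex with hβ
    have hF : ∀ n, β ≤ n → F r n (θ y) = dv t.m (n - t.n) := by
      intro n hn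
      rw [← F_dv r hn, hb2, dv_dv]; congr 1; omega
    obtain ⟨k, hkQ, hkK, hyk⟩ := cells_cover (r := r) S t K ht htn hUS hK (n := K + 1) (u := y)
      (by have := hK t ht; omega) hyt (fun h => by have := hK _ h; simp at this)
    have hkQ' := mem_cells.1 hkQ
    have htau : ∀ n, β ≤ n → tau r θ n y = st t n (X r n y) := fun n hn => by
      ext <;> simp [hF n hn]
    have hAiff : ∀ n, n ∈ A ↔ (β ≤ n ∧ n ≤ k.1) ∧ ch r n (θ y) := by
      intro n
      simp only [hA, Finset.mem_filter, Finset.mem_Icc]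
      constructor
      · rintro ⟨h1, h2, h3, h4⟩
        have hn : β ≤ n := Nat.find_min' hbex ⟨h4.1, h4.2.2.symm⟩
        refine ⟨⟨hn, ?_⟩, h2⟩
        by_contra hlt
        apply hkQ'.2.2.2
        rw [htau n hn] at h3
        refine hUS _ h3 _ (st_le_st t (by omega) (show k.1 + 1 ≤ n by omega) ?_) (by simp)
        rw [X_dv r (by omega)]; exact mem_cl.1 hyk
      · rintro ⟨⟨h1, h2⟩, h3⟩
        refine ⟨⟨by omega, by omega⟩, h3, ?_, ?_⟩
        · rw [htau n h1]; exact cells_par S t K htn hUS hkQ (by omega) h2 hyk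
        · rw [htau n h1]; exact st_le t (by omega) (dv_X_t (by omega) hyt)
    have hβk : β ≤ k.1 := by have := ((hAiff n₀).1 hn₀).1; omega
    have hyB : y ∈ Bk k := ⟨⟨hy, mem_cl.1 hyk⟩, hF _ hβk⟩
    have hmemI : ∀ n, y ∈ Set.Ico ((st t n (X r n y)).lo r) ((st t n (X r n y)).hi r) := fun n => by
      rw [Tile.mem_I_iff]; simp
    set A2 := (K2 t K).filter (fun n => β < n ∧ n ≤ k.1) with hA2
    have hAA : A.filter (fun n => β < n) = A2 := by
      ext n
      simp only [Finset.mem_filter, hAiff, hA2, mem_K2]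
      constructor
      · rintro ⟨⟨⟨h1, h2⟩, h3⟩, h4⟩
        refine ⟨⟨⟨by omega, by omega⟩, ?_⟩, h4, h2⟩
        unfold ch at h3
        rwa [hF n h1, hF (n - 1) (by omega), show n - 1 - t.n = n - 1 - t.n from rfl] at h3
      · rintro ⟨⟨⟨h1, h2⟩, h3⟩, h4, h5⟩
        refine ⟨⟨⟨by omega, h5⟩, ?_⟩, h4⟩
        unfold ch
        rw [hF n (by omega), hF (n - 1) (by omega), h3]
    have hAB : A.filter (fun n => ¬ β < n) ⊆ {β} := by
      intro n hn
      rw [Finset.mem_filter, hAiff] at hn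
      rw [Finset.mem_singleton]; omega
    have hw2 : ∀ n ∈ A, (st t n (X r n y)).w2 r (θ y) := by
      intro n hn
      obtain ⟨⟨h1, h2⟩, h3⟩ := (hAiff n).1 hn
      refine Tile.w2_of _ (by simp; omega) ?_
      simp only [st_n, st_m]
      rw [← hF n h1]; exact h3
    have hSn : ∀ n ∈ A, st t n (X r n y) ∈ S := by
      intro n hn
      obtain ⟨⟨h1, h2⟩, h3⟩ := (hAiff n).1 hn
      exact cells_par S t K htn hUS hkQ (by omega) h2 hyk
    have hdist : |θ y - ξ| ≤ R r β := by
      have h1 := (F_iff' r β _ _).1 hb2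
      have h2 := (F_iff' r β _ _).1 (F_xi (r := r) t hb1)
      rw [abs_le]; constructor <;> linarith [h1.1, h1.2, h2.1, h2.2]
    have hRβ := R_pos r β
    have hreal : ‖∑ n ∈ A, Ps f psi (R r n) (θ y) y‖ ≤ v k := by
      rw [← Finset.sum_filter_add_sum_filter_not A (fun n => β < n), hAA]
      have p1 : ‖∑ n ∈ A.filter (fun n => ¬ β < n), Ps f psi (R r n) (θ y) y‖ ≤ 64 * CM * σ := by
        refine (norm_sum_le _ _).trans ?_
        have h1 : ∀ n ∈ A.filter (fun n => ¬ β < n), ‖Ps f psi (R r n) (θ y) y‖ ≤ 64 * CM * σ := by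
          intro n hn
          have hn' := (Finset.mem_filter.1 hn).1
          refine (Ps_le_near psi_mother mm0 mm1 hf (st t n (X r n y)) (hw2 n hn') (hmemI n)).trans ?_
          have := hco _ (hSn n hn')
          gcongr
        refine (Finset.sum_le_card_nsmul _ _ _ h1).trans ?_
        have hc : (A.filter (fun n => ¬ β < n)).card ≤ 1 := by
          simpa using Finset.card_le_card hAB
        have : ((A.filter (fun n => ¬ β < n)).card : ℝ) ≤ 1 := by exact_mod_cast hc
        rw [nsmul_eq_mul]
        have : 0 ≤ 64 * CM * σ := by positivity
        nlinarith
      have p2 : ‖∑ n ∈ A2, (Ps f psi (R r n) (θ y) y - Ps f psi (R r n) ξ y)‖ ≤ 108 * π * CM * σ := by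
        refine (norm_sum_le _ _).trans ?_
        have h1 : ∀ n ∈ A2, ‖Ps f psi (R r n) (θ y) y - Ps f psi (R r n) ξ y‖ ≤ 54 * π * CM * σ * R r β * (1 / R r n) := by
          intro n hn
          have hnA : n ∈ A := by rw [← hAA] at hn; exact (Finset.mem_filter.1 hn).1
          have hn2 : n ∈ K2 t K := (Finset.mem_filter.1 hn).1
          refine (Ps_sub_le psi_mother mm0 mm1 hf (st t n (X r n y)) (hw2 n hnA) (w2_xi t hn2 _) (hmemI n)).trans ?_
          have h2 := hco _ (hSn n hnA)
          have h3 := co_nonneg (r := r) hf (st t n (X r n y))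
          have h4 := R_pos r n
          simp only [st_n]
          calc _ ≤ 54 * π * CM * (R r β / R r n) * σ := by gcongr
            _ = _ := by ring
        refine (Finset.sum_le_sum h1).trans ?_
        rw [← Finset.mul_sum]
        have h2 := geom_R (r := r) A2 β fun n hn => (Finset.mem_filter.1 hn).2.1.le
        calc _ ≤ 54 * π * CM * σ * R r β * (2 / R r β) := by gcongr
          _ = _ := by field_simp; ring
      have p3 : ‖∑ n ∈ A2, Ps f psi (R r n) ξ y‖ ≤ 2 * ‖Z k (b k) (x k)‖ := hmax k y β hyk hβk
      have p4 : ∑ n ∈ A2, Ps f psi (R r n) (θ y) y = ∑ n ∈ A2, (Ps f psi (R r n) (θ y) y - Ps f psi (R r n) ξ y) +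
          ∑ n ∈ A2, Ps f psi (R r n) ξ y := by rw [← Finset.sum_add_distrib]; simp
      rw [p4]
      refine (norm_add₃_le).trans ?_
      simp only [hv]
      linarith
    rw [← ofReal_norm]
    refine (ENNReal.ofReal_le_ofReal hreal).trans ?_
    have := Finset.single_le_sum (f := fun k => (Bk k).indicator (fun _ => ENNReal.ofReal (v k)) y)
      (fun _ _ => zero_le) hkQ
    simpa [hyB] using this
end
end CarlesonProof

end


section
open MeasureTheory
open scoped Real ENNReal

set_option linter.unusedSectionVars false
set_option linter.unusedVariables false
namespace CarlesonProof

section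
variable {r : ℕ} [NeZero r]

open Classical in
/-- the model operator restricted to a set of tiles -/
noncomputable def TS (r : ℕ) (f : ℝ → ℂ) (θ : ℝ → ℝ) (K : ℕ) (S : Finset Tile) (x : ℝ) : ℂ :=
  ∑ n ∈ (Finset.Icc 1 K).filter (fun n => ch r n (θ x) ∧ tau r θ n x ∈ S), Ps f psi (R r n) (θ x) x

open Classical in
/-- state of the iteration -/
structure Good (r : ℕ) (P S : Finset Tile) (f : ℝ → ℂ) (θ : ℝ → ℝ) (σ μ : ℝ) : Prop where
  sub : S ⊆ P
  up : ∀ s ∈ S, ∀ u : Tile, Tile.le s u → 1 ≤ u.n → u ∈ S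
  sz : ∀ t ∈ P, ∑ s ∈ S.filter (fun s => Tile.two s t), co r f s ^ 2 / R r s.n ≤ σ ^ 2 / R r t.n
  mass : ∀ s ∈ S, em r θ s * R r s.n ≤ μ

lemma Good.co_le {P S : Finset Tile} {f : ℝ → ℂ} {θ : ℝ → ℝ} {σ μ : ℝ} (hσ : 0 < σ) (hG : Good r P S f θ σ μ) 
    {s : Tile} (hs : s ∈ S) : co r f s ≤ σ := by
  classical
  have h1 := hG.sz s (hG.sub hs)
  have hR := R_pos r s.n
  have h2 : co r f s ^ 2 / R r s.n ≤ σ ^ 2 / R r s.n := by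
    refine _root_.le_trans ?_ h1
    exact Finset.single_le_sum (f := fun s => co r f s ^ 2 / R r s.n)
      (fun s _ => by have := R_pos r s.n; positivity) (Finset.mem_filter.2 ⟨hs, Or.inl rfl⟩)
  rw [div_le_div_iff_of_pos_right hR] at h2
  exact le_of_sq_le_sq h2 hσ.le
where
  le_of_sq_le_sq {a b : ℝ} (h : a ^ 2 ≤ b ^ 2) (hb : 0 ≤ b) : a ≤ b := abs_le_of_sq_le_sq' h hb |>.2

open Classical in
lemma forest {P : Finset Tile} {K : ℕ} (hP : ∀ s ∈ P, 1 ≤ s.n ∧ s.n ≤ K) {f : ℝ → ℂ} (hf : Fok f)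
    {θ : ℝ → ℝ} (hθ : Measurable θ) {σ μ : ℝ} (hσ : 0 < σ) (hμ : 0 ≤ μ) {S : Finset Tile}
    (hG : Good r P S f θ σ μ) (D : Finset Tile) (hD : D ⊆ P) :
    Good r P (S.filter (fun s => ∀ u ∈ D, ¬ Tile.le s u)) f θ σ μ ∧
    ∃ h : ℝ → ℝ≥0∞, Measurable h ∧
      ∫⁻ x in Set.Ico (0:ℝ) 1, h x ≤ ENNReal.ofReal (CT * σ * μ * ∑ t ∈ D, 1 / R r t.n) ∧
      ∀ x ∈ Set.Ico (0:ℝ) 1, ‖TS r f θ K S x - TS r f θ K (S.filter (fun s => ∀ u ∈ D, ¬ Tile.le s u)) x‖ₑ ≤ h x := by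
  have hCT := CT_pos
  induction D using Finset.induction_on with
  | empty => 
    have : S.filter (fun s => ∀ u ∈ (∅ : Finset Tile), ¬ Tile.le s u) = S := by simp
    rw [this]
    exact ⟨hG, fun _ => 0, measurable_const, by simp, by simp⟩
  | insert t D htD ih =>
    obtain ⟨hG1, h1, m1, i1, b1⟩ := ih ((Finset.subset_insert _ _).trans hD)
    have htP : t ∈ P := hD (Finset.mem_insert_self _ _)
    set S1 := S.filter (fun s => ∀ u ∈ D, ¬ Tile.le s u) with hS1
    set S2 := S.filter (fun s => ∀ u ∈ insert t D, ¬ Tile.le s u) with hS2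
    have hmem2 : ∀ s, s ∈ S2 ↔ s ∈ S1 ∧ ¬ Tile.le s t := by
      intro s
      simp only [hS1, hS2, Finset.mem_filter, Finset.mem_insert, forall_eq_or_imp]
      tauto
    have hG2 : Good r P S2 f θ σ μ := by
      refine ⟨fun s hs => hG1.sub ((hmem2 s).1 hs).1, fun s hs u hu hn => ?_, fun t' ht' => ?_,
        fun s hs => hG1.mass s ((hmem2 s).1 hs).1⟩
      · rw [hmem2] at hs ⊢
        exact ⟨hG1.up s hs.1 u hu hn, fun h => hs.2 (Tile.le_trans hu h)⟩
      · refine _root_.le_trans ?_ (hG1.sz t' ht')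
        refine Finset.sum_le_sum_of_subset_of_nonneg ?_ fun s _ _ => by have := R_pos r s.n; positivity
        intro s hs
        rw [Finset.mem_filter] at hs ⊢
        exact ⟨((hmem2 s).1 hs.1).1, hs.2⟩
    refine ⟨hG2, ?_⟩
    by_cases ht : t ∈ S1
    · obtain ⟨h2, m2, i2, b2⟩ := tree_lemma (r := r) S1 t K ht (hP t htP).1 hG1.up (fun s hs => (hP s (hG1.sub hs)).2) hf hσ
        (hG1.sz t htP) (fun s hs => hG1.co_le hσ hs) θ hθ hμ hG1.mass
      refine ⟨fun x => h1 x + h2 x, m1.add m2, ?_, fun x hx => ?_⟩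
      · rw [lintegral_add_left m1, Finset.sum_insert htD, mul_add, ENNReal.ofReal_add]
        · rw [add_comm]
          refine add_le_add (i2.trans (le_of_eq ?_)) i1
          congr 1; ring
        · have := R_pos r t.n; positivity
        · have : 0 ≤ ∑ t ∈ D, 1 / R r t.n := Finset.sum_nonneg fun s _ => by have := R_pos r s.n; positivity
          positivity
      · have e1 : TS r f θ K S x - TS r f θ K S2 x = (TS r f θ K S x - TS r f θ K S1 x) + 
            (TS r f θ K S1 x - TS r f θ K S2 x) := by ring
        rw [e1]
        refine (enorm_add_le _ _).trans (add_le_add (b1 x hx) ?_)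
        refine _root_.le_trans (le_of_eq (congrArg _ ?_)) (b2 x hx)
        unfold TS
        rw [sub_eq_iff_eq_add, ← Finset.sum_filter_add_sum_filter_not 
          ((Finset.Icc 1 K).filter fun n => ch r n (θ x) ∧ tau r θ n x ∈ S1) (fun n => Tile.le (tau r θ n x) t)]
        congr 1
        · refine Finset.sum_congr ?_ fun _ _ => rfl
          ext n; simp only [Finset.mem_filter]; tauto
        · refine Finset.sum_congr ?_ fun _ _ => rfl
          ext n; simp only [Finset.mem_filter, hmem2]; tauto
    · have : S2 = S1 := by
        ext s; rw [hmem2]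
        exact ⟨fun h => h.1, fun h => ⟨h, fun hle => ht (hG1.up s h t hle (hP t htP).1)⟩⟩
      rw [this]
      refine ⟨h1, m1, i1.trans (ENNReal.ofReal_le_ofReal ?_), b1⟩
      rw [Finset.sum_insert htD]
      have := R_pos r t.n
      have : 0 ≤ 1 / R r t.n := by positivity
      gcongr; linarith

lemma A0_pos : 0 < A0 := by unfold A0; positivity
lemma C2_pos : 0 < C2 := by unfold C2; positivity
/-- initial size -/
noncomputable def A1 : ℝ := Real.sqrt A0
lemma A1_pos : 0 < A1 := Real.sqrt_pos.2 A0_pos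
/-- iteration constant -/
noncomputable def CI : ℝ := 8 * CT * (12 * C2 / A1 + A1)
lemma CI_pos : 0 < CI := by
  have := CT_pos; have := C2_pos; have := A1_pos; unfold CI; positivity

open Classical in
lemma iter_step {P : Finset Tile} {K : ℕ} (hP : ∀ s ∈ P, 1 ≤ s.n ∧ s.n ≤ K) {f : ℝ → ℂ} (hf : Fok f)
    {θ : ℝ → ℝ} (hθ : Measurable θ) {σ μ : ℝ} (hσ : 0 < σ) (hμ : 0 < μ) {S : Finset Tile}
    (hG : Good r P S f θ (2 * σ) (4 * μ)) :
    ∃ S', Good r P S' f θ σ μ ∧ ∃ h : ℝ → ℝ≥0∞, Measurable h ∧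
      ∫⁻ x in Set.Ico (0:ℝ) 1, h x ≤ ENNReal.ofReal (CT * (2 * σ) * (4 * μ) * (12 * C2 / σ ^ 2 + 1 / μ)) ∧
      ∀ x ∈ Set.Ico (0:ℝ) 1, ‖TS r f θ K S x - TS r f θ K S' x‖ₑ ≤ h x := by
  have hCT := CT_pos
  obtain ⟨D, hDP, hDs, hD⟩ := size_lemma (r := r) hf P S hG.sub hσ hG.sz
  obtain ⟨M, hMS, hMs, hM⟩ := mass_lemma r θ hθ S hμ
  obtain ⟨hG', h, m, i, bd⟩ := forest (r := r) hP hf hθ (by positivity) (by positivity) hG (D ∪ M)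
    (Finset.union_subset hDP (hMS.trans hG.sub))
  refine ⟨_, ⟨hG'.sub, hG'.up, fun t ht => ?_, fun s hs => ?_⟩, h, m, i.trans (ENNReal.ofReal_le_ofReal ?_), bd⟩
  · refine _root_.le_trans ?_ (hD t ht)
    refine Finset.sum_le_sum_of_subset_of_nonneg ?_ fun s _ _ => by have := R_pos r s.n; positivity
    intro s hs
    rw [Finset.mem_filter, Finset.mem_filter] at hs
    rw [Finset.mem_filter]
    exact ⟨hs.1.1, hs.2, fun u hu => hs.1.2 u (Finset.mem_union_left _ hu)⟩
  · rw [Finset.mem_filter] at hs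
    exact hM s hs.1 fun u hu => hs.2 u (Finset.mem_union_right _ hu)
  · have h1 : ∑ t ∈ D ∪ M, 1 / R r t.n ≤ 12 * C2 / σ ^ 2 + 1 / μ := by
      refine _root_.le_trans ?_ (add_le_add hDs hMs)
      rw [← Finset.sum_union_inter]
      have : 0 ≤ ∑ t ∈ D ∩ M, 1 / R r t.n := Finset.sum_nonneg fun s _ => by have := R_pos r s.n; positivity
      linarith
    gcongr

lemma iter {P : Finset Tile} {K : ℕ} (hP : ∀ s ∈ P, 1 ≤ s.n ∧ s.n ≤ K) {f : ℝ → ℂ} (hf : Fok f)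
    {θ : ℝ → ℝ} (hθ : Measurable θ) (hG : Good r P P f θ A1 1) (J : ℕ) :
    ∃ S, Good r P S f θ (A1 * (1 / 2) ^ J) ((1 / 4) ^ J) ∧ ∃ h : ℝ → ℝ≥0∞, Measurable h ∧
      ∫⁻ x in Set.Ico (0:ℝ) 1, h x ≤ ENNReal.ofReal (CI * (1 - (1 / 2) ^ J)) ∧
      ∀ x ∈ Set.Ico (0:ℝ) 1, ‖TS r f θ K P x - TS r f θ K S x‖ₑ ≤ h x := by
  have hA := A1_pos
  have hCI := CI_pos
  induction J with
  | zero => exact ⟨P, by simpa using hG, fun _ => 0, measurable_const, by simp, by simp⟩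
  | succ J ih =>
    obtain ⟨S, hS, h1, m1, i1, b1⟩ := ih
    obtain ⟨S', hS', h2, m2, i2, b2⟩ := iter_step (r := r) (σ := A1 * (1 / 2) ^ (J + 1)) (μ := (1 / 4) ^ (J + 1)) hP hf hθ
      (by positivity) (by positivity) (S := S) (by convert hS using 1 <;> ring)
    refine ⟨S', hS', fun x => h1 x + h2 x, m1.add m2, ?_, fun x hx => ?_⟩
    · rw [lintegral_add_left m1]
      refine (add_le_add i1 i2).trans ?_
      have h3 : (1 / 2 : ℝ) ^ J ≤ 1 := pow_le_one₀ (by norm_num) (by norm_num)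
      have hCT := CT_pos; have hC2 := C2_pos
      rw [← ENNReal.ofReal_add (mul_nonneg hCI.le (by linarith)) (by positivity)]
      refine ENNReal.ofReal_le_ofReal (le_of_eq ?_)
      have e4 : (1 / 4 : ℝ) ^ (J + 1) = ((1 / 2) ^ (J + 1)) ^ 2 := by rw [← pow_mul, mul_comm, pow_mul]; norm_num
      have e5 : (1 / 2 : ℝ) ^ J = 2 * (1 / 2) ^ (J + 1) := by ring
      rw [e4, e5]
      set y : ℝ := (1 / 2) ^ (J + 1) with hy
      have hy0 : 0 < y := by positivity
      unfold CI
      field_simp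
      ring
    · have e1 : TS r f θ K P x - TS r f θ K S' x = (TS r f θ K P x - TS r f θ K S x) + 
            (TS r f θ K S x - TS r f θ K S' x) := by ring
      rw [e1]
      exact (enorm_add_le _ _).trans (add_le_add (b1 x hx) (b2 x hx))

lemma TS_small {P S : Finset Tile} {K : ℕ} {f : ℝ → ℂ} (hf : Fok f) {θ : ℝ → ℝ} {σ μ : ℝ} (hσ : 0 < σ) 
    (hG : Good r P S f θ σ μ) (x : ℝ) : ‖TS r f θ K S x‖ ≤ K * (64 * CM * σ) := by
  classical
  have hCM := CM_pos
  unfold TS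
  refine (norm_sum_le _ _).trans ?_
  have h1 : ∀ n ∈ (Finset.Icc 1 K).filter (fun n => ch r n (θ x) ∧ tau r θ n x ∈ S), 
      ‖Ps f psi (R r n) (θ x) x‖ ≤ 64 * CM * σ := by
    intro n hn
    obtain ⟨h1, h2, h3⟩ := Finset.mem_filter.1 hn
    have hw : (tau r θ n x).w2 r (θ x) := Tile.w2_of _ (Finset.mem_Icc.1 h1).1 h2
    refine (Ps_le_near psi_mother mm0 mm1 hf (tau r θ n x) hw (by rw [Tile.mem_I_iff]; simp)).trans ?_
    have := hG.co_le hσ h3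
    gcongr
  refine (Finset.sum_le_card_nsmul _ _ _ h1).trans ?_
  rw [nsmul_eq_mul]
  have : ((Finset.Icc 1 K).filter (fun n => ch r n (θ x) ∧ tau r θ n x ∈ S)).card ≤ K := by
    refine (Finset.card_filter_le _ _).trans (by simp)
  gcongr

/-- the full collection of tiles -/
lemma exists_P (r : ℕ) [NeZero r] (K : ℕ) (H : ℝ) : ∃ P : Finset Tile, (∀ s ∈ P, 1 ≤ s.n ∧ s.n ≤ K) ∧
    (∀ s ∈ P, ∀ u : Tile, Tile.le s u → 1 ≤ u.n → u ∈ P) ∧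
    (∀ n ∈ Finset.Icc 1 K, ∀ x ∈ Set.Ico (0:ℝ) 1, ∀ v : ℝ, |v| ≤ H → (⟨n, X r n x, F r n v⟩ : Tile) ∈ P) := by
  set H' := H + R r K with hH'
  set A : Set Tile := {s | (1 ≤ s.n ∧ s.n ≤ K) ∧ (0 ≤ s.i ∧ (s.i + 1 : ℝ) ≤ R r s.n) ∧
    (-H' ≤ s.m * R r s.n ∧ (s.m + 1) * R r s.n ≤ H')} with hA
  have hfin : A.Finite := by
    refine Set.Finite.subset (((Set.finite_Icc 1 K).prod ((Set.finite_Icc (0:ℤ) ⌈R r K⌉).prod 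
      (Set.finite_Icc (-⌈|H'|⌉) ⌈|H'|⌉))).image (fun z => (⟨z.1, z.2.1, z.2.2⟩ : Tile))) ?_
    rintro s ⟨h1, ⟨h2, h3⟩, h4, h5⟩
    have hR1 : 1 ≤ R r s.n := by
      unfold R
      have h1 : (1:ℝ) ≤ r := by exact_mod_cast Nat.pos_of_ne_zero (NeZero.ne r)
      have h2 : (1:ℝ) ≤ 256 ^ s.n := one_le_pow₀ (by norm_num)
      nlinarith
    have hRK := R_mono r h1.2
    refine ⟨(s.n, s.i, s.m), ⟨h1, ⟨h2, ?_⟩, ?_, ?_⟩, rfl⟩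
    · exact (Int.cast_le (R := ℝ)).1 (by have := Int.le_ceil (R r K); push_cast; linarith)
    · have h6 : -|H'| ≤ s.m := by
        by_cases h : (0:ℝ) ≤ s.m
        · linarith [abs_nonneg H']
        · push Not at h
          have := le_abs_self H'
          nlinarith
      have := Int.le_ceil |H'|
      exact (Int.cast_le (R := ℝ)).1 (by push_cast; linarith)
    · have h6 : s.m ≤ |H'| := by
        by_cases h : (s.m:ℝ) ≤ 0
        · linarith [abs_nonneg H']
        · push Not at h
          have := le_abs_self H'
          nlinarith
      have := Int.le_ceil |H'|
      exact (Int.cast_le (R := ℝ)).1 (by push_cast; linarith)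
  refine ⟨hfin.toFinset, fun s hs => ?_, fun s hs u hu hn => ?_, fun n hn x hx v hv => ?_⟩
  · exact ((Set.Finite.mem_toFinset _).1 hs).1
  · rw [Set.Finite.mem_toFinset] at hs ⊢
    obtain ⟨h1, ⟨h2, h3⟩, h4, h5⟩ := hs
    obtain ⟨a, c, d⟩ := hu
    have hR := R_pos r u.n
    rw [dv_iff] at c d
    have c1 : (u.i:ℝ) * 256 ^ (s.n - u.n) ≤ s.i := by exact_mod_cast c.1
    have c2 : (s.i:ℝ) + 1 ≤ (u.i + 1) * 256 ^ (s.n - u.n) := by exact_mod_cast c.2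
    have d1 : (s.m:ℝ) * 256 ^ (s.n - u.n) ≤ u.m := by exact_mod_cast d.1
    have d2 : (u.m:ℝ) + 1 ≤ (s.m + 1) * 256 ^ (s.n - u.n) := by exact_mod_cast d.2
    have hRs := R_sub r a
    have hp : (0:ℝ) < 256 ^ (s.n - u.n) := by positivity
    refine ⟨⟨hn, by omega⟩, ⟨?_, ?_⟩, ?_, ?_⟩
    · by_contra h
      have : u.i + 1 ≤ 0 := by omega
      have : (u.i + 1 : ℝ) ≤ 0 := by exact_mod_cast this
      have h2' : (0:ℝ) ≤ s.i := by exact_mod_cast h2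
      nlinarith
    · have h3' : (s.i : ℝ) < R r u.n * 256 ^ (s.n - u.n) := by rw [← hRs]; linarith
      have h6 : (u.i : ℝ) < R r u.n := by
        by_contra h
        push Not at h
        have : R r u.n * 256 ^ (s.n - u.n) ≤ u.i * 256 ^ (s.n - u.n) := by gcongr
        linarith
      have e : R r u.n = ((r * 256 ^ u.n : ℕ) : ℤ) := by unfold R; push_cast; ring
      rw [e] at h6 ⊢
      have h7 : u.i < ((r * 256 ^ u.n : ℕ) : ℤ) := by exact_mod_cast h6
      exact_mod_cast h7
    · rw [hRs] at h4
      have : (s.m:ℝ) * 256 ^ (s.n - u.n) * R r u.n ≤ u.m * R r u.n := by gcongr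
      linarith
    · rw [hRs] at h5
      have : ((u.m:ℝ) + 1) * R r u.n ≤ (s.m + 1) * 256 ^ (s.n - u.n) * R r u.n := by gcongr
      linarith
  · rw [Set.Finite.mem_toFinset]
    rw [Finset.mem_Icc] at hn
    have hR := R_pos r n
    have hRK := R_mono r hn.2
    obtain ⟨x1, x2⟩ := (X_iff r n x _).1 rfl
    obtain ⟨v1, v2⟩ := (F_iff' r n v _).1 rfl
    obtain ⟨v3, v4⟩ := abs_le.1 hv
    refine ⟨hn, ⟨?_, ?_⟩, ?_, ?_⟩
    · exact Int.floor_nonneg.2 (mul_nonneg hR.le hx.1)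
    · have h6 : (X r n x : ℝ) < R r n := by
        have := hx.2
        nlinarith
      have e : R r n = ((r * 256 ^ n : ℕ) : ℤ) := by unfold R; push_cast; ring
      simp only
      rw [e] at h6 ⊢
      have h7 : X r n x < ((r * 256 ^ n : ℕ) : ℤ) := by exact_mod_cast h6
      exact_mod_cast h7
    · simp only; linarith
    · simp only; linarith

/-- main constant -/
noncomputable def CX : ℝ := CI + 1

open Classical in
theorem main_est {f : ℝ → ℂ} (hf : Fok f) {θ : ℝ → ℝ} (hθ : Measurable θ) {H : ℝ} (hH : ∀ x, |θ x| ≤ H) (K : ℕ) :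
    ∃ h : ℝ → ℝ≥0∞, Measurable h ∧ ∫⁻ x in Set.Ico (0:ℝ) 1, h x ≤ ENNReal.ofReal CX ∧
      ∀ x ∈ Set.Ico (0:ℝ) 1, ‖∑ n ∈ (Finset.Icc 1 K).filter (fun n => ch r n (θ x)), Ps f psi (R r n) (θ x) x‖ₑ ≤ h x := by
  obtain ⟨P, hP1, hP2, hP3⟩ := exists_P r K H
  have hCM := CM_pos
  have hA1 := A1_pos
  have hG : Good r P P f θ A1 1 := by
    refine ⟨fun _ h => h, hP2, fun t _ => ?_, fun s _ => ?_⟩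
    · have := initial_size (r := r) hf (P.filter (fun s => Tile.two s t)) t fun s hs => (Finset.mem_filter.1 hs).2
      rwa [A1, Real.sq_sqrt A0_pos.le]
    · have hR := R_pos r s.n
      rw [← le_div_iff₀ hR, em, ← Tile.len r s]
      refine ENNReal.toReal_le_of_le_ofReal (by linarith [Tile.lo_lt_hi r s]) ?_
      rw [← Real.volume_Ico]
      exact measure_mono fun x hx => (Tile.mem_I_iff r s x).2 hx.2.1
  obtain ⟨J, hJ⟩ := exists_pow_lt_of_lt_one (show 0 < 1 / (K * (64 * CM * A1) + 1) by positivity) (show (1/2:ℝ) < 1 by norm_num)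
  obtain ⟨S, hS, h, m, i, bd⟩ := iter (r := r) hP1 hf hθ hG J
  refine ⟨fun x => h x + 1, m.add_const _, ?_, fun x hx => ?_⟩
  · rw [lintegral_add_right _ measurable_const]
    simp only [lintegral_const, Measure.restrict_apply MeasurableSet.univ, Set.univ_inter, Real.volume_Ico, one_mul]
    rw [CX, ENNReal.ofReal_add CI_pos.le one_pos.le]
    refine add_le_add (i.trans (ENNReal.ofReal_le_ofReal ?_)) (by simp)
    have : (0:ℝ) ≤ (1 / 2) ^ J := by positivity
    nlinarith [CI_pos]
  · have e1 : ∑ n ∈ (Finset.Icc 1 K).filter (fun n => ch r n (θ x)), Ps f psi (R r n) (θ x) x = TS r f θ K P x := by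
      unfold TS
      refine Finset.sum_congr ?_ fun _ _ => rfl
      ext n
      simp only [Finset.mem_filter]
      constructor
      · rintro ⟨h1, h2⟩; exact ⟨h1, h2, hP3 n h1 x hx _ (hH x)⟩
      · rintro ⟨h1, h2, _⟩; exact ⟨h1, h2⟩
    have e2 : TS r f θ K P x = (TS r f θ K P x - TS r f θ K S x) + TS r f θ K S x := by ring
    rw [e1, e2]
    refine (enorm_add_le _ _).trans (add_le_add (bd x hx) ?_)
    rw [← ofReal_norm]
    have h1 := TS_small (K := K) hf (show 0 < A1 * (1 / 2) ^ J by positivity) hS x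
    refine ENNReal.ofReal_le_one.2 (h1.trans ?_)
    rw [lt_div_iff₀ (by positivity)] at hJ
    have : (0:ℝ) ≤ (1 / 2) ^ J := by positivity
    calc _ = (1 / 2) ^ J * (K * (64 * CM * A1)) := by ring
      _ ≤ _ := by linarith
end
end CarlesonProof

end


section
open MeasureTheory
open scoped Real ENNReal
set_option linter.unusedSectionVars false
set_option linter.unusedVariables false
namespace CarlesonProof

lemma avg_shift (φ : ℤ → ℕ) (M : ℕ) (hφ : ∀ w, φ (w - M) = φ w) (a : ℤ) :
    ∑ u ∈ Finset.range M, φ (a - u) = ∑ u ∈ Finset.range M, φ u := by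
  have step : ∀ a : ℤ, ∑ u ∈ Finset.range M, φ (a + 1 - u) = ∑ u ∈ Finset.range M, φ (a - u) := by
    intro a
    have h1 := Finset.sum_range_succ (fun u : ℕ => φ (a + 1 - u)) M
    have h2 := Finset.sum_range_succ' (fun u : ℕ => φ (a + 1 - u)) M
    rw [h1, hφ] at h2
    simp only [Nat.cast_zero, sub_zero, Nat.cast_add, Nat.cast_one] at h2
    have h3 : ∀ u : ℕ, a + 1 - ((u:ℤ) + 1) = a - u := fun u => by ring
    simp only [h3] at h2
    omega
  have const : ∀ a : ℤ, ∑ u ∈ Finset.range M, φ (a - u) = ∑ u ∈ Finset.range M, φ (((M:ℤ) - 1) - u) := by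
    intro a
    refine Int.inductionOn' a ((M:ℤ) - 1) rfl (fun k _ ih => ?_) (fun k _ ih => ?_)
    · rw [step, ih]
    · rw [← ih, ← step (k - 1), sub_add_cancel]
  rw [const, ← Finset.sum_range_reflect]
  refine Finset.sum_congr rfl fun u hu => ?_
  rw [Finset.mem_range] at hu
  congr 1
  omega

lemma avg_count (b q : ℕ) (hb : 0 < b) (a : ℤ) :
    ∑ u ∈ Finset.range (q * (256 * b)), (if (a - u) / (b:ℤ) = 256 * ((a - u) / (256 * b : ℤ)) then 1 else 0) = q * b := by
  have hb' : (b:ℤ) ≠ 0 := by positivity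
  have hb2 : (256 * b:ℤ) ≠ 0 := by positivity
  have sh : ∀ w k : ℤ, ((w + k * (256 * b)) / (b:ℤ) = 256 * ((w + k * (256 * b)) / (256 * b : ℤ))) ↔ 
      (w / (b:ℤ) = 256 * (w / (256 * b : ℤ))) := by
    intro w k
    rw [Int.add_mul_ediv_right _ _ hb2, show w + k * (256 * (b:ℤ)) = w + (k * 256) * b by ring,
      Int.add_mul_ediv_right _ _ hb']
    constructor <;> intro h <;> linarith
  rw [avg_shift (fun w => if w / (b:ℤ) = 256 * (w / (256 * b : ℤ)) then 1 else 0)]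
  · induction q with
    | zero => simp
    | succ q ih =>
      rw [add_mul, one_mul, Finset.sum_range_add, ih, add_mul, one_mul]
      congr 1
      have : ∀ u ∈ Finset.range (256 * b), (if (((q * (256 * b) + u : ℕ) : ℤ)) / (b:ℤ) = 256 * ((((q * (256 * b) + u : ℕ) : ℤ)) / (256 * b : ℤ)) then 1 else 0)
          = if u < b then 1 else 0 := by
        intro u hu
        rw [Finset.mem_range] at hu
        have e1 : (((q * (256 * b) + u : ℕ) : ℤ)) = u + q * (256 * b) := by push_cast; ring
        rw [e1]
        refine if_congr ?_ rfl rfl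
        rw [sh, Int.ediv_eq_zero_of_lt (b := 256 * (b:ℤ)) (by positivity) (by exact_mod_cast hu), mul_zero]
        constructor
        · intro h
          by_contra hc
          push Not at hc
          have : 1 ≤ (u:ℤ) / b := by
            rw [Int.le_ediv_iff_mul_le (by positivity)]; simpa using hc
          omega
        · intro h
          exact Int.ediv_eq_zero_of_lt (by positivity) (by exact_mod_cast h)
      rw [Finset.sum_congr rfl this, Finset.sum_ite, Finset.sum_const_zero, add_zero, Finset.sum_const, smul_eq_mul, mul_one]
      have : (Finset.range (256 * b)).filter (fun u => u < b) = Finset.range b := by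
        ext u; simp only [Finset.mem_filter, Finset.mem_range]; omega
      rw [this, Finset.card_range]
  · intro w
    refine if_congr ?_ rfl rfl
    have := sh w (-q)
    rw [← this]
    push_cast
    ring_nf

variable {r : ℕ} [NeZero r]

lemma F_intCast (n : ℕ) (w : ℤ) : F r n (w:ℝ) = w / ((r * 256 ^ n : ℕ) : ℤ) := by
  unfold F R
  have : (r:ℝ) * 256 ^ n = ((r * 256 ^ n : ℕ) : ℝ) := by push_cast; ring
  rw [this, Int.floor_div_natCast, Int.floor_intCast]

lemma Ps_mod (f ψ : ℝ → ℂ) (ρ θ u x : ℝ) :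
    Ps f ψ ρ θ x = e (u * x) * Ps (fun y => e (-(u * y)) * f y) ψ ρ (θ - u) x := by
  unfold Ps
  rw [← integral_const_mul]
  congr 1; ext y
  unfold pk
  have : e (θ * (x - y)) = e (u * x) * e ((θ - u) * (x - y)) * e (-(u * y)) := by
    rw [← e_add, ← e_add]; congr 1; ring
  rw [this]; ring

lemma Fok.mod {f : ℝ → ℂ} (hf : Fok f) (u : ℝ) : Fok (fun y => e (-(u * y)) * f y) :=
  ⟨(by fun_prop : Continuous fun y => e (-(u * y))).measurable.mul hf.meas, fun x => by
    rw [norm_mul, norm_e, one_mul]; exact hf.bdd x, fun x hx => by simp only [hf.supp x hx, mul_zero]⟩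

open Classical in
lemma avg_count' {K n : ℕ} (hn : n ∈ Finset.Icc 1 K) (a : ℤ) :
    ∑ u ∈ Finset.range (r * 256 ^ K), (if ch r n ((a:ℝ) - (u:ℕ)) then (1:ℕ) else 0) = r * 256 ^ (K - 1) := by
  rw [Finset.mem_Icc] at hn
  obtain ⟨m, rfl⟩ : ∃ m, n = m + 1 := ⟨n - 1, by omega⟩
  obtain ⟨j, rfl⟩ : ∃ j, K = m + 1 + j := ⟨K - (m + 1), by omega⟩
  have hr : 0 < r := Nat.pos_of_ne_zero (NeZero.ne r)
  have := avg_count (r * 256 ^ m) (256 ^ j) (by positivity) a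
  have e1 : 256 ^ j * (256 * (r * 256 ^ m)) = r * 256 ^ (m + 1 + j) := by rw [pow_add, pow_add]; ring
  have e2 : 256 ^ j * (r * 256 ^ m) = r * 256 ^ (m + 1 + j - 1) := by
    rw [show m + 1 + j - 1 = m + j by omega, pow_add]; ring
  rw [e1, e2] at this
  rw [← this]
  refine Finset.sum_congr rfl fun u _ => if_congr ?_ rfl rfl
  unfold ch
  rw [show ((a:ℝ) - (u:ℕ)) = ((a - u : ℤ) : ℝ) by push_cast; ring, F_intCast, F_intCast, Nat.add_sub_cancel,
    show ((r * 256 ^ (m+1) : ℕ) : ℤ) = 256 * ((r * 256 ^ m : ℕ) : ℤ) by push_cast; ring]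

open Classical in
lemma avg_est (r : ℕ) [NeZero r] {f : ℝ → ℂ} (hf : Fok f) {N : ℝ → ℤ} (hN : Measurable N) {H : ℝ}
    (hH : ∀ x, |(N x : ℝ)| ≤ H) (K : ℕ) :
    ∃ h : ℝ → ℝ≥0∞, Measurable h ∧ ∫⁻ x in Set.Ico (0:ℝ) 1, h x ≤ ENNReal.ofReal (256 * CX) ∧
      ∀ x ∈ Set.Ico (0:ℝ) 1, ‖∑ n ∈ Finset.Icc 1 K, Ps f psi (R r n) (N x) x‖ₑ ≤ h x := by
  rcases Nat.eq_zero_or_pos K with hK | hK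
  · subst hK
    exact ⟨fun _ => 0, measurable_const, by simp, fun x _ => by simp⟩
  have hr : 0 < r := Nat.pos_of_ne_zero (NeZero.ne r)
  set M := r * 256 ^ K with hM
  have hMpos : 0 < M := by positivity
  have hθ : ∀ u : ℕ, Measurable (fun x => (N x : ℝ) - u) := fun u =>
    ((measurable_of_countable (fun z : ℤ => (z:ℝ))).comp hN).sub_const _
  have hb : ∀ u : ℕ, ∀ x, |(N x : ℝ) - u| ≤ H + u := fun u x => by
    refine (abs_sub _ _).trans ?_
    have := hH x
    rw [abs_of_nonneg (show (0:ℝ) ≤ u by positivity)]; linarith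
  choose h hm hi hle using fun u : ℕ => main_est (r := r) (hf.mod u) (hθ u) (hb u) K
  refine ⟨fun x => ENNReal.ofReal (256 / M) * ∑ u ∈ Finset.range M, h u x, 
    (Finset.measurable_fun_sum _ fun u _ => hm u).const_mul _, ?_, fun x hx => ?_⟩
  · rw [lintegral_const_mul _ (Finset.measurable_fun_sum _ fun u _ => hm u), lintegral_finsetSum _ fun u _ => hm u]
    calc _ ≤ ENNReal.ofReal (256 / M) * ∑ u ∈ Finset.range M, ENNReal.ofReal CX := by
          gcongr with u hu; exact hi u
      _ = ENNReal.ofReal (256 / M) * (ENNReal.ofReal M * ENNReal.ofReal CX) := by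
          rw [Finset.sum_const, Finset.card_range, nsmul_eq_mul, ENNReal.ofReal_natCast]
      _ = ENNReal.ofReal (256 * CX) := by
          rw [← mul_assoc, ← ENNReal.ofReal_mul (by positivity), ← ENNReal.ofReal_mul (by positivity)]
          congr 1; field_simp
      _ ≤ _ := le_rfl
  · have key : ∑ n ∈ Finset.Icc 1 K, Ps f psi (R r n) (N x) x = ((256 / M : ℝ) : ℂ) * 
        ∑ u ∈ Finset.range M, e (u * x) * ∑ n ∈ (Finset.Icc 1 K).filter (fun n => ch r n ((N x : ℝ) - u)), 
          Ps (fun y => e (-(u * y)) * f y) psi (R r n) ((N x : ℝ) - u) x := by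
      have h1 : ∀ u : ℕ, e (u * x) * ∑ n ∈ (Finset.Icc 1 K).filter (fun n => ch r n ((N x : ℝ) - u)), 
          Ps (fun y => e (-(u * y)) * f y) psi (R r n) ((N x : ℝ) - u) x = 
          ∑ n ∈ Finset.Icc 1 K, ((if ch r n ((N x : ℝ) - u) then (1:ℕ) else 0 : ℕ) : ℂ) * Ps f psi (R r n) (N x) x := by
        intro u
        rw [Finset.mul_sum, Finset.sum_filter]
        refine Finset.sum_congr rfl fun n _ => ?_
        rw [← Ps_mod]
        split_ifs <;> simp
      simp only [h1]
      rw [Finset.sum_comm, Finset.mul_sum]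
      refine Finset.sum_congr rfl fun n hn => ?_
      rw [← Finset.sum_mul, ← Nat.cast_sum, avg_count' hn (N x), ← mul_assoc]
      have : ((256 / M : ℝ) : ℂ) * ((r * 256 ^ (K - 1) : ℕ) : ℂ) = 1 := by
        have : ((256 / M : ℝ)) * ((r * 256 ^ (K - 1) : ℕ) : ℝ) = 1 := by
          obtain ⟨k, rfl⟩ : ∃ k, K = k + 1 := ⟨K - 1, by omega⟩
          rw [hM, Nat.add_sub_cancel]; push_cast
          have : (r:ℝ) ≠ 0 := by positivity
          field_simp
          ring
        exact_mod_cast this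
      rw [this, one_mul]
    rw [key, enorm_mul]
    refine mul_le_mul' ?_ ?_
    · rw [← ofReal_norm]; refine ENNReal.ofReal_le_ofReal ?_
      rw [Complex.norm_real, Real.norm_of_nonneg (by positivity)]
    · refine (enorm_sum_le _ _).trans (Finset.sum_le_sum fun u _ => ?_)
      rw [enorm_mul, ← ofReal_norm (e _), norm_e, ENNReal.ofReal_one, one_mul]
      exact hle u x hx

end CarlesonProof

end


section
open MeasureTheory
open scoped Real ENNReal
set_option linter.unusedSectionVars false
set_option linter.unusedVariables false
namespace CarlesonProof

/-- trigonometric polynomial of period one -/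
noncomputable def tp (D : ℕ) (c : ℤ → ℂ) (y : ℝ) : ℂ := ∑ n ∈ Finset.Icc (-(D:ℤ)) D, c n * e (n * y)

@[fun_prop] lemma tp_cont (D : ℕ) (c : ℤ → ℂ) : Continuous (tp D c) := by
  unfold tp
  exact continuous_finsetSum _ fun n _ => by fun_prop

/-- the part of the trigonometric polynomial with frequencies `> m` -/
noncomputable def tpGt (D : ℕ) (c : ℤ → ℂ) (m : ℤ) (y : ℝ) : ℂ :=
  ∑ n ∈ Finset.Icc (-(D:ℤ)) D, if m < n then c n * e (n * y) else 0

/-- truncation -/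
noncomputable def trunc (f : ℝ → ℂ) : ℝ → ℂ := (Set.Icc (-1:ℝ) 2).indicator f

lemma trunc_ok {q : ℝ → ℂ} (hq : Continuous q) (hb : ∀ y, ‖q y‖ ≤ 1) : Fok (trunc q) := by
  refine ⟨hq.measurable.indicator measurableSet_Icc, fun x => ?_, fun x hx => ?_⟩
  · unfold trunc
    exact (norm_indicator_le_norm_self _ _).trans (hb x)
  · unfold trunc
    exact Set.indicator_of_notMem hx _

lemma Ps_tp {ψ : ℝ → ℂ} {g : ℝ → ℝ} {C : ℝ} (M : Mother ψ g C) (D : ℕ) (c : ℤ → ℂ) {ρ : ℝ} (hρ : 0 < ρ) (θ x : ℝ) :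
    Ps (tp D c) ψ ρ θ x = ∑ n ∈ Finset.Icc (-(D:ℤ)) D, c n * e (n * x) * g ((n - θ) / ρ) := by
  unfold Ps tp
  simp_rw [Finset.mul_sum]
  rw [integral_finsetSum]
  · refine Finset.sum_congr rfl fun n _ => ?_
    have h := M.FI_pk hρ θ x n
    rw [mul_assoc, mul_comm (n:ℝ) x, ← h, FI, ← integral_const_mul]
    congr 1; ext y; rw [mul_comm y]; ring
  · intro n _
    refine (M.pk_integrable hρ θ x).mul_bdd (c := ‖c n‖) ?_ (Filter.Eventually.of_forall fun y => ?_)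
    · exact (by fun_prop : Continuous fun y : ℝ => c n * e (n * y)).aestronglyMeasurable
    · rw [norm_mul, norm_e, mul_one]

lemma tel_sum (t : ℝ) (K : ℕ) : ∑ k ∈ Finset.Icc 1 K, mm (t / 16 ^ k) = Phi (t / 16 ^ K) - Phi t := by
  induction K with
  | zero => simp
  | succ K ih =>
    rw [Finset.sum_Icc_succ_top (by omega), ih, mm]
    have : 16 * (t / 16 ^ (K + 1)) = t / 16 ^ K := by field_simp; ring
    rw [this]; ring

lemma tpGt_eq (D : ℕ) (c : ℤ → ℂ) (m : ℤ) (K : ℕ) (hK : 4 * (D + |(m:ℝ)|) ≤ 16 ^ K) (x : ℝ) :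
    ∑ k ∈ Finset.Icc 1 K, Ps (tp D c) psi (16 ^ k) m x = tpGt D c m x := by
  have h1 : ∀ k ∈ Finset.Icc 1 K, Ps (tp D c) psi (16 ^ k) m x = 
      ∑ n ∈ Finset.Icc (-(D:ℤ)) D, c n * e (n * x) * (mm ((n - m) / 16 ^ k) : ℂ) := fun k _ =>
    Ps_tp psi_mother D c (by positivity) m x
  rw [Finset.sum_congr rfl h1, Finset.sum_comm]
  unfold tpGt
  refine Finset.sum_congr rfl fun n hn => ?_
  rw [← Finset.mul_sum, ← Complex.ofReal_sum, tel_sum]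
  rw [Finset.mem_Icc] at hn
  have hn2 : (n:ℝ) ≤ D := by exact_mod_cast hn.2
  have h2 : Phi (((n:ℝ) - m) / 16 ^ K) = 1 := by
    apply Phi_one
    rw [div_le_iff₀ (by positivity)]
    have := neg_abs_le (m:ℝ)
    linarith
  rw [h2]
  split_ifs with h
  · have : (m:ℝ) + 1 ≤ n := by exact_mod_cast h
    rw [Phi_zero (by linarith)]; simp
  · have : (n:ℝ) ≤ m := by exact_mod_cast not_lt.1 h
    rw [Phi_one (by linarith)]; simp

lemma trunc_err {q : ℝ → ℂ} (hq : Continuous q) (hb : ∀ y, ‖q y‖ ≤ 1) {ρ : ℝ} (hρ : 1 ≤ ρ) (θ : ℝ) {x : ℝ}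
    (hx : x ∈ Set.Ico (0:ℝ) 1) : ‖Ps q psi ρ θ x - Ps (trunc q) psi ρ θ x‖ ≤ CM * π / ρ := by
  have hρ0 : 0 < ρ := by linarith
  have hCM := CM_pos
  have hint := psi_mother.pk_integrable hρ0 θ x
  unfold Ps
  rw [← integral_sub]
  · have hbd : ∀ y, ‖pk psi ρ θ x y * q y - pk psi ρ θ x y * trunc q y‖ ≤ CM * W (ρ * (x - y)) := by
      intro y
      rw [← mul_sub, norm_mul]
      unfold trunc
      by_cases hy : y ∈ Set.Icc (-1:ℝ) 2
      · rw [Set.indicator_of_mem hy, sub_self, norm_zero, mul_zero]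
        have := W_nonneg (ρ * (x - y)); positivity
      · rw [Set.indicator_of_notMem hy, sub_zero]
        have hW := W_nonneg (ρ * (x - y))
        have h1 : 1 ≤ |x - y| := by
          by_contra hc
          push Not at hc
          rw [abs_lt] at hc
          exact hy ⟨by linarith [hx.1], by linarith [hx.2]⟩
        have h2 : W (ρ * (x - y)) ≤ 1 / ρ := by
          have : W (ρ * (x - y)) ≤ W ρ := W_anti (by rw [abs_mul]; nlinarith [abs_nonneg ρ])
          refine this.trans ((W_le_inv_sq hρ0).trans ?_)
          rw [div_le_div_iff₀ (by positivity) hρ0]; nlinarith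
        calc ‖pk psi ρ θ x y‖ * ‖q y‖ ≤ (CM * (ρ * W (ρ * (x - y)) ^ 2)) * 1 := by
              gcongr
              · exact psi_mother.pk_bound_le hρ0 θ x y (by norm_num)
              · exact hb y
          _ = CM * (ρ * W (ρ * (x - y))) * W (ρ * (x - y)) := by ring
          _ ≤ CM * (ρ * (1 / ρ)) * W (ρ * (x - y)) := by gcongr
          _ = _ := by field_simp
    refine (norm_integral_le_of_norm_le ((W_scale_integrable hρ0 x).const_mul CM) (Filter.Eventually.of_forall hbd)).trans ?_
    rw [integral_const_mul, W_scale_integral hρ0, mul_div_assoc]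
  · exact hint.mul_bdd (c := 1) hq.aestronglyMeasurable (Filter.Eventually.of_forall hb)
  · have := trunc_ok hq hb
    exact hint.mul_bdd (c := 1) this.meas.aestronglyMeasurable (Filter.Eventually.of_forall this.bdd)

lemma sum_odd_even (a : ℕ → ℂ) (L : ℕ) : ∑ k ∈ Finset.Icc 1 (2 * L + 1), a k = a 1 + 
    ((∑ n ∈ Finset.Icc 1 L, a (2 * n)) + ∑ n ∈ Finset.Icc 1 L, a (2 * n + 1)) := by
  induction L with
  | zero => simp
  | succ L ih =>
    rw [show 2 * (L + 1) + 1 = (2 * L + 1) + 1 + 1 by ring, Finset.sum_Icc_succ_top (by omega),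
      Finset.sum_Icc_succ_top (by omega), ih, Finset.sum_Icc_succ_top (by omega), Finset.sum_Icc_succ_top (by omega)]
    rw [show 2 * (L + 1) = 2 * L + 1 + 1 by ring]
    ring

lemma geo16 (K : ℕ) : ∑ k ∈ Finset.Icc 1 K, 1 / (16:ℝ) ^ k ≤ 1 - 1 / 16 ^ K := by
  induction K with
  | zero => simp
  | succ K ih =>
    rw [Finset.sum_Icc_succ_top (by omega)]
    have h : 1 / (16:ℝ) ^ (K + 1) = 1 / 16 ^ K * (1 / 16) := by rw [pow_succ]; field_simp
    have h2 : 0 < 1 / (16:ℝ) ^ K := by positivity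
    rw [h]
    linarith

/-- final constant -/
noncomputable def CY : ℝ := 512 * CX + 2 * (CM * π)

lemma CX_pos : 0 < CX := by unfold CX; linarith [CI_pos]
lemma CY_pos : 0 < CY := by
  unfold CY; have := CX_pos; have := CM_pos; positivity

lemma tpGt_est (D : ℕ) (c : ℤ → ℂ) (hb : ∀ y, ‖tp D c y‖ ≤ 1) {N : ℝ → ℤ} (hN : Measurable N) {H : ℕ}
    (hH : ∀ x, |(N x : ℝ)| ≤ H) :
    ∃ h : ℝ → ℝ≥0∞, Measurable h ∧ ∫⁻ x in Set.Ico (0:ℝ) 1, h x ≤ ENNReal.ofReal CY ∧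
      ∀ x ∈ Set.Ico (0:ℝ) 1, ‖tpGt D c (N x) x‖ₑ ≤ h x := by
  set L := 4 * (D + H) with hL
  have hKL : (4 * (D + H) : ℝ) ≤ 16 ^ (2 * L + 1) := by
    have h1 : 2 * L + 1 < 16 ^ (2 * L + 1) := Nat.lt_pow_self (by norm_num)
    have h2 : 4 * (D + H) ≤ 16 ^ (2 * L + 1) := by omega
    exact_mod_cast h2
  have hok := trunc_ok (tp_cont D c) hb
  haveI : NeZero (16:ℕ) := ⟨by norm_num⟩
  obtain ⟨h1, m1, i1, b1⟩ := avg_est 1 hok hN hH L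
  obtain ⟨h2, m2, i2, b2⟩ := avg_est 16 hok hN hH L
  have hCM := CM_pos
  have hCX := CX_pos
  refine ⟨fun x => (h1 x + h2 x) + ENNReal.ofReal (2 * (CM * π)), (m1.add m2).add_const _, ?_, fun x hx => ?_⟩
  · rw [lintegral_add_right _ measurable_const, lintegral_add_left m1, lintegral_const]
    simp only [MeasurableSet.univ, Measure.restrict_apply, Set.univ_inter, Real.volume_Ico, sub_zero, 
      ENNReal.ofReal_one, mul_one]
    rw [CY, ENNReal.ofReal_add (by positivity) (by positivity), show 512 * CX = 256 * CX + 256 * CX by ring,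
      ENNReal.ofReal_add (by positivity) (by positivity)]
    gcongr
  · have hT := tpGt_eq D c (N x) (2 * L + 1) (by linarith [hH x]) x
    set q := tp D c with hq
    have e1 : tpGt D c (N x) x = (∑ n ∈ Finset.Icc 1 L, Ps (trunc q) psi (R 1 n) (N x) x
        + ∑ n ∈ Finset.Icc 1 L, Ps (trunc q) psi (R 16 n) (N x) x) + (Ps (trunc q) psi (16 ^ 1) (N x) x + 
        ∑ k ∈ Finset.Icc 1 (2 * L + 1), (Ps q psi (16 ^ k) (N x) x - Ps (trunc q) psi (16 ^ k) (N x) x)) := by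
      rw [Finset.sum_sub_distrib, hT, sum_odd_even (fun k => Ps (trunc q) psi (16 ^ k) (N x) x)]
      have a1 : ∀ n : ℕ, R 1 n = 16 ^ (2 * n) := fun n => by
        unfold R; rw [pow_mul]; norm_num
      have a2 : ∀ n : ℕ, R 16 n = 16 ^ (2 * n + 1) := fun n => by
        unfold R; rw [pow_succ, pow_mul]; push_cast; norm_num; ring
      simp only [a1, a2]
      ring
    rw [e1]
    refine (enorm_add_le _ _).trans (add_le_add ((enorm_add_le _ _).trans (add_le_add (b1 x hx) (b2 x hx))) ?_)
    rw [← ofReal_norm]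
    refine ENNReal.ofReal_le_ofReal ?_
    refine (norm_add_le _ _).trans ?_
    have g1 := Ps_bdd psi_mother hok (ρ := 16 ^ 1) (by norm_num) (N x) x
    have g2 : ‖∑ k ∈ Finset.Icc 1 (2 * L + 1), (Ps q psi (16 ^ k) (N x) x - Ps (trunc q) psi (16 ^ k) (N x) x)‖ ≤ CM * π := by
      refine (norm_sum_le _ _).trans ?_
      calc _ ≤ ∑ k ∈ Finset.Icc 1 (2 * L + 1), CM * π * (1 / 16 ^ k) := by
            refine Finset.sum_le_sum fun k _ => ?_
            have := trunc_err (tp_cont D c) hb (ρ := 16 ^ k) (one_le_pow₀ (by norm_num)) (N x) hx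
            rw [mul_one_div]; exact this
        _ ≤ CM * π * 1 := by
            rw [← Finset.mul_sum]
            gcongr
            have := geo16 (2 * L + 1)
            have h : 0 < 1 / (16:ℝ) ^ (2 * L + 1) := by positivity
            linarith
        _ = _ := mul_one _
    linarith

/-- partial sums of trigonometric polynomials -/
noncomputable def tpS (D : ℕ) (c : ℤ → ℂ) (N : ℕ) (y : ℝ) : ℂ :=
  ∑ n ∈ Finset.Icc (-(D:ℤ)) D, if -(N:ℤ) ≤ n ∧ n ≤ N then c n * e (n * y) else 0

lemma tpS_eq (D : ℕ) (c : ℤ → ℂ) (N : ℕ) (y : ℝ) : tpS D c N y = tpGt D c (-N - 1) y - tpGt D c N y := by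
  unfold tpS tpGt
  rw [← Finset.sum_sub_distrib]
  refine Finset.sum_congr rfl fun n _ => ?_
  by_cases h1 : (N:ℤ) < n
  · rw [if_neg (by omega), if_pos (by omega), if_pos h1, sub_self]
  · rw [if_neg h1, sub_zero]
    exact if_congr (by omega) rfl rfl

lemma tpS_meas (D : ℕ) (c : ℤ → ℂ) (N : ℕ) : Continuous (tpS D c N) := by
  unfold tpS
  refine continuous_finsetSum _ fun n _ => ?_
  split_ifs <;> fun_prop

lemma weak_one (D : ℕ) (c : ℤ → ℂ) (hb : ∀ y, ‖tp D c y‖ ≤ 1) (N₁ : ℕ) {lam : ℝ} (hl : 0 < lam) :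
    volume {x | x ∈ Set.Ico (0:ℝ) 1 ∧ ∃ N ≤ N₁, lam < ‖tpS D c N x‖} ≤ ENNReal.ofReal (2 * CY / lam) := by
  classical
  set p : ℝ → ℕ → Prop := fun x N => lam < ‖tpS D c N x‖ with hp
  set N : ℝ → ℕ := fun x => Nat.findGreatest (p x) N₁ with hN
  have hNm : Measurable N := measurable_findGreatest fun k _ =>
    measurableSet_lt measurable_const (tpS_meas D c k).norm.measurable
  have hNle : ∀ x, N x ≤ N₁ := fun x => Nat.findGreatest_le _
  have hNs : ∀ x, (∃ N ≤ N₁, p x N) → p x (N x) := fun x ⟨n, hn, h⟩ => Nat.findGreatest_spec hn h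
  have hNle' : ∀ x, (N x : ℝ) ≤ N₁ := fun x => by exact_mod_cast hNle x
  obtain ⟨h1, m1, i1, b1⟩ := tpGt_est D c hb (N := fun x => -(N x : ℤ) - 1) (H := N₁ + 1)
    ((measurable_of_countable (fun z : ℕ => -(z:ℤ) - 1)).comp hNm) (fun x => by
      have := hNle' x
      push_cast
      rw [abs_le]; constructor <;> linarith [show (0:ℝ) ≤ N x by positivity])
  obtain ⟨h2, m2, i2, b2⟩ := tpGt_est D c hb (N := fun x => (N x : ℤ)) (H := N₁)
    ((measurable_of_countable (fun z : ℕ => (z:ℤ))).comp hNm) (fun x => by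
      have := hNle' x
      push_cast
      rw [abs_of_nonneg (by positivity)]; exact this)
  have hCY := CY_pos
  have hsub : {x | x ∈ Set.Ico (0:ℝ) 1 ∧ ∃ N ≤ N₁, lam < ‖tpS D c N x‖} ⊆ 
      {x | ENNReal.ofReal lam ≤ h1 x + h2 x} ∩ Set.Ico 0 1 := by
    rintro x ⟨hx, hex⟩
    refine ⟨?_, hx⟩
    have hs := hNs x hex
    rw [Set.mem_ofPred_eq]
    calc ENNReal.ofReal lam ≤ ENNReal.ofReal ‖tpS D c (N x) x‖ := ENNReal.ofReal_le_ofReal hs.le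
      _ = ‖tpS D c (N x) x‖ₑ := ofReal_norm _
      _ ≤ _ := by
        rw [tpS_eq]
        exact (enorm_sub_le).trans (add_le_add (b1 x hx) (b2 x hx))
  refine (measure_mono hsub).trans ?_
  have hms : MeasurableSet {x | ENNReal.ofReal lam ≤ h1 x + h2 x} := measurableSet_le measurable_const (m1.add m2)
  rw [← Measure.restrict_apply hms]
  refine (meas_ge_le_lintegral_div (m1.add m2).aemeasurable (by simpa using hl) ENNReal.ofReal_ne_top).trans ?_
  rw [ENNReal.ofReal_div_of_pos hl]
  gcongr
  simp only [Pi.add_apply]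
  rw [lintegral_add_left m1, two_mul, ENNReal.ofReal_add hCY.le hCY.le]
  exact add_le_add i1 i2

lemma weak_tp (D : ℕ) (c : ℤ → ℂ) {δ : ℝ} (hδ : 0 < δ) (hb : ∀ y, ‖tp D c y‖ ≤ δ) (N₁ : ℕ) {lam : ℝ} (hl : 0 < lam) :
    volume {x | x ∈ Set.Ico (0:ℝ) 1 ∧ ∃ N ≤ N₁, lam < ‖tpS D c N x‖} ≤ ENNReal.ofReal (2 * CY * δ / lam) := by
  have e1 : ∀ y, tp D (fun n => (δ⁻¹ : ℝ) * c n) y = (δ⁻¹ : ℝ) * tp D c y := fun y => by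
    unfold tp; rw [Finset.mul_sum]; exact Finset.sum_congr rfl fun n _ => by ring
  have e2 : ∀ N y, tpS D (fun n => (δ⁻¹ : ℝ) * c n) N y = (δ⁻¹ : ℝ) * tpS D c N y := fun N y => by
    unfold tpS; rw [Finset.mul_sum]
    exact Finset.sum_congr rfl fun n _ => by split_ifs <;> ring
  have := weak_one D (fun n => (δ⁻¹ : ℝ) * c n) (fun y => by
    rw [e1, norm_mul, Complex.norm_real, Real.norm_of_nonneg (by positivity), inv_mul_le_iff₀ hδ, mul_one]
    exact hb y) N₁ (lam := lam / δ) (by positivity)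
  refine _root_.le_trans (le_of_eq ?_) (this.trans (le_of_eq ?_))
  · congr 1; ext x
    simp only [Set.mem_ofPred_eq, e2, norm_mul, Complex.norm_real, Real.norm_of_nonneg (inv_pos.2 hδ).le]
    have : ∀ N, (lam / δ < δ⁻¹ * ‖tpS D c N x‖) ↔ lam < ‖tpS D c N x‖ := fun N => by
      rw [div_eq_inv_mul]
      exact mul_lt_mul_iff_right₀ (inv_pos.2 hδ)
    simp only [this]
  · congr 1; field_simp

end CarlesonProof

end


section
open MeasureTheory
open scoped Real ENNReal
set_option linter.unusedSectionVars false
set_option linter.unusedVariables false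
namespace CarlesonProof

lemma e_int_integral (n : ℤ) : ∫ y in (0:ℝ)..1, e (n * y) = if n = 0 then 1 else 0 := by
  split_ifs with h
  · subst h; simp
  · have hc : (2 * π * n * Complex.I : ℂ) ≠ 0 := by
      have : (n:ℂ) ≠ 0 := by exact_mod_cast h
      have := Real.pi_ne_zero
      simp [*]
    have h1 : ∀ y : ℝ, e (n * y) = Complex.exp ((2 * π * n * Complex.I) * y) := fun y => by
      unfold e; congr 1; push_cast; ring
    simp_rw [h1]
    rw [integral_exp_mul_complex hc]
    have h2 : Complex.exp (2 * π * n * Complex.I * (1:ℝ)) = 1 := by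
      rw [← h1, mul_one, e_int]
    rw [h2]; simp

/-- Fourier coefficient, period one -/
noncomputable def cf (f : ℝ → ℂ) (n : ℤ) : ℂ := ∫ y in (0:ℝ)..1, f y * e (-(n * y))
/-- partial sum, period one -/
noncomputable def SN (f : ℝ → ℂ) (N : ℕ) (x : ℝ) : ℂ := ∑ n ∈ Finset.Icc (-(N:ℤ)) N, cf f n * e (n * x)

lemma cf_sub {f g : ℝ → ℂ} (hf : Continuous f) (hg : Continuous g) (n : ℤ) : 
    cf (fun y => f y - g y) n = cf f n - cf g n := by
  unfold cf
  rw [← intervalIntegral.integral_sub]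
  · congr 1; ext y; ring
  · exact (by fun_prop : Continuous fun y => f y * e (-(n * y))).intervalIntegrable _ _
  · exact (by fun_prop : Continuous fun y => g y * e (-(n * y))).intervalIntegrable _ _

lemma SN_sub {f g : ℝ → ℂ} (hf : Continuous f) (hg : Continuous g) (N : ℕ) (x : ℝ) : 
    SN (fun y => f y - g y) N x = SN f N x - SN g N x := by
  unfold SN
  rw [← Finset.sum_sub_distrib]
  exact Finset.sum_congr rfl fun n _ => by rw [cf_sub hf hg]; ring

lemma cf_le {f : ℝ → ℂ} {δ : ℝ} (hb : ∀ y, ‖f y‖ ≤ δ) (n : ℤ) : ‖cf f n‖ ≤ δ := by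
  unfold cf
  have := intervalIntegral.norm_integral_le_of_norm_le_const (a := 0) (b := 1) (C := δ) 
    (f := fun y => f y * e (-(n * y))) (fun y _ => by rw [norm_mul, norm_e, mul_one]; exact hb y)
  simpa using this

lemma SN_le {f : ℝ → ℂ} {δ : ℝ} (hb : ∀ y, ‖f y‖ ≤ δ) (N : ℕ) (x : ℝ) : ‖SN f N x‖ ≤ (2 * N + 1) * δ := by
  unfold SN
  refine (norm_sum_le _ _).trans ?_
  refine (Finset.sum_le_sum (g := fun _ => δ) fun n _ => ?_).trans (le_of_eq ?_)
  · rw [norm_mul, norm_e, mul_one]; exact cf_le hb n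
  · rw [Finset.sum_const, Int.card_Icc, nsmul_eq_mul]
    congr 1
    have : ((N:ℤ) + 1 - -N).toNat = 2 * N + 1 := by omega
    rw [this]; push_cast; ring

lemma SN_cont (f : ℝ → ℂ) (N : ℕ) : Continuous (SN f N) := by
  unfold SN
  exact continuous_finsetSum _ fun n _ => by fun_prop

lemma cf_tp (D : ℕ) (c : ℤ → ℂ) (m : ℤ) : cf (tp D c) m = if m ∈ Finset.Icc (-(D:ℤ)) D then c m else 0 := by
  unfold cf tp
  simp_rw [Finset.sum_mul]
  rw [intervalIntegral.integral_finsetSum]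
  · have : ∀ n ∈ Finset.Icc (-(D:ℤ)) D, ∫ y in (0:ℝ)..1, c n * e (n * y) * e (-(m * y)) = if m = n then c n else 0 := by
      intro n _
      have h : ∀ y : ℝ, c n * e (n * y) * e (-(m * y)) = c n * e ((n - m : ℤ) * y) := fun y => by
        rw [mul_assoc, ← e_add]; congr 2; push_cast; ring
      simp_rw [h]
      rw [intervalIntegral.integral_const_mul, e_int_integral]
      by_cases hh : m = n
      · subst hh; simp
      · rw [if_neg (by omega), if_neg hh, mul_zero]
    rw [Finset.sum_congr rfl this, Finset.sum_ite_eq]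
  · intro n _
    exact (by fun_prop : Continuous fun y : ℝ => c n * e (n * y) * e (-(m * y))).intervalIntegrable _ _

lemma SN_tp (D : ℕ) (c : ℤ → ℂ) (N : ℕ) (x : ℝ) : SN (tp D c) N x = tpS D c N x := by
  unfold SN tpS
  simp_rw [cf_tp]
  rw [← Finset.sum_filter]
  simp_rw [ite_mul, zero_mul]
  rw [← Finset.sum_filter]
  refine Finset.sum_congr ?_ fun _ _ => rfl
  ext n; simp only [Finset.mem_filter, Finset.mem_Icc]; tauto

lemma tpS_large (D : ℕ) (c : ℤ → ℂ) (N : ℕ) (h : D ≤ N) (x : ℝ) : tpS D c N x = tp D c x := by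
  unfold tpS tp
  refine Finset.sum_congr rfl fun n hn => ?_
  rw [Finset.mem_Icc] at hn
  rw [if_pos (by omega)]

lemma dense_tp {f : ℝ → ℂ} (hf : Continuous f) (hp : Function.Periodic f 1) {δ : ℝ} (hδ : 0 < δ) :
    ∃ D c, ∀ y, ‖f y - tp D c y‖ ≤ δ := by
  haveI : Fact ((0:ℝ) < 1) := ⟨one_pos⟩
  let g : C(AddCircle (1:ℝ), ℂ) := ⟨hp.lift, continuous_coinduced_dom.2 hf⟩
  have hg : g ∈ (Submodule.span ℂ (Set.range (fourier (T := (1:ℝ))))).topologicalClosure := by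
    rw [span_fourier_closure_eq_top]; trivial
  rw [← SetLike.mem_coe, Submodule.topologicalClosure_coe, Metric.mem_closure_iff] at hg
  obtain ⟨p, hp', hd⟩ := hg δ hδ
  rw [SetLike.mem_coe, Finsupp.mem_span_range_iff_exists_finsupp] at hp'
  obtain ⟨c, rfl⟩ := hp'
  refine ⟨c.support.sup Int.natAbs, c, fun y => ?_⟩
  have e1 : tp (c.support.sup Int.natAbs) c y = (c.sum fun i a => a • fourier (T := (1:ℝ)) i) (y : AddCircle (1:ℝ)) := by
    unfold tp Finsupp.sum
    rw [ContinuousMap.coe_sum, Finset.sum_apply]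
    rw [← Finset.sum_subset (s₁ := c.support)]
    · refine Finset.sum_congr rfl fun n _ => ?_
      rw [ContinuousMap.coe_smul, Pi.smul_apply, smul_eq_mul, fourier_coe_apply]
      congr 1
      unfold e; congr 1; push_cast; ring
    · intro n hn
      have := Finset.le_sup (f := Int.natAbs) hn
      rw [Finset.mem_Icc]; omega
    · intro n _ hn
      rw [Finsupp.notMem_support_iff.1 hn, zero_mul]
  rw [e1]
  have := (ContinuousMap.dist_apply_le_dist (f := g) (g := c.sum fun i a => a • fourier (T := (1:ℝ)) i) (y : AddCircle (1:ℝ))).trans hd.le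
  rw [dist_eq_norm] at this
  exact this

lemma weak_cont {f : ℝ → ℂ} (hf : Continuous f) (hp : Function.Periodic f 1) {δ lam : ℝ} (hδ : 0 < δ) 
    (hl : δ ≤ lam) (hb : ∀ y, ‖f y‖ ≤ δ) :
    volume {x | x ∈ Set.Ico (0:ℝ) 1 ∧ ∃ N, 2 * lam < ‖SN f N x‖} ≤ ENNReal.ofReal (4 * CY * δ / lam) := by
  have hl0 : 0 < lam := by linarith
  have hU : {x | x ∈ Set.Ico (0:ℝ) 1 ∧ ∃ N, 2 * lam < ‖SN f N x‖} = 
      ⋃ N₁ : ℕ, {x | x ∈ Set.Ico (0:ℝ) 1 ∧ ∃ N ≤ N₁, 2 * lam < ‖SN f N x‖} := by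
    ext x
    simp only [Set.mem_ofPred_eq, Set.mem_iUnion]
    constructor
    · rintro ⟨hx, N, hN⟩; exact ⟨N, hx, N, _root_.le_refl _, hN⟩
    · rintro ⟨_, hx, N, _, hN⟩; exact ⟨hx, N, hN⟩
  rw [hU, Monotone.measure_iUnion]
  · refine iSup_le fun N₁ => ?_
    obtain ⟨D, c, hD⟩ := dense_tp hf hp (δ := δ / (2 * N₁ + 1)) (by positivity)
    have hD' : ∀ y, ‖f y - tp D c y‖ ≤ δ := fun y => (hD y).trans (div_le_self hδ.le (by linarith [show (0:ℝ) ≤ N₁ by positivity]))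
    have hq : ∀ y, ‖tp D c y‖ ≤ 2 * δ := fun y => by
      have : tp D c y = f y - (f y - tp D c y) := by ring
      rw [this]
      refine (norm_sub_le _ _).trans ?_
      linarith [hb y, hD' y]
    refine (measure_mono ?_).trans ((weak_tp D c (by positivity : 0 < 2 * δ) hq N₁ hl0).trans (le_of_eq ?_))
    · rintro x ⟨hx, N, hN, hlt⟩
      refine ⟨hx, N, hN, ?_⟩
      have h1 := SN_le hD N x
      rw [SN_sub hf (tp_cont D c), SN_tp] at h1
      have h2 : (2 * (N:ℝ) + 1) * (δ / (2 * N₁ + 1)) ≤ δ := by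
        rw [← mul_div_assoc, div_le_iff₀ (by positivity), mul_comm]
        have : (N:ℝ) ≤ N₁ := by exact_mod_cast hN
        gcongr
      have h3 := norm_sub_norm_le (SN f N x) (tpS D c N x)
      linarith
    · congr 1; ring
  · intro a b hab x hx
    obtain ⟨hx, N, hN, h⟩ := hx
    exact ⟨hx, N, hN.trans hab, h⟩

lemma carleson_one {f : ℝ → ℂ} (hf : Continuous f) (hp : Function.Periodic f 1) {ε η : ℝ} (hε : 0 < ε) (hη : 0 < η) :
    ∃ E : Set ℝ, MeasurableSet E ∧ volume E ≤ ENNReal.ofReal η ∧ ∃ N₀ : ℕ, 0 < N₀ ∧ 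
      ∀ x ∈ Set.Ico (0:ℝ) 1 \ E, ∀ N : ℕ, N₀ < N → ‖f x - SN f N x‖ ≤ ε := by
  have hCY := CY_pos
  set δ := min (ε / 4) (η * (ε / 4) / (4 * CY)) with hδd
  have hδ : 0 < δ := by positivity
  obtain ⟨D, c, hD⟩ := dense_tp hf hp hδ
  have hper : Function.Periodic (tp D c) 1 := fun y => by
    unfold tp
    refine Finset.sum_congr rfl fun n _ => ?_
    rw [mul_add, mul_one, e_add, e_int, mul_one]
  have hcont : Continuous (fun y => f y - tp D c y) := by fun_prop
  refine ⟨{x | x ∈ Set.Ico (0:ℝ) 1 ∧ ∃ N, 2 * (ε / 4) < ‖SN (fun y => f y - tp D c y) N x‖}, ?_, ?_, D + 1, by omega, ?_⟩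
  · have : {x | x ∈ Set.Ico (0:ℝ) 1 ∧ ∃ N, 2 * (ε / 4) < ‖SN (fun y => f y - tp D c y) N x‖} = 
      Set.Ico 0 1 ∩ ⋃ N, {x | 2 * (ε / 4) < ‖SN (fun y => f y - tp D c y) N x‖} := by
      ext x; simp
    rw [this]
    exact measurableSet_Ico.inter (MeasurableSet.iUnion fun N => measurableSet_lt measurable_const (SN_cont _ N).norm.measurable)
  · refine (weak_cont hcont (fun y => by simp only [hp y, hper y]) hδ (min_le_left _ _) hD).trans (ENNReal.ofReal_le_ofReal ?_)
    have : δ ≤ η * (ε / 4) / (4 * CY) := min_le_right _ _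
    rw [le_div_iff₀ (by positivity)] at this
    rw [div_le_iff₀ (by positivity)]
    linarith
  · rintro x ⟨hx, hxE⟩ N hN
    rw [Set.mem_ofPred_eq] at hxE
    push Not at hxE
    have h1 := hxE hx N
    rw [SN_sub hf (tp_cont D c), SN_tp, tpS_large D c N (by omega)] at h1
    have h2 := hD x
    have h3 : δ ≤ ε / 4 := min_le_left _ _
    have : f x - SN f N x = (f x - tp D c x) - (SN f N x - tp D c x) := by ring
    rw [this]
    refine (norm_sub_le _ _).trans ?_
    linarith

end CarlesonProof

end

/-- **Classical Carleson with exceptional sets**: for a `2π`-periodic continuous function `f`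
and every `ε > 0`, there is a Borel set `E ⊆ [0, 2π]` of measure at most `ε` and a positive
integer `N₀` so that `|f(x) - S_N f(x)| ≤ ε` for all `x ∈ [0, 2π] \ E` and all `N > N₀`. -/
theorem exceptional_set_carleson {f : ℝ → ℂ} (cont_f : Continuous f)
    (periodic_f : Function.Periodic f (2 * π)) {ε : ℝ} (hε : 0 < ε) :
    ∃ E ⊆ Set.Icc 0 (2 * π), MeasurableSet E ∧ volume E ≤ ENNReal.ofReal ε ∧
      ∃ N₀ : ℕ, 0 < N₀ ∧ ∀ x ∈ Set.Icc 0 (2 * π) \ E, ∀ N : ℕ, N₀ < N →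
        ‖f x - partialFourierSum N f x‖ ≤ ε := by
  classical
  have h2π : (0:ℝ) < 2 * π := by positivity
  set g : ℝ → ℂ := fun t => f (2 * π * t) with hg
  have hgc : Continuous g := by fun_prop
  have hgp : Function.Periodic g 1 := fun t => by
    simp only [hg, mul_add, mul_one]; exact periodic_f _
  obtain ⟨E, hE, hEv, N₀, hN₀, hN⟩ := CarlesonProof.carleson_one hgc hgp hε (div_pos hε h2π)
  have hS : ∀ N : ℕ, ∀ x : ℝ, partialFourierSum N f x = CarlesonProof.SN g N ((2 * π)⁻¹ * x) := by
    intro N x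
    unfold partialFourierSum CarlesonProof.SN
    refine Finset.sum_congr rfl fun n _ => ?_
    have e2 : Complex.exp (Complex.I * (n : ℂ) * (x : ℂ)) = CarlesonProof.e (n * ((2 * π)⁻¹ * x)) := by
      unfold CarlesonProof.e
      congr 1
      have : (2 * π * (n * ((2 * π)⁻¹ * x)) : ℝ) = n * x := by field_simp
      rw [this]; push_cast; ring
    rw [e2]
    congr 1
    unfold CarlesonProof.cf
    have e3 : ∀ y : ℝ, g y * CarlesonProof.e (-(n * y)) = (fun z : ℝ => f z * Complex.exp (-(Complex.I * (n : ℂ) * (z : ℂ)))) (2 * π * y) := by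
      intro y
      simp only [hg]
      congr 1
      unfold CarlesonProof.e
      congr 1
      push_cast; ring
    simp_rw [e3]
    rw [intervalIntegral.integral_comp_mul_left (fun z : ℝ => f z * Complex.exp (-(Complex.I * (n : ℂ) * (z : ℂ)))) h2π.ne', mul_zero, mul_one, Complex.real_smul]
  refine ⟨((fun x => (2 * π)⁻¹ * x) ⁻¹' E ∩ Set.Icc 0 (2 * π)) ∪ {2 * π}, ?_, ?_, ?_, N₀, hN₀, ?_⟩
  · rintro x (hx | hx)
    · exact hx.2
    · rw [Set.mem_singleton_iff] at hx
      subst hx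
      exact ⟨h2π.le, le_rfl⟩
  · exact ((measurable_const_mul _ hE).inter measurableSet_Icc).union (measurableSet_singleton _)
  · refine (measure_union_le _ _).trans ?_
    rw [Real.volume_singleton, add_zero]
    refine (measure_mono Set.inter_subset_left).trans ?_
    rw [Real.volume_preimage_mul_left (inv_pos.2 h2π).ne', inv_inv, abs_of_pos h2π]
    refine (mul_le_mul' le_rfl hEv).trans (le_of_eq ?_)
    rw [← ENNReal.ofReal_mul h2π.le]
    congr 1; field_simp
  · rintro x ⟨hx, hxE⟩ N hNN
    rw [hS]
    have hx1 : x ≠ 2 * π := fun h => hxE (Or.inr h)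
    have hx2 : x < 2 * π := lt_of_le_of_ne hx.2 hx1
    have hmem : (2 * π)⁻¹ * x ∈ Set.Ico (0:ℝ) 1 \ E := by
      refine ⟨⟨mul_nonneg (inv_pos.2 h2π).le hx.1, ?_⟩, fun h => hxE (Or.inl ⟨h, hx⟩)⟩
      rw [inv_mul_lt_iff₀ h2π, mul_one]; exact hx2
    have := hN _ hmem N hNN
    simp only [hg] at this
    rwa [mul_inv_cancel_left₀ h2π.ne'] at this
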